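/- Let D ⊂ ℝ^N be a bounded open set satisfying the exterior cone condition: for every z ∈ ∂D there exist a nonempty open cone C with vertex z and r > 0 such that C ∩ B(z,r) ⊆ ℝ^N ∖ D. Then for every bounded continuous f : ℝ^N ∖ D → [0,∞) there exists exactly one bounded continuous function u : ℝ^N → [0,∞) such that u = f on ℝ^N ∖ D, the function x ↦ ρ(x)·φ(u(x)) is locally integrable on D, and Δ^{α/2}u = −ρ·φ(u) holds in the distributional sense on D. -/

import Mathlib

open MeasureTheory Real Filter Topology
open scoped ENNReal

noncomputable section

/-- The constant `c_{N,-α} = 2^α · π^{-N/2} · Γ((N+α)/2) / |Γ(-α/2)|`. -/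
def fracLapCoeff (N : ℕ) (α : ℝ) : ℝ :=
  2 ^ α * Real.pi ^ (-(N : ℝ) / 2) * Real.Gamma (((N : ℝ) + α) / 2) / |Real.Gamma (-α / 2)|

/-- The fractional Laplacian `Δ^{α/2}θ` of a test function `θ`. -/
def fracLap (N : ℕ) (α : ℝ) (θ : EuclideanSpace ℝ (Fin N) → ℝ)
    (x : EuclideanSpace ℝ (Fin N)) : ℝ :=
  (fracLapCoeff N α / 2) *
    ∫ z : EuclideanSpace ℝ (Fin N), (θ (x + z) + θ (x - z) - 2 * θ x) / ‖z‖ ^ ((N : ℝ) + α)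

/-- A nonnegative entire bounded (distributional) solution of `-Δ^{α/2}u = ρ·φ(u)` on
`ℝ^N`; here `φ : ℝ → ℝ≥0∞` is extended-real-valued (`φ(0)` may be `∞`), the local
integrability of `ρ·φ(u)` is expressed via the lower integral. -/
def NegEntireSol (N : ℕ) (α : ℝ) (ρ : EuclideanSpace ℝ (Fin N) → ℝ) (φ : ℝ → ℝ≥0∞)
    (u : EuclideanSpace ℝ (Fin N) → ℝ) : Prop :=
  Continuous u ∧ (∃ M, ∀ x, u x ≤ M) ∧ (∀ x, 0 ≤ u x) ∧
  (∀ K : Set (EuclideanSpace ℝ (Fin N)), IsCompact K →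
    (∫⁻ x in K, ENNReal.ofReal (ρ x) * φ (u x)) ≠ ⊤) ∧
  ∀ θ : EuclideanSpace ℝ (Fin N) → ℝ, ContDiff ℝ (⊤ : ℕ∞) θ → HasCompactSupport θ →
    (∫ x, u x * fracLap N α θ x) =
      -∫ x, (ENNReal.ofReal (ρ x) * φ (u x)).toReal * θ x

/-- The kernel `c_{N,-α} |z|^{-(N+α)}` of the fractional Laplacian, capped at height
`c_{N,-α} δ^{-(N+α)}` near the origin. -/
def fracKernel (N : ℕ) (α δ : ℝ) (z : EuclideanSpace ℝ (Fin N)) : ℝ :=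
  fracLapCoeff N α * (max ‖z‖ δ) ^ (-((N : ℝ) + α))

section Kernel

variable {N : ℕ} {α : ℝ}

theorem fracLapCoeff_pos (hα1 : 0 < α) (hα2 : α < 2) : 0 < fracLapCoeff N α := by
  have h1 : 0 < Real.Gamma (((N : ℝ) + α) / 2) := Real.Gamma_pos_of_pos (by positivity)
  have h2 : Real.Gamma (-α / 2) ≠ 0 := by
    apply Real.Gamma_ne_zero
    intro m hm
    have h3 : α = 2 * m := by linarith
    rcases Nat.eq_zero_or_pos m with h | h
    · subst h; simp at h3; linarith
    · have : (1 : ℝ) ≤ m := by exact_mod_cast h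
      linarith
  unfold fracLapCoeff
  positivity

theorem fracKernel_nonneg (hα1 : 0 < α) (hα2 : α < 2) (δ : ℝ) (z : EuclideanSpace ℝ (Fin N)) :
    0 ≤ fracKernel N α δ z :=
  mul_nonneg (fracLapCoeff_pos hα1 hα2).le
    (Real.rpow_nonneg (le_max_of_le_left (norm_nonneg z)) _)

theorem fracKernel_neg (δ : ℝ) (z : EuclideanSpace ℝ (Fin N)) :
    fracKernel N α δ (-z) = fracKernel N α δ z := by
  simp [fracKernel]

theorem measurable_fracKernel (δ : ℝ) : Measurable (fracKernel N α δ) := by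
  unfold fracKernel
  fun_prop

theorem fracKernel_eq_of_le {δ : ℝ} {z : EuclideanSpace ℝ (Fin N)} (h : δ ≤ ‖z‖) :
    fracKernel N α δ z = fracKernel N α 0 z := by
  simp [fracKernel, max_eq_left h]

theorem fracKernel_le (hα1 : 0 < α) (hα2 : α < 2) {δ : ℝ} {z : EuclideanSpace ℝ (Fin N)}
    (hz : z ≠ 0) : fracKernel N α δ z ≤ fracKernel N α 0 z := by
  have hz' : 0 < ‖z‖ := norm_pos_iff.2 hz
  unfold fracKernel
  apply mul_le_mul_of_nonneg_left _ (fracLapCoeff_pos hα1 hα2).le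
  rw [max_eq_left (norm_nonneg z)]
  apply Real.rpow_le_rpow_of_nonpos hz' (le_max_left _ _)
  have : (0:ℝ) ≤ N := by positivity
  linarith

theorem le_fracKernel (hα1 : 0 < α) (hα2 : α < 2) {δ r : ℝ} {z : EuclideanSpace ℝ (Fin N)}
    (hδ : 0 < δ) (hδr : δ ≤ r) (hz : ‖z‖ ≤ r) :
    fracLapCoeff N α * r ^ (-((N : ℝ) + α)) ≤ fracKernel N α δ z := by
  unfold fracKernel
  apply mul_le_mul_of_nonneg_left _ (fracLapCoeff_pos hα1 hα2).le
  apply Real.rpow_le_rpow_of_nonpos (lt_max_of_lt_right hδ) (max_le hz hδr)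
  have : (0:ℝ) ≤ N := by positivity
  linarith

theorem tendsto_fracKernel {ι : Type*} {l : Filter ι} {δ : ι → ℝ} (hδ : Tendsto δ l (𝓝 0))
    {z : EuclideanSpace ℝ (Fin N)} (hz : z ≠ 0) :
    Tendsto (fun i => fracKernel N α (δ i) z) l (𝓝 (fracKernel N α 0 z)) := by
  have hz' : 0 < ‖z‖ := norm_pos_iff.2 hz
  apply tendsto_nhds_of_eventually_eq
  filter_upwards [hδ.eventually_le_const hz'] with i hi
  exact fracKernel_eq_of_le hi

theorem integrable_min_mul_fracKernel_zero (hN : 0 < N) (hα1 : 0 < α) (hα2 : α < 2) :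
    Integrable (fun z : EuclideanSpace ℝ (Fin N) => min (‖z‖ ^ 2) 1 * fracKernel N α 0 z) := by
  have : Nonempty (Fin N) := ⟨⟨0, hN⟩⟩
  have hfin : Module.finrank ℝ (EuclideanSpace ℝ (Fin N)) = N := by simp
  have key := integrable_fun_norm_addHaar (volume : Measure (EuclideanSpace ℝ (Fin N)))
    (f := fun r : ℝ => min (r ^ 2) 1 * (fracLapCoeff N α * (max r 0) ^ (-((N : ℝ) + α))))
  refine key.2 ?_
  rw [hfin]
  rw [← Set.Ioc_union_Ioi_eq_Ioi (zero_le_one' ℝ)]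
  refine IntegrableOn.union ?_ ?_
  · have h1 : IntegrableOn (fun r : ℝ => fracLapCoeff N α * r ^ (1 - α)) (Set.Ioc 0 1) := by
      apply Integrable.const_mul
      have := intervalIntegral.intervalIntegrable_rpow' (r := 1 - α) (a := 0) (b := 1)
        (by linarith)
      rwa [intervalIntegrable_iff_integrableOn_Ioc_of_le zero_le_one] at this
    refine h1.congr_fun ?_ measurableSet_Ioc
    intro r hr
    have hr0 : 0 < r := hr.1
    have hr1 : r ^ 2 ≤ 1 := by nlinarith [hr.2]
    simp only [min_eq_left hr1, max_eq_left hr0.le, smul_eq_mul]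
    have e : r ^ (1 - α) = r ^ (N - 1) * (r ^ 2 * r ^ (-((N : ℝ) + α))) := by
      rw [← Real.rpow_natCast r (N - 1), ← Real.rpow_natCast r 2, ← Real.rpow_add hr0,
        ← Real.rpow_add hr0]
      congr 1
      rw [Nat.cast_sub hN]
      push_cast; ring
    rw [e]; ring
  · have h1 : IntegrableOn (fun r : ℝ => fracLapCoeff N α * r ^ (-1 - α)) (Set.Ioi 1) := by
      apply Integrable.const_mul
      exact integrableOn_Ioi_rpow_of_lt (by linarith) zero_lt_one
    refine h1.congr_fun ?_ measurableSet_Ioi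
    intro r hr
    have hr1' : 1 < r := hr
    have hr0 : 0 < r := by linarith
    have hr1 : 1 ≤ r ^ 2 := by nlinarith
    simp only [min_eq_right hr1, max_eq_left hr0.le, smul_eq_mul]
    have e : r ^ (-1 - α) = r ^ (N - 1) * r ^ (-((N : ℝ) + α)) := by
      rw [← Real.rpow_natCast r (N - 1), ← Real.rpow_add hr0]
      congr 1
      rw [Nat.cast_sub hN]
      push_cast; ring
    rw [e]; ring

theorem min_mul_fracKernel_le (hα1 : 0 < α) (hα2 : α < 2) (δ : ℝ)
    (z : EuclideanSpace ℝ (Fin N)) :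
    min (‖z‖ ^ 2) 1 * fracKernel N α δ z ≤ min (‖z‖ ^ 2) 1 * fracKernel N α 0 z := by
  rcases eq_or_ne z 0 with h | h
  · simp [h]
  · exact mul_le_mul_of_nonneg_left (fracKernel_le hα1 hα2 h) (by positivity)

theorem integrable_min_mul_fracKernel (hN : 0 < N) (hα1 : 0 < α) (hα2 : α < 2) (δ : ℝ) :
    Integrable (fun z : EuclideanSpace ℝ (Fin N) => min (‖z‖ ^ 2) 1 * fracKernel N α δ z) := by
  refine (integrable_min_mul_fracKernel_zero hN hα1 hα2).mono' ?_ ?_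
  · exact ((by fun_prop : Measurable fun z : EuclideanSpace ℝ (Fin N) => min (‖z‖ ^ 2) 1).mul
      (measurable_fracKernel δ)).aestronglyMeasurable
  · refine Eventually.of_forall fun z => ?_
    rw [Real.norm_of_nonneg (mul_nonneg (by positivity) (fracKernel_nonneg hα1 hα2 _ _))]
    exact min_mul_fracKernel_le hα1 hα2 δ z

theorem integrable_fracKernel (hα1 : 0 < α) (hα2 : α < 2) {δ : ℝ}
    (hδ : 0 < δ) : Integrable (fracKernel N α δ) := by
  have hfin : Module.finrank ℝ (EuclideanSpace ℝ (Fin N)) = N := by simp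
  have hp : (0:ℝ) < N + α := by positivity
  have h1 := (integrable_one_add_norm (E := EuclideanSpace ℝ (Fin N))
    (μ := volume) (r := (N : ℝ) + α) (by rw [hfin]; linarith)).const_mul
      (fracLapCoeff N α * (min 1 δ / 2) ^ (-((N : ℝ) + α)))
  refine h1.mono' (measurable_fracKernel δ).aestronglyMeasurable (Eventually.of_forall fun z => ?_)
  rw [Real.norm_of_nonneg (fracKernel_nonneg hα1 hα2 _ _), mul_assoc]
  refine mul_le_mul_of_nonneg_left ?_ (fracLapCoeff_pos hα1 hα2).le
  rw [← Real.mul_rpow (by positivity) (by positivity)]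
  apply Real.rpow_le_rpow_of_nonpos (by positivity) _ (by linarith)
  have h2 : min 1 δ * ‖z‖ ≤ ‖z‖ := mul_le_of_le_one_left (norm_nonneg z) (min_le_left _ _)
  have h3 := min_le_right 1 δ
  have h4 := le_max_left ‖z‖ δ
  have h5 := le_max_right ‖z‖ δ
  linarith

/-- The total mass of `min (|z|²/r²) 1` against the kernel at `r = 1`. -/
def fracMass (N : ℕ) (α : ℝ) : ℝ :=
  ∫ z : EuclideanSpace ℝ (Fin N), min (‖z‖ ^ 2) 1 * fracKernel N α 0 z

theorem fracMass_nonneg (hα1 : 0 < α) (hα2 : α < 2) : 0 ≤ fracMass N α :=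
  integral_nonneg fun z => mul_nonneg (by positivity) (fracKernel_nonneg hα1 hα2 _ _)

theorem fracKernel_zero_smul {r : ℝ} (hr : 0 < r) (z : EuclideanSpace ℝ (Fin N)) :
    fracKernel N α 0 (r • z) = r ^ (-((N : ℝ) + α)) * fracKernel N α 0 z := by
  simp only [fracKernel, norm_smul, Real.norm_of_nonneg hr.le]
  rw [max_eq_left (by positivity), max_eq_left (by positivity),
    Real.mul_rpow hr.le (norm_nonneg z)]
  ring

theorem integrable_min_div_mul_fracKernel_zero (hN : 0 < N) (hα1 : 0 < α) (hα2 : α < 2) {r : ℝ}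
    (hr : 0 < r) : Integrable (fun z : EuclideanSpace ℝ (Fin N) =>
      min (‖z‖ ^ 2 / r ^ 2) 1 * fracKernel N α 0 z) := by
  rw [← integrable_comp_smul_iff volume _ hr.ne']
  have : (fun z : EuclideanSpace ℝ (Fin N) =>
      min (‖r • z‖ ^ 2 / r ^ 2) 1 * fracKernel N α 0 (r • z)) = fun z =>
        r ^ (-((N : ℝ) + α)) * (min (‖z‖ ^ 2) 1 * fracKernel N α 0 z) := by
    ext z
    rw [fracKernel_zero_smul hr, norm_smul, Real.norm_of_nonneg hr.le, mul_pow,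
      mul_div_cancel_left₀ _ (by positivity)]
    ring
  rw [this]
  exact (integrable_min_mul_fracKernel_zero hN hα1 hα2).const_mul _

theorem integral_min_div_mul_fracKernel_zero {r : ℝ}
    (hr : 0 < r) : ∫ z : EuclideanSpace ℝ (Fin N),
      min (‖z‖ ^ 2 / r ^ 2) 1 * fracKernel N α 0 z = r ^ (-α) * fracMass N α := by
  have h := Measure.integral_comp_smul (volume : Measure (EuclideanSpace ℝ (Fin N)))
    (fun z : EuclideanSpace ℝ (Fin N) => min (‖z‖ ^ 2 / r ^ 2) 1 * fracKernel N α 0 z) r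
  have : (fun z : EuclideanSpace ℝ (Fin N) =>
      min (‖r • z‖ ^ 2 / r ^ 2) 1 * fracKernel N α 0 (r • z)) = fun z =>
        r ^ (-((N : ℝ) + α)) * (min (‖z‖ ^ 2) 1 * fracKernel N α 0 z) := by
    ext z
    rw [fracKernel_zero_smul hr, norm_smul, Real.norm_of_nonneg hr.le, mul_pow,
      mul_div_cancel_left₀ _ (by positivity)]
    ring
  rw [this, integral_const_mul] at h
  simp only [finrank_euclideanSpace, Fintype.card_fin, smul_eq_mul] at h
  rw [abs_of_pos (by positivity)] at h
  have e : r ^ (-α) = r ^ N * r ^ (-((N : ℝ) + α)) := by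
    rw [← Real.rpow_natCast r N, ← Real.rpow_add hr]; congr 1; ring
  rw [e, fracMass, mul_assoc, h, ← mul_assoc, mul_inv_cancel₀ (by positivity), one_mul]

theorem integral_min_div_mul_fracKernel_le (hN : 0 < N) (hα1 : 0 < α) (hα2 : α < 2)
    (δ : ℝ) {r : ℝ} (hr : 0 < r) :
    Integrable (fun z : EuclideanSpace ℝ (Fin N) =>
      min (‖z‖ ^ 2 / r ^ 2) 1 * fracKernel N α δ z) ∧
    ∫ z : EuclideanSpace ℝ (Fin N),
      min (‖z‖ ^ 2 / r ^ 2) 1 * fracKernel N α δ z ≤ r ^ (-α) * fracMass N α := by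
  have hle : ∀ z : EuclideanSpace ℝ (Fin N), min (‖z‖ ^ 2 / r ^ 2) 1 * fracKernel N α δ z ≤
      min (‖z‖ ^ 2 / r ^ 2) 1 * fracKernel N α 0 z := by
    intro z
    rcases eq_or_ne z 0 with h | h
    · simp [h]
    · exact mul_le_mul_of_nonneg_left (fracKernel_le hα1 hα2 h) (by positivity)
  have hi : Integrable (fun z : EuclideanSpace ℝ (Fin N) =>
      min (‖z‖ ^ 2 / r ^ 2) 1 * fracKernel N α δ z) := by
    refine (integrable_min_div_mul_fracKernel_zero hN hα1 hα2 hr).mono' ?_ ?_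
    · exact ((by fun_prop :
        Measurable fun z : EuclideanSpace ℝ (Fin N) => min (‖z‖ ^ 2 / r ^ 2) 1).mul
        (measurable_fracKernel δ)).aestronglyMeasurable
    · refine Eventually.of_forall fun z => ?_
      rw [Real.norm_of_nonneg (mul_nonneg (by positivity) (fracKernel_nonneg hα1 hα2 _ _))]
      exact hle z
  refine ⟨hi, ?_⟩
  rw [← integral_min_div_mul_fracKernel_zero hr]
  exact integral_mono hi (integrable_min_div_mul_fracKernel_zero hN hα1 hα2 hr) hle

end Kernel

section JumpOperator

variable {N : ℕ}

/-- Bounded Borel functions on `ℝ^N`. -/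
def BddMeas (u : EuclideanSpace ℝ (Fin N) → ℝ) : Prop :=
  Measurable u ∧ ∃ C, ∀ x, |u x| ≤ C

theorem BddMeas.add {u v : EuclideanSpace ℝ (Fin N) → ℝ} (hu : BddMeas u) (hv : BddMeas v) :
    BddMeas (fun x => u x + v x) := by
  obtain ⟨hum, C, hC⟩ := hu
  obtain ⟨hvm, C', hC'⟩ := hv
  exact ⟨hum.add hvm, C + C', fun x => (abs_add_le _ _).trans (add_le_add (hC x) (hC' x))⟩

theorem bddMeas_const (a : ℝ) : BddMeas (fun _ : EuclideanSpace ℝ (Fin N) => a) :=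
  ⟨measurable_const, |a|, fun _ => le_rfl⟩

theorem BddMeas.const_mul {u : EuclideanSpace ℝ (Fin N) → ℝ} (hu : BddMeas u) (a : ℝ) :
    BddMeas (fun x => a * u x) := by
  obtain ⟨hum, C, hC⟩ := hu
  refine ⟨hum.const_mul a, |a| * C, fun x => ?_⟩
  rw [abs_mul]
  exact mul_le_mul_of_nonneg_left (hC x) (abs_nonneg a)

theorem BddMeas.neg {u : EuclideanSpace ℝ (Fin N) → ℝ} (hu : BddMeas u) :
    BddMeas (fun x => -u x) := by
  obtain ⟨hum, C, hC⟩ := hu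
  exact ⟨hum.neg, C, fun x => by rw [abs_neg]; exact hC x⟩

theorem BddMeas.sub {u v : EuclideanSpace ℝ (Fin N) → ℝ} (hu : BddMeas u) (hv : BddMeas v) :
    BddMeas (fun x => u x - v x) := by
  simpa only [sub_eq_add_neg] using hu.add hv.neg

theorem BddMeas.comp_add {u : EuclideanSpace ℝ (Fin N) → ℝ} (hu : BddMeas u)
    (t : EuclideanSpace ℝ (Fin N)) : BddMeas (fun x => u (x + t)) := by
  obtain ⟨hum, C, hC⟩ := hu
  exact ⟨hum.comp (measurable_add_const t), C, fun x => hC _⟩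

theorem BddMeas.indicator {u : EuclideanSpace ℝ (Fin N) → ℝ} (hu : BddMeas u)
    {s : Set (EuclideanSpace ℝ (Fin N))} (hs : MeasurableSet s) : BddMeas (s.indicator u) := by
  obtain ⟨hum, C, hC⟩ := hu
  refine ⟨hum.indicator hs, C, fun x => ?_⟩
  by_cases hx : x ∈ s
  · simpa [hx] using hC x
  · simpa [hx] using (abs_nonneg _).trans (hC x)

theorem BddMeas.integrable_mul {u J : EuclideanSpace ℝ (Fin N) → ℝ} (hu : BddMeas u)
    (hJ : Integrable J) (x : EuclideanSpace ℝ (Fin N)) :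
    Integrable (fun z => J z * u (x + z)) := by
  obtain ⟨hum, C, hC⟩ := hu
  exact hJ.mul_bdd (hum.comp (measurable_const_add x)).aestronglyMeasurable
    (Eventually.of_forall fun z => hC _)

/-- The generator `u ↦ ∫ J(z) (u(x+z) - u(x)) dz` of the jump process with jump kernel `J`. -/
def jumpOp (J u : EuclideanSpace ℝ (Fin N) → ℝ) (x : EuclideanSpace ℝ (Fin N)) : ℝ :=
  ∫ z, J z * (u (x + z) - u x)

variable {J : EuclideanSpace ℝ (Fin N) → ℝ}

theorem BddMeas.integrable_jump {u : EuclideanSpace ℝ (Fin N) → ℝ} (hu : BddMeas u)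
    (hJ : Integrable J) (x : EuclideanSpace ℝ (Fin N)) :
    Integrable (fun z => J z * (u (x + z) - u x)) :=
  (hu.sub (bddMeas_const (u x))).integrable_mul hJ x

theorem jumpOp_eq {u : EuclideanSpace ℝ (Fin N) → ℝ} (hu : BddMeas u)
    (hJ : Integrable J) (x : EuclideanSpace ℝ (Fin N)) :
    jumpOp J u x = (∫ z, J z * u (x + z)) - (∫ z, J z) * u x := by
  simp only [jumpOp, mul_sub]
  rw [integral_sub (hu.integrable_mul hJ x) (hJ.mul_const _), integral_mul_const]

theorem jumpOp_add {u v : EuclideanSpace ℝ (Fin N) → ℝ} (hu : BddMeas u) (hv : BddMeas v)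
    (hJ : Integrable J) (x : EuclideanSpace ℝ (Fin N)) :
    jumpOp J (fun y => u y + v y) x = jumpOp J u x + jumpOp J v x := by
  unfold jumpOp
  rw [← integral_add (hu.integrable_jump hJ x) (hv.integrable_jump hJ x)]
  congr 1; ext z; ring

theorem jumpOp_const_mul (a : ℝ) (u : EuclideanSpace ℝ (Fin N) → ℝ)
    (x : EuclideanSpace ℝ (Fin N)) :
    jumpOp J (fun y => a * u y) x = a * jumpOp J u x := by
  unfold jumpOp
  rw [← integral_const_mul]
  congr 1; ext z; ring

theorem jumpOp_neg (u : EuclideanSpace ℝ (Fin N) → ℝ) (x : EuclideanSpace ℝ (Fin N)) :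
    jumpOp J (fun y => -u y) x = -jumpOp J u x := by
  simpa using jumpOp_const_mul (J := J) (-1) u x

theorem jumpOp_sub {u v : EuclideanSpace ℝ (Fin N) → ℝ} (hu : BddMeas u) (hv : BddMeas v)
    (hJ : Integrable J) (x : EuclideanSpace ℝ (Fin N)) :
    jumpOp J (fun y => u y - v y) x = jumpOp J u x - jumpOp J v x := by
  simp only [sub_eq_add_neg]
  rw [jumpOp_add hu hv.neg hJ, jumpOp_neg]

theorem jumpOp_sub_const (u : EuclideanSpace ℝ (Fin N) → ℝ) (a : ℝ)
    (x : EuclideanSpace ℝ (Fin N)) :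
    jumpOp J (fun y => u y - a) x = jumpOp J u x := by
  simp [jumpOp]

theorem jumpOp_const_sub (u : EuclideanSpace ℝ (Fin N) → ℝ) (a : ℝ)
    (x : EuclideanSpace ℝ (Fin N)) :
    jumpOp J (fun y => a - u y) x = -jumpOp J u x := by
  rw [← jumpOp_neg]
  simp only [jumpOp]
  congr 1; ext z; ring

theorem jumpOp_comp_add (u : EuclideanSpace ℝ (Fin N) → ℝ) (t x : EuclideanSpace ℝ (Fin N)) :
    jumpOp J (fun y => u (y + t)) x = jumpOp J u (x + t) := by
  simp only [jumpOp, add_right_comm]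

/-- `J` is a nonnegative integrable jump kernel leaving `D` at rate at least `β`. -/
structure ExitKernel (J : EuclideanSpace ℝ (Fin N) → ℝ) (D : Set (EuclideanSpace ℝ (Fin N)))
    (β : ℝ) : Prop where
  nonneg : ∀ z, 0 ≤ J z
  even : ∀ z, J (-z) = J z
  measurable : Measurable J
  integrable : Integrable J
  meas_set : MeasurableSet D
  rate_pos : 0 < β
  rate_le : ∀ x ∈ D, β ≤ ∫ z, J z * Dᶜ.indicator (fun _ => (1 : ℝ)) (x + z)

variable {D : Set (EuclideanSpace ℝ (Fin N))} {β : ℝ}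

theorem bddMeas_indicator_one {s : Set (EuclideanSpace ℝ (Fin N))} (hs : MeasurableSet s) :
    BddMeas (s.indicator (fun _ => (1 : ℝ))) :=
  (bddMeas_const 1).indicator hs

theorem ExitKernel.integral_mul_indicator_le (h : ExitKernel J D β)
    {x : EuclideanSpace ℝ (Fin N)} (hx : x ∈ D) :
    ∫ z, J z * D.indicator (fun _ => (1 : ℝ)) (x + z) ≤ (∫ z, J z) - β := by
  have h1 := h.rate_le x hx
  have h2 : (∫ z, J z) = (∫ z, J z * D.indicator (fun _ => (1 : ℝ)) (x + z)) +
      ∫ z, J z * Dᶜ.indicator (fun _ => (1 : ℝ)) (x + z) := by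
    rw [← integral_add ((bddMeas_indicator_one h.meas_set).integrable_mul h.integrable x)
      ((bddMeas_indicator_one h.meas_set.compl).integrable_mul h.integrable x)]
    congr 1; ext z
    by_cases hz : x + z ∈ D <;> simp [hz]
  linarith

theorem ExitKernel.comparison (h : ExitKernel J D β) {w : EuclideanSpace ℝ (Fin N) → ℝ}
    {e : ℝ} (he : 0 ≤ e) (hw : BddMeas w) (hoff : ∀ x ∉ D, w x ≤ 0)
    (hin : ∀ x ∈ D, 0 < w x → -e ≤ jumpOp J w x) (x₀ : EuclideanSpace ℝ (Fin N)) :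
    w x₀ ≤ e / β := by
  by_contra! hcon
  have hβ := h.rate_pos
  obtain ⟨C, hC⟩ := hw.2
  have hbdd : BddAbove (Set.range w) :=
    ⟨C, by rintro _ ⟨x, rfl⟩; exact (le_abs_self _).trans (hC x)⟩
  set m := ⨆ x, w x with hm
  have hle : ∀ x, w x ≤ m := fun x => le_ciSup hbdd x
  have hm1 : e / β < m := hcon.trans_le (hle x₀)
  have hm0 : 0 < m := (div_nonneg he hβ.le).trans_lt hm1
  have hm2 : e < m * β := (div_lt_iff₀ hβ).1 hm1
  set c := ∫ z, J z with hc
  have hc0 : 0 ≤ c := integral_nonneg h.nonneg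
  set η := (m * β - e) / (2 * (c + 1)) with hη
  have hη0 : 0 < η := div_pos (by linarith) (by positivity)
  obtain ⟨x, hx⟩ := exists_lt_of_lt_ciSup (show max (m - η) 0 < ⨆ x, w x from
    max_lt (by linarith) hm0)
  have hx1 : m - η < w x := (le_max_left _ _).trans_lt hx
  have hx2 : 0 < w x := (le_max_right _ _).trans_lt hx
  have hxD : x ∈ D := by
    by_contra hxD
    exact absurd (hoff x hxD) (not_le.2 hx2)
  have hint := (bddMeas_indicator_one h.meas_set).integrable_mul h.integrable x
  have h1 : jumpOp J w x ≤ ∫ z, (m * (J z * D.indicator (fun _ => (1 : ℝ)) (x + z)) -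
      J z * w x) := by
    refine integral_mono (hw.integrable_jump h.integrable x)
      ((hint.const_mul m).sub (h.integrable.mul_const _)) fun z => ?_
    have hz := h.nonneg z
    by_cases hzD : x + z ∈ D
    · simp only [hzD, Set.indicator_of_mem]
      nlinarith [hle (x + z)]
    · simp only [hzD, not_false_eq_true, Set.indicator_of_notMem]
      nlinarith [hoff _ hzD]
  rw [integral_sub (hint.const_mul m) (h.integrable.mul_const _), integral_const_mul,
    integral_mul_const, ← hc] at h1
  have h2 := h.integral_mul_indicator_le hxD
  have h3 := hin x hxD hx2
  have h4 : -e ≤ m * (c - β) - c * w x := by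
    refine (h3.trans h1).trans ?_
    have := mul_le_mul_of_nonneg_left h2 hm0.le
    linarith
  have h5 : c * (m - w x) ≤ c * η := mul_le_mul_of_nonneg_left (by linarith) hc0
  have h6 : η * (2 * (c + 1)) = m * β - e := div_mul_cancel₀ _ (by positivity)
  nlinarith

theorem exists_strictMono_inverse {c M : ℝ} (hc : 0 < c) {ψ : ℝ → ℝ} (hψc : Continuous ψ)
    (hψa : Antitone ψ) (hψ0 : ∀ t, 0 ≤ ψ t) (hψM : ∀ t, ψ t ≤ M) :
    ∃ Ψ : ℝ → ℝ → ℝ, (∀ r s, 0 ≤ r → c * Ψ r s = s + r * ψ (Ψ r s)) ∧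
      (∀ r r' s s', 0 ≤ r → 0 ≤ r' → c * |Ψ r s - Ψ r' s'| ≤ |s - s'| + M * |r - r'|) ∧
      Measurable (Function.uncurry Ψ) := by
  have hex : ∀ r s : ℝ, ∃ t, c * t - max r 0 * ψ t = s := by
    intro r s
    have hM : ∀ t, max r 0 * ψ t ≤ max r 0 * M := fun t =>
      mul_le_mul_of_nonneg_left (hψM t) (le_max_right _ _)
    have h0 : ∀ t, 0 ≤ max r 0 * ψ t := fun t => mul_nonneg (le_max_right _ _) (hψ0 t)
    have hcont : Continuous fun t => c * t - max r 0 * ψ t := by fun_prop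
    refine hcont.surjective ?_ ?_ s
    · refine tendsto_atTop_mono (f := fun t => c * t - max r 0 * M)
        (fun t => by linarith [hM t]) ?_
      exact tendsto_atTop_add_const_right _ _ (tendsto_id.const_mul_atTop hc)
    · refine tendsto_atBot_mono
        (fun t => (by linarith [h0 t] : c * t - max r 0 * ψ t ≤ c * t)) ?_
      exact tendsto_id.const_mul_atBot hc
  choose Ψ hΨ using hex
  have key : ∀ r r' s s', c * (Ψ r s - Ψ r' s') ≤ |s - s'| + M * |max r 0 - max r' 0| := by
    intro r r' s s'
    have hM : 0 ≤ M := (hψ0 0).trans (hψM 0)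
    rcases le_total (Ψ r s) (Ψ r' s') with hle | hle
    · have : c * (Ψ r s - Ψ r' s') ≤ 0 := mul_nonpos_of_nonneg_of_nonpos hc.le (by linarith)
      have : 0 ≤ |s - s'| + M * |max r 0 - max r' 0| := by positivity
      linarith
    · have h1 := hΨ r s
      have h2 := hΨ r' s'
      have h3 : max r 0 * ψ (Ψ r s) ≤ max r 0 * ψ (Ψ r' s') :=
        mul_le_mul_of_nonneg_left (hψa hle) (le_max_right _ _)
      have h4 : (max r 0 - max r' 0) * ψ (Ψ r' s') ≤ |max r 0 - max r' 0| * M :=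
        (mul_le_mul_of_nonneg_right (le_abs_self _) (hψ0 _)).trans
          (mul_le_mul_of_nonneg_left (hψM _) (abs_nonneg _))
      have h5 := le_abs_self (s - s')
      nlinarith
  have key' : ∀ r r' s s', c * |Ψ r s - Ψ r' s'| ≤ |s - s'| + M * |max r 0 - max r' 0| := by
    intro r r' s s'
    rcases abs_cases (Ψ r s - Ψ r' s') with ⟨h, -⟩ | ⟨h, -⟩
    · rw [h]; exact key r r' s s'
    · rw [h, abs_sub_comm s, abs_sub_comm (max r 0), neg_sub]; exact key r' r s' s
  refine ⟨Ψ, fun r s hr => ?_, fun r r' s s' hr hr' => ?_, ?_⟩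
  · have := hΨ r s
    rw [max_eq_left hr] at this
    linarith
  · have := key' r r' s s'
    rwa [max_eq_left hr, max_eq_left hr'] at this
  · refine Continuous.measurable (continuous_iff_continuousAt.2 fun p => ?_)
    rw [ContinuousAt, tendsto_iff_dist_tendsto_zero]
    have hb : Tendsto (fun q : ℝ × ℝ => (|q.2 - p.2| + M * |max q.1 0 - max p.1 0|) / c) (𝓝 p)
        (𝓝 ((|p.2 - p.2| + M * |max p.1 0 - max p.1 0|) / c)) :=
      Continuous.tendsto (by fun_prop) p
    simp only [sub_self, abs_zero, mul_zero, add_zero, zero_div] at hb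
    refine squeeze_zero (fun _ => dist_nonneg) (fun q => ?_) hb
    rw [le_div_iff₀ hc, mul_comm]
    exact key' q.1 p.1 q.2 p.2

end JumpOperator

section JumpDirichlet

variable {N : ℕ} {J : EuclideanSpace ℝ (Fin N) → ℝ} {D : Set (EuclideanSpace ℝ (Fin N))} {β : ℝ}

theorem measurable_integral_mul_comp_add (hJ : Measurable J)
    {u : EuclideanSpace ℝ (Fin N) → ℝ} (hu : Measurable u) :
    Measurable fun x => ∫ z, J z * u (x + z) := by
  have h : Measurable (Function.uncurry fun x z : EuclideanSpace ℝ (Fin N) =>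
      J z * u (x + z)) :=
    (hJ.comp measurable_snd).mul (hu.comp (measurable_fst.add measurable_snd))
  exact (StronglyMeasurable.integral_prod_right h.stronglyMeasurable).measurable

theorem abs_integral_mul_le (hJ0 : ∀ z, 0 ≤ J z) (hJ : Integrable J)
    {u : EuclideanSpace ℝ (Fin N) → ℝ} {C : ℝ} (hC : ∀ x, |u x| ≤ C)
    (x : EuclideanSpace ℝ (Fin N)) : |∫ z, J z * u (x + z)| ≤ (∫ z, J z) * C := by
  rw [← integral_mul_const]
  refine norm_integral_le_of_norm_le (f := fun z => J z * u (x + z)) (hJ.mul_const C)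
    (Eventually.of_forall fun z => ?_)
  rw [Real.norm_eq_abs, abs_mul, abs_of_nonneg (hJ0 z)]
  exact mul_le_mul_of_nonneg_left (hC _) (hJ0 z)

theorem ExitKernel.exists_solution (h : ExitKernel J D β) (hc : 0 < ∫ z, J z)
    {ρ : EuclideanSpace ℝ (Fin N) → ℝ} (hρm : Measurable ρ) (hρ0 : ∀ x, 0 ≤ ρ x)
    {M₁ : ℝ} (hρM : ∀ x, ρ x ≤ M₁) {ψ : ℝ → ℝ} (hψc : Continuous ψ)
    (hψa : Antitone ψ) (hψ0 : ∀ t, 0 ≤ ψ t) {M₂ : ℝ} (hψM : ∀ t, ψ t ≤ M₂)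
    {f : EuclideanSpace ℝ (Fin N) → ℝ} (hf : BddMeas f) :
    ∃ u, BddMeas u ∧ (∀ x ∉ D, u x = f x) ∧ ∀ x ∈ D, jumpOp J u x = -(ρ x * ψ (u x)) := by
  classical
  rcases D.eq_empty_or_nonempty with hD | ⟨xD, hxD⟩
  · subst hD
    exact ⟨f, hf, fun _ _ => rfl, fun x hx => absurd hx (Set.notMem_empty x)⟩
  obtain ⟨Ψ, hΨ1, hΨ2, hΨm⟩ := exists_strictMono_inverse hc hψc hψa hψ0 hψM
  set c := ∫ z, J z with hcdef
  have hβ := h.rate_pos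
  have hβc : β ≤ c := by
    have h1 := h.integral_mul_indicator_le hxD
    have h2 : 0 ≤ ∫ z, J z * D.indicator (fun _ => (1 : ℝ)) (xD + z) :=
      integral_nonneg fun z => mul_nonneg (h.nonneg z)
        (Set.indicator_nonneg (fun _ _ => zero_le_one) _)
    linarith
  set T : (EuclideanSpace ℝ (Fin N) → ℝ) → EuclideanSpace ℝ (Fin N) → ℝ := fun u =>
    D.piecewise (fun x => Ψ (ρ x) (∫ z, J z * u (x + z))) f with hT
  have hTin : ∀ u, ∀ x ∈ D, T u x = Ψ (ρ x) (∫ z, J z * u (x + z)) := fun u x hx =>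
    Set.piecewise_eq_of_mem _ _ _ hx
  have hTout : ∀ u, ∀ x ∉ D, T u x = f x := fun u x hx =>
    Set.piecewise_eq_of_notMem _ _ _ hx
  have hTm : ∀ u, Measurable u → Measurable (T u) := fun u hu =>
    Measurable.piecewise h.meas_set
      (hΨm.comp (hρm.prodMk (measurable_integral_mul_comp_add h.measurable hu))) hf.1
  have hM₂ : 0 ≤ M₂ := (hψ0 0).trans (hψM 0)
  have hM₁ : 0 ≤ M₁ := (hρ0 0).trans (hρM 0)
  have hTb : ∀ u, BddMeas u → BddMeas (T u) := by
    intro u hu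
    obtain ⟨C, hC⟩ := hu.2
    obtain ⟨F, hF⟩ := hf.2
    refine ⟨hTm u hu.1, max ((c * C + M₁ * M₂) / c) F, fun x => ?_⟩
    by_cases hx : x ∈ D
    · refine le_max_of_le_left ?_
      rw [hTin u x hx, le_div_iff₀ hc, mul_comm]
      have h1 := hΨ1 (ρ x) (∫ z, J z * u (x + z)) (hρ0 x)
      have h2 : |c * Ψ (ρ x) (∫ z, J z * u (x + z))| ≤ c * C + M₁ * M₂ := by
        rw [h1]
        refine (abs_add_le _ _).trans (add_le_add (abs_integral_mul_le h.nonneg h.integrable hC x) ?_)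
        rw [abs_of_nonneg (mul_nonneg (hρ0 x) (hψ0 _))]
        exact mul_le_mul (hρM x) (hψM _) (hψ0 _) hM₁
      rwa [abs_mul, abs_of_pos hc] at h2
    · refine le_max_of_le_right ?_
      rw [hTout u x hx]; exact hF x
  set q := (c - β) / c with hq
  have hq0 : 0 ≤ q := div_nonneg (by linarith) hc.le
  have hq1 : q < 1 := (div_lt_one hc).2 (by linarith)
  have hcontr : ∀ u v, BddMeas u → BddMeas v → (∀ x ∉ D, u x = v x) → ∀ K, 0 ≤ K →
      (∀ x, |u x - v x| ≤ K) → ∀ x, |T u x - T v x| ≤ K * q := by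
    intro u v hu hv huv K hK hKuv x
    by_cases hx : x ∈ D
    · rw [hTin u x hx, hTin v x hx, hq, mul_div_assoc', le_div_iff₀ hc, mul_comm]
      have h1 := hΨ2 (ρ x) (ρ x) (∫ z, J z * u (x + z)) (∫ z, J z * v (x + z)) (hρ0 x) (hρ0 x)
      simp only [sub_self, abs_zero, mul_zero, add_zero] at h1
      refine h1.trans ?_
      rw [← integral_sub (hu.integrable_mul h.integrable x) (hv.integrable_mul h.integrable x)]
      refine le_trans ?_ (mul_le_mul_of_nonneg_left (h.integral_mul_indicator_le hx) hK)
      rw [← integral_const_mul]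
      refine norm_integral_le_of_norm_le (f := fun z => J z * u (x + z) - J z * v (x + z))
        (((bddMeas_indicator_one h.meas_set).integrable_mul h.integrable x).const_mul K)
        (Eventually.of_forall fun z => ?_)
      rw [Real.norm_eq_abs, ← mul_sub, abs_mul, abs_of_nonneg (h.nonneg z)]
      by_cases hz : x + z ∈ D
      · simp only [hz, Set.indicator_of_mem, mul_one]
        rw [mul_comm]
        exact mul_le_mul_of_nonneg_right (hKuv _) (h.nonneg z)
      · simp [hz, huv _ hz]
    · rw [hTout u x hx, hTout v x hx]
      simpa using mul_nonneg hK hq0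
  set s : ℕ → EuclideanSpace ℝ (Fin N) → ℝ := fun n => T^[n] f with hs
  have hs_succ : ∀ n, s (n + 1) = T (s n) := fun n => Function.iterate_succ_apply' T n f
  have hsb : ∀ n, BddMeas (s n) := by
    intro n
    induction n with
    | zero => exact hf
    | succ n ih => rw [hs_succ]; exact hTb _ ih
  have hsout : ∀ n, ∀ x ∉ D, s n x = f x := by
    intro n x hx
    cases n with
    | zero => rfl
    | succ n => rw [hs_succ]; exact hTout _ x hx
  obtain ⟨C₀, hC₀⟩ := ((hsb 1).sub (hsb 0)).2
  have hC₀0 : 0 ≤ C₀ := (abs_nonneg _).trans (hC₀ 0)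
  have hstep : ∀ n x, |s (n + 1) x - s n x| ≤ C₀ * q ^ n := by
    intro n
    induction n with
    | zero => simpa using hC₀
    | succ n ih =>
      intro x
      rw [hs_succ (n + 1), hs_succ n, pow_succ, ← mul_assoc]
      have := hcontr (s (n + 1)) (s n) (hsb _) (hsb _)
        (fun x hx => by rw [hsout _ x hx, hsout _ x hx]) _ (by positivity) ih x
      rwa [hs_succ n] at this
  have hdist : ∀ x n, dist (s n x) (s (n + 1) x) ≤ C₀ * q ^ n := fun x n => by
    rw [dist_comm, Real.dist_eq]; exact hstep n x
  choose u hu using fun x =>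
    cauchySeq_tendsto_of_complete (cauchySeq_of_le_geometric q C₀ hq1 (hdist x))
  have hsu : ∀ n x, |s n x - u x| ≤ C₀ * q ^ n / (1 - q) := fun n x =>
    dist_le_of_le_geometric_of_tendsto q C₀ hq1 (hdist x) (hu x) n
  obtain ⟨F, hF⟩ := hf.2
  have hum : Measurable u :=
    measurable_of_tendsto_metrizable (fun n => (hsb n).1) (tendsto_pi_nhds.2 hu)
  have hub : BddMeas u := by
    refine ⟨hum, F + C₀ / (1 - q), fun x => ?_⟩
    have h1 := hsu 0 x
    have h2 := hF x
    simp only [pow_zero, mul_one] at h1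
    have h3 : u x = f x - (s 0 x - u x) := by simp [hs]
    rw [h3]
    exact (abs_sub _ _).trans (add_le_add h2 h1)
  have huout : ∀ x ∉ D, u x = f x := fun x hx =>
    tendsto_nhds_unique (hu x) (by simp only [hsout _ x hx]; exact tendsto_const_nhds)
  have hfix : ∀ x, T u x = u x := by
    intro x
    have hlim : Tendsto (fun n => C₀ * q ^ n / (1 - q) * q + C₀ * q ^ (n + 1) / (1 - q)) atTop
        (𝓝 (C₀ * 0 / (1 - q) * q + C₀ * 0 / (1 - q))) := by
      have h1 := tendsto_pow_atTop_nhds_zero_of_lt_one hq0 hq1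
      have h2 := h1.comp (tendsto_add_atTop_nat 1)
      exact (((h1.const_mul C₀).div_const _).mul_const q).add ((h2.const_mul C₀).div_const _)
    simp only [mul_zero, zero_div, zero_mul, add_zero] at hlim
    have h0 : |T u x - u x| ≤ 0 := by
      refine ge_of_tendsto' hlim fun n => ?_
      have h1 := hcontr u (s n) hub (hsb n)
        (fun x hx => by rw [huout x hx, hsout _ x hx]) (C₀ * q ^ n / (1 - q))
        (div_nonneg (by positivity) (by linarith))
        (fun x => by rw [abs_sub_comm]; exact hsu n x) x
      have h2 := hsu (n + 1) x
      rw [hs_succ] at h2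
      have h3 : T u x - u x = (T u x - T (s n) x) + (T (s n) x - u x) := by ring
      rw [h3]
      exact (abs_add_le _ _).trans (add_le_add h1 h2)
    have := abs_nonneg (T u x - u x)
    exact sub_eq_zero.1 (abs_eq_zero.1 (le_antisymm h0 this))
  refine ⟨u, hub, huout, fun x hx => ?_⟩
  rw [jumpOp_eq hub h.integrable]
  have h1 := hΨ1 (ρ x) (∫ z, J z * u (x + z)) (hρ0 x)
  have h2 := hfix x
  rw [hTin u x hx] at h2
  rw [h2] at h1
  rw [← hcdef]
  linarith

theorem integrable_mul_jump_prod (hJ : Integrable J)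
    {a b : EuclideanSpace ℝ (Fin N) → ℝ} (ha : Integrable a)
    (hb : BddMeas b) :
    Integrable (Function.uncurry fun x z : EuclideanSpace ℝ (Fin N) => a x * (J z * b (x + z)))
      (volume.prod volume) := by
  obtain ⟨hbm, C, hC⟩ := hb
  have h1 := (ha.mul_prod hJ).mul_bdd (c := C) (g := fun p : EuclideanSpace ℝ (Fin N) × EuclideanSpace ℝ (Fin N) => b (p.1 + p.2))
    (hbm.comp (measurable_fst.add measurable_snd)).aestronglyMeasurable
    (Eventually.of_forall fun p => hC _)
  refine h1.congr (Eventually.of_forall fun p => ?_)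
  simp [Function.uncurry, mul_assoc]

theorem integral_mul_jumpOp_comm (hJm : Measurable J) (hJ : Integrable J)
    (hJe : ∀ z, J (-z) = J z) {a b : EuclideanSpace ℝ (Fin N) → ℝ} (hab : BddMeas a)
    (ha : Integrable a) (hb : BddMeas b) :
    ∫ x, a x * jumpOp J b x = ∫ x, b x * jumpOp J a x := by
  have hI := integrable_mul_jump_prod hJ ha hb
  have hswap : ∫ x, a x * (∫ z, J z * b (x + z)) = ∫ x, b x * (∫ z, J z * a (x + z)) := by
    have e1 : ∫ x, a x * (∫ z, J z * b (x + z)) = ∫ z, ∫ x, a x * (J z * b (x + z)) := by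
      simp only [← integral_const_mul]
      exact integral_integral_swap hI
    have e2 : ∀ z, ∫ x, a x * (J z * b (x + z)) = ∫ x, a (x - z) * (J z * b x) := by
      intro z
      rw [← integral_add_right_eq_self (fun x => a (x - z) * (J z * b x)) z]
      simp
    have e3 : ∫ z, ∫ x, a (x - z) * (J z * b x) = ∫ z, ∫ x, a (x + z) * (J z * b x) := by
      rw [← integral_neg_eq_self]
      simp [hJe]
    have hI2 : Integrable (Function.uncurry fun z x : EuclideanSpace ℝ (Fin N) =>
        a (x + z) * (J z * b x)) (volume.prod volume) := by
      obtain ⟨hbm, C, hC⟩ := hb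
      have hm : AEStronglyMeasurable (Function.uncurry fun z x : EuclideanSpace ℝ (Fin N) =>
          a (x + z) * (J z * b x)) (volume.prod volume) :=
        ((hab.1.comp (measurable_snd.add measurable_fst)).mul
          ((hJm.comp measurable_fst).mul (hbm.comp measurable_snd))).aestronglyMeasurable
      rw [integrable_prod_iff hm]
      refine ⟨Eventually.of_forall fun z => ?_, ?_⟩
      · exact ((ha.comp_add_right z).mul_bdd (c := |J z| * C)
          (hbm.const_mul (J z)).aestronglyMeasurable (Eventually.of_forall fun x => by
            rw [Real.norm_eq_abs, abs_mul]
            exact mul_le_mul_of_nonneg_left (hC x) (abs_nonneg _)))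
      · refine ((hJ.abs.mul_const C).mul_const (∫ x, |a x|)).mono'
          hm.norm.integral_prod_right' (Eventually.of_forall fun z => ?_)
        rw [Real.norm_of_nonneg (integral_nonneg fun _ => norm_nonneg _), mul_comm,
          ← integral_add_right_eq_self (fun x => |a x|) z, ← integral_mul_const]
        refine integral_mono_of_nonneg (Eventually.of_forall fun _ => norm_nonneg _)
          ((ha.comp_add_right z).abs.mul_const _) (Eventually.of_forall fun x => ?_)
        simp only [Function.uncurry, norm_mul, Real.norm_eq_abs]
        exact mul_le_mul_of_nonneg_left (mul_le_mul_of_nonneg_left (hC x) (abs_nonneg _))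
          (abs_nonneg _)
    rw [e1]
    simp only [e2]
    rw [e3, integral_integral_swap hI2]
    congr 1; ext x
    rw [← integral_const_mul]
    congr 1; ext z; ring
  have hint1 : Integrable fun x => a x * ∫ z, J z * b (x + z) := by
    have := hI.integral_prod_left
    simpa [Function.uncurry, integral_const_mul] using this
  have hint2 : Integrable fun x => b x * ∫ z, J z * a (x + z) := by
    obtain ⟨hbm, C, hC⟩ := hb
    have h1 : Integrable fun x => ∫ z, J z * a (x + z) := by
      have hm : AEStronglyMeasurable (Function.uncurry fun x z : EuclideanSpace ℝ (Fin N) =>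
          J z * a (x + z)) (volume.prod volume) :=
        ((hJm.comp measurable_snd).mul
          (hab.1.comp (measurable_fst.add measurable_snd))).aestronglyMeasurable
      have : Integrable (Function.uncurry fun x z : EuclideanSpace ℝ (Fin N) =>
          J z * a (x + z)) (volume.prod volume) := by
        rw [integrable_prod_iff' hm]
        refine ⟨Eventually.of_forall fun z => ?_, ?_⟩
        · have h : Integrable (fun x => J z * a (x + z)) volume :=
            (ha.comp_add_right z).const_mul (J z)
          exact h
        simp only [Function.uncurry, norm_mul, integral_const_mul]
        have : ∀ z, ∫ x, ‖a (x + z)‖ = ∫ x, ‖a x‖ := fun z =>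
          integral_add_right_eq_self (fun x => ‖a x‖) z
        simp only [this]
        exact hJ.norm.mul_const _
      simpa [Function.uncurry] using this.integral_prod_left
    exact h1.bdd_mul hbm.aestronglyMeasurable (Eventually.of_forall fun x => hC x)
  have hint3 : Integrable fun x => a x * ((∫ z, J z) * b x) := by
    obtain ⟨hbm, C, hC⟩ := hb.const_mul (∫ z, J z)
    exact ha.mul_bdd hbm.aestronglyMeasurable (Eventually.of_forall fun x => hC x)
  simp only [jumpOp_eq hb hJ, jumpOp_eq hab hJ, mul_sub]
  have hint4 : Integrable fun x => b x * ((∫ z, J z) * a x) := by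
    refine hint3.congr (Eventually.of_forall fun x => ?_)
    simp only; ring
  rw [integral_sub hint1 hint3, integral_sub hint2 hint4, hswap]
  congr 2; ext x; ring

end JumpDirichlet

section Barrier

variable {N : ℕ} {J : EuclideanSpace ℝ (Fin N) → ℝ} {D : Set (EuclideanSpace ℝ (Fin N))} {β : ℝ}

theorem exists_forall_le_add {X : Type*} [Nonempty X] {w : X → ℝ} {C : ℝ}
    (hC : ∀ x, w x ≤ C) {η : ℝ} (hη : 0 < η) : ∃ x, ∀ y, w y ≤ w x + η := by
  have hbdd : BddAbove (Set.range w) := ⟨C, by rintro _ ⟨x, rfl⟩; exact hC x⟩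
  obtain ⟨x, hx⟩ := exists_lt_of_lt_ciSup (show (⨆ x, w x) - η < ⨆ x, w x by linarith)
  exact ⟨x, fun y => by linarith [le_ciSup hbdd y]⟩

theorem BddMeas.integrable_of_eq_zero {v : EuclideanSpace ℝ (Fin N) → ℝ} (hv : BddMeas v)
    (hD : MeasurableSet D) (hDv : volume D ≠ ⊤) (hv0 : ∀ x ∉ D, v x = 0) : Integrable v := by
  obtain ⟨hvm, C, hC⟩ := hv
  have h1 : IntegrableOn v D :=
    Measure.integrableOn_of_bounded hDv hvm.aestronglyMeasurable
      (Eventually.of_forall fun x => hC x)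
  refine (h1.integrable_indicator hD).congr (Eventually.of_forall fun x => ?_)
  by_cases hx : x ∈ D
  · simp [hx]
  · simp [hx, hv0 x hx]

theorem jumpOp_ge_of_near_max {v : EuclideanSpace ℝ (Fin N) → ℝ} (hJ0 : ∀ z, 0 ≤ J z)
    (hJ : Integrable J) (hv : BddMeas v) (hvi : Integrable v) (hv0 : ∀ x, 0 ≤ v x)
    {κ r η : ℝ} (hκ : 0 ≤ κ) (hr : ∀ z, ‖z‖ ≤ r → κ ≤ J z) {x : EuclideanSpace ℝ (Fin N)}
    (hx : ∀ y, v y ≤ v x + η) (hη : 0 ≤ η) :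
    jumpOp J v x ≤ κ * (∫ y, v y) -
      κ * volume.real (Metric.closedBall (0 : EuclideanSpace ℝ (Fin N)) r) * v x +
        (∫ z, J z) * η := by
  set B := Metric.closedBall (0 : EuclideanSpace ℝ (Fin N)) r with hB
  have hBi : Integrable (B.indicator fun _ => κ * v x) :=
    (integrable_indicator_iff measurableSet_closedBall).2
      (integrableOn_const (isCompact_closedBall _ _).measure_ne_top)
  have hvx : Integrable fun z => v (x + z) := hvi.comp_add_left x
  have h1 : jumpOp J v x ≤ ∫ z, (κ * v (x + z) - B.indicator (fun _ => κ * v x) z + J z * η) := by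
    refine integral_mono (hv.integrable_jump hJ x)
      (((hvx.const_mul κ).sub hBi).add (hJ.mul_const η)) fun z => ?_
    have h2 := hx (x + z)
    have h3 := hv0 (x + z)
    have h4 := hJ0 z
    by_cases hz : z ∈ B
    · have h5 := hr z (by simpa [hB] using hz)
      simp only [hz, Set.indicator_of_mem]
      nlinarith
    · simp only [hz, not_false_eq_true, Set.indicator_of_notMem]
      nlinarith [mul_nonneg hκ h3]
  have h2 : ∫ z, (κ * v (x + z) - B.indicator (fun _ => κ * v x) z + J z * η) =
      κ * (∫ y, v y) - κ * volume.real B * v x + (∫ z, J z) * η := by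
    have h3 : Integrable fun z => κ * v (x + z) - B.indicator (fun _ => κ * v x) z :=
      (hvx.const_mul κ).sub hBi
    rw [integral_add h3 (hJ.mul_const η),
      integral_sub (hvx.const_mul κ) hBi, integral_const_mul, integral_mul_const,
      integral_indicator measurableSet_closedBall, setIntegral_const,
      integral_add_left_eq_self (fun z => v z) x, smul_eq_mul]
    ring
  linarith

theorem ExitKernel.exists_barrier (h : ExitKernel J D β) (hDv : volume D ≠ ⊤)
    (hc : 0 < ∫ z, J z) {κ r : ℝ} (hκ : 0 < κ) (hr : 0 < r) (hJr : ∀ z, ‖z‖ ≤ r → κ ≤ J z)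
    {g : EuclideanSpace ℝ (Fin N) → ℝ} (hgm : Measurable g) (hg0 : ∀ x, 0 ≤ g x) {M : ℝ}
    (hgM : ∀ x, g x ≤ M) :
    ∃ v, BddMeas v ∧ (∀ x ∉ D, v x = 0) ∧ (∀ x, 0 ≤ v x) ∧ (∀ x ∈ D, jumpOp J v x = -g x) ∧
      ∀ x, v x ≤ ((∫ x in D, g x) / β + M / κ) /
        volume.real (Metric.closedBall (0 : EuclideanSpace ℝ (Fin N)) r) := by
  have hβ := h.rate_pos
  have hM : 0 ≤ M := (hg0 0).trans (hgM 0)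
  obtain ⟨v, hv, hvD, hvJ⟩ := h.exists_solution hc hgm hg0 hgM (ψ := fun _ => 1) (M₂ := 1)
    continuous_const (fun _ _ _ => le_rfl) (fun _ => zero_le_one) (fun _ => le_rfl)
    (bddMeas_const 0)
  obtain ⟨v₁, hv₁, hv₁D, hv₁J⟩ := h.exists_solution hc (ρ := fun _ => 1) measurable_const
    (fun _ => zero_le_one) (fun _ => le_rfl) (ψ := fun _ => 1) (M₂ := 1)
    continuous_const (fun _ _ _ => le_rfl) (fun _ => zero_le_one) (fun _ => le_rfl)
    (bddMeas_const 0)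
  simp only [mul_one] at hvJ hv₁J
  have hv0 : ∀ x, 0 ≤ v x := by
    intro x
    have := h.comparison le_rfl hv.neg (fun x hx => by simp [hvD x hx])
      (fun x hx _ => by rw [jumpOp_neg, hvJ x hx]; simpa using hg0 x) x
    simp only [zero_div] at this
    linarith
  have hv₁1 : ∀ x, v₁ x ≤ 1 / β := h.comparison zero_le_one hv₁ (fun x hx => (hv₁D x hx).le)
    (fun x hx _ => (hv₁J x hx).ge)
  have hvi : Integrable v := hv.integrable_of_eq_zero h.meas_set hDv hvD
  have hgi : IntegrableOn g D :=
    Measure.integrableOn_of_bounded hDv hgm.aestronglyMeasurable (M := M)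
      (Eventually.of_forall fun x => by rw [Real.norm_of_nonneg (hg0 x)]; exact hgM x)
  have hsym := integral_mul_jumpOp_comm h.measurable h.integrable h.even hv hvi hv₁
  have h1 : ∫ x, v x * jumpOp J v₁ x = -∫ x, v x := by
    rw [← integral_neg]
    congr 1; ext x
    by_cases hx : x ∈ D
    · rw [hv₁J x hx]; ring
    · simp [hvD x hx]
  have h2 : ∫ x, v₁ x * jumpOp J v x = -∫ x in D, v₁ x * g x := by
    rw [← integral_neg, ← integral_indicator h.meas_set]
    congr 1; ext x
    by_cases hx : x ∈ D
    · simp only [hx, Set.indicator_of_mem]; rw [hvJ x hx]; ring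
    · simp [hx, hv₁D x hx]
  have h3 : ∫ x, v x ≤ (∫ x in D, g x) / β := by
    have h4 : ∫ x in D, v₁ x * g x ≤ ∫ x in D, 1 / β * g x := by
      obtain ⟨hv₁m, C, hC⟩ := hv₁
      refine integral_mono (hgi.bdd_mul hv₁m.aestronglyMeasurable
        (Eventually.of_forall fun x => hC x)) (hgi.const_mul _) fun x => ?_
      exact mul_le_mul_of_nonneg_right (hv₁1 x) (hg0 x)
    rw [integral_const_mul, one_div_mul_eq_div] at h4
    linarith
  refine ⟨v, hv, hvD, hv0, hvJ, fun x₀ => ?_⟩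
  set V := volume.real (Metric.closedBall (0 : EuclideanSpace ℝ (Fin N)) r) with hV
  have hVpos : 0 < V := by
    rw [hV, measureReal_def]
    exact ENNReal.toReal_pos (Metric.measure_closedBall_pos _ _ hr).ne'
      (isCompact_closedBall _ _).measure_ne_top
  set c := ∫ z, J z with hcdef
  refine le_of_forall_pos_le_add fun ε hε => ?_
  obtain ⟨C, hC⟩ := hv.2
  have hηpos : 0 < ε / (c / (κ * V) + 1) := by positivity
  set η := ε / (c / (κ * V) + 1) with hη
  obtain ⟨x, hx⟩ := exists_forall_le_add (fun x => (le_abs_self _).trans (hC x)) hηpos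
  have hA : 0 ≤ ((∫ x in D, g x) / β + M / κ) / V := by
    have : 0 ≤ ∫ x in D, g x := integral_nonneg hg0
    positivity
  have hη1 : c / (κ * V) * η + η = ε := by
    rw [hη]; field_simp
  have hle : v x ≤ ((∫ x in D, g x) / β + M / κ) / V + c / (κ * V) * η := by
    by_cases hxD : x ∈ D
    · have h5 := jumpOp_ge_of_near_max h.nonneg h.integrable hv hvi hv0 hκ.le hJr hx hηpos.le
      rw [hvJ x hxD, ← hV, ← hcdef] at h5
      have h6 := hgM x
      have h7 : κ * (∫ y, v y) ≤ κ * ((∫ x in D, g x) / β) := mul_le_mul_of_nonneg_left h3 hκ.le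
      have h8 : κ * V * v x ≤ κ * ((∫ x in D, g x) / β) + M + c * η := by linarith
      have h9 : ((∫ x in D, g x) / β + M / κ) / V + c / (κ * V) * η =
          (κ * ((∫ x in D, g x) / β) + M + c * η) / (κ * V) := by field_simp
      rw [h9, le_div_iff₀ (by positivity), mul_comm]
      exact h8
    · rw [hvD x hxD]
      positivity
  linarith [hx x₀]

end Barrier

section Boundary

variable {N : ℕ} {α : ℝ} {D : Set (EuclideanSpace ℝ (Fin N))}

theorem integral_fracKernel_pos (hα1 : 0 < α) (hα2 : α < 2) {δ : ℝ} (hδ : 0 < δ) :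
    0 < ∫ z, fracKernel N α δ z := by
  rw [integral_pos_iff_support_of_nonneg (fracKernel_nonneg hα1 hα2 δ)
    (integrable_fracKernel hα1 hα2 hδ)]
  have : Function.support (fracKernel N α δ) = Set.univ := by
    ext z
    have h1 : 0 < max ‖z‖ δ := lt_max_of_lt_right hδ
    have h2 := fracLapCoeff_pos (N := N) hα1 hα2
    simp only [Function.mem_support, Set.mem_univ, iff_true, fracKernel]
    positivity
  rw [this]
  exact isOpen_univ.measure_pos _ Set.univ_nonempty

theorem exists_exitKernel_fracKernel (hN : 0 < N) (hα1 : 0 < α) (hα2 : α < 2)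
    (hD : MeasurableSet D) (hDb : Bornology.IsBounded D) :
    ∃ β, ∀ δ, 0 < δ → δ ≤ 1 → ExitKernel (fracKernel N α δ) D β := by
  have hne : Nonempty (Fin N) := ⟨⟨0, hN⟩⟩
  obtain ⟨R, hR⟩ := hDb.exists_norm_le
  set R' := max (2 * R) 1 with hR'
  have hs : MeasurableSet {z : EuclideanSpace ℝ (Fin N) | R' < ‖z‖} :=
    measurableSet_lt measurable_const measurable_norm
  refine ⟨∫ z in {z : EuclideanSpace ℝ (Fin N) | R' < ‖z‖}, fracKernel N α 1 z,
    fun δ hδ hδ1 => ⟨fracKernel_nonneg hα1 hα2 δ, fun z => by simp [fracKernel],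
      measurable_fracKernel δ, integrable_fracKernel hα1 hα2 hδ, hD, ?_, fun x hx => ?_⟩⟩
  · rw [setIntegral_pos_iff_support_of_nonneg_ae
      (Eventually.of_forall fun z => fracKernel_nonneg hα1 hα2 1 z)
      (integrable_fracKernel hα1 hα2 one_pos).integrableOn]
    have : Function.support (fracKernel N α 1) = Set.univ := by
      ext z
      have h1 : 0 < max ‖z‖ 1 := lt_max_of_lt_right one_pos
      have h2 := fracLapCoeff_pos (N := N) hα1 hα2
      simp only [Function.mem_support, Set.mem_univ, iff_true, fracKernel]
      positivity
    rw [this, Set.univ_inter]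
    refine (isOpen_lt continuous_const continuous_norm).measure_pos _ ?_
    exact NormedSpace.exists_lt_norm ℝ _ R'
  · rw [← integral_indicator hs]
    refine integral_mono ((integrable_fracKernel hα1 hα2 one_pos).indicator hs)
      ((bddMeas_indicator_one hD.compl).integrable_mul (integrable_fracKernel hα1 hα2 hδ) x)
      fun z => ?_
    have h0 := fracKernel_nonneg hα1 hα2 δ z
    by_cases hz : R' < ‖z‖
    · have h1 : x + z ∈ Dᶜ := by
        intro hmem
        have h2 := hR _ hmem
        have h3 := hR _ hx
        have h4 : ‖z‖ ≤ ‖x + z‖ + ‖x‖ := by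
          have := norm_sub_le (x + z) x
          simpa using this
        have := (le_max_left (2 * R) 1).trans_lt hz
        linarith
      have h5 : (1 : ℝ) ≤ ‖z‖ := (le_max_right (2 * R) 1).trans hz.le
      simp only [Set.mem_ofPred_eq, hz, Set.indicator_of_mem, h1, mul_one]
      rw [fracKernel_eq_of_le h5, fracKernel_eq_of_le (hδ1.trans h5)]
    · simp only [Set.mem_ofPred_eq, hz, not_false_eq_true, Set.indicator_of_notMem]
      exact mul_nonneg h0 (Set.indicator_nonneg (fun _ _ => zero_le_one) _)

theorem jumpOp_eq_half {J u : EuclideanSpace ℝ (Fin N) → ℝ} (hJ : Integrable J)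
    (hJe : ∀ z, J (-z) = J z) (hu : BddMeas u) (x : EuclideanSpace ℝ (Fin N)) :
    jumpOp J u x = (1 / 2) * ∫ z, J z * (u (x + z) + u (x - z) - 2 * u x) := by
  have h1 := hu.integrable_jump hJ x
  have h2 : Integrable fun z => J z * (u (x - z) - u x) := by
    simpa [hJe, sub_eq_add_neg] using h1.comp_neg
  have h3 : jumpOp J u x = ∫ z, J z * (u (x - z) - u x) := by
    unfold jumpOp
    rw [← integral_neg_eq_self]
    simp only [hJe, sub_eq_add_neg]
  have h4 : ∫ z, J z * (u (x + z) + u (x - z) - 2 * u x) =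
      jumpOp J u x + ∫ z, J z * (u (x - z) - u x) := by
    unfold jumpOp
    rw [← integral_add h1 h2]
    congr 1; ext z; ring
  rw [h4, ← h3]; ring

/-- The bump `(1 - |x - z₀|²/r²)₊`. -/
def quadBump (z₀ : EuclideanSpace ℝ (Fin N)) (r : ℝ) (x : EuclideanSpace ℝ (Fin N)) : ℝ :=
  max (1 - ‖x - z₀‖ ^ 2 / r ^ 2) 0

theorem quadBump_nonneg (z₀ : EuclideanSpace ℝ (Fin N)) (r : ℝ) (x : EuclideanSpace ℝ (Fin N)) :
    0 ≤ quadBump z₀ r x := le_max_right _ _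

theorem quadBump_le_one (z₀ : EuclideanSpace ℝ (Fin N)) (r : ℝ) (x : EuclideanSpace ℝ (Fin N)) :
    quadBump z₀ r x ≤ 1 :=
  max_le (by have : 0 ≤ ‖x - z₀‖ ^ 2 / r ^ 2 := by positivity
             linarith) zero_le_one

theorem bddMeas_quadBump (z₀ : EuclideanSpace ℝ (Fin N)) (r : ℝ) : BddMeas (quadBump z₀ r) := by
  refine ⟨by unfold quadBump; fun_prop, 1, fun x => ?_⟩
  rw [abs_of_nonneg (quadBump_nonneg _ _ _)]
  exact quadBump_le_one _ _ _

theorem quadBump_second_difference (z₀ : EuclideanSpace ℝ (Fin N)) (r : ℝ)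
    (x z : EuclideanSpace ℝ (Fin N)) :
    -2 * min (‖z‖ ^ 2 / r ^ 2) 1 ≤
      quadBump z₀ r (x + z) + quadBump z₀ r (x - z) - 2 * quadBump z₀ r x := by
  have h1 := quadBump_nonneg z₀ r (x + z)
  have h2 := quadBump_nonneg z₀ r (x - z)
  have h3 := quadBump_le_one z₀ r x
  have h0 : 0 ≤ min (‖z‖ ^ 2 / r ^ 2) 1 := by positivity
  rcases le_total (1 - ‖x - z₀‖ ^ 2 / r ^ 2) 0 with h | h
  · have : quadBump z₀ r x = 0 := max_eq_right h
    linarith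
  · have h4 : quadBump z₀ r x = 1 - ‖x - z₀‖ ^ 2 / r ^ 2 := max_eq_left h
    have h5 : 1 - ‖x + z - z₀‖ ^ 2 / r ^ 2 ≤ quadBump z₀ r (x + z) := le_max_left _ _
    have h6 : 1 - ‖x - z - z₀‖ ^ 2 / r ^ 2 ≤ quadBump z₀ r (x - z) := le_max_left _ _
    have h7 : ‖x + z - z₀‖ ^ 2 + ‖x - z - z₀‖ ^ 2 = 2 * ‖x - z₀‖ ^ 2 + 2 * ‖z‖ ^ 2 := by
      have := parallelogram_law_with_norm ℝ (x - z₀) z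
      rw [show x + z - z₀ = x - z₀ + z by abel, show x - z - z₀ = x - z₀ - z by abel]
      linarith
    have h8 : ‖x + z - z₀‖ ^ 2 / r ^ 2 + ‖x - z - z₀‖ ^ 2 / r ^ 2 =
        2 * (‖x - z₀‖ ^ 2 / r ^ 2) + 2 * (‖z‖ ^ 2 / r ^ 2) := by
      rw [← add_div, h7]; ring
    rcases le_total (‖z‖ ^ 2 / r ^ 2) 1 with h9 | h9
    · rw [min_eq_left h9]; linarith
    · rw [min_eq_right h9]; linarith

theorem jumpOp_quadBump_ge (hN : 0 < N) (hα1 : 0 < α) (hα2 : α < 2) {δ r : ℝ} (hδ : 0 < δ)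
    (hr : 0 < r) (z₀ x : EuclideanSpace ℝ (Fin N)) :
    -(r ^ (-α) * fracMass N α) ≤ jumpOp (fracKernel N α δ) (quadBump z₀ r) x := by
  have hJ := integrable_fracKernel (N := N) hα1 hα2 hδ
  obtain ⟨h1, h2⟩ := integral_min_div_mul_fracKernel_le (N := N) hN hα1 hα2 δ hr
  have hb := bddMeas_quadBump z₀ r
  rw [jumpOp_eq_half hJ (fun z => by simp [fracKernel]) hb]
  have h3 : ∫ z, -2 * (min (‖z‖ ^ 2 / r ^ 2) 1 * fracKernel N α δ z) ≤
      ∫ z, fracKernel N α δ z *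
        (quadBump z₀ r (x + z) + quadBump z₀ r (x - z) - 2 * quadBump z₀ r x) := by
    refine integral_mono (h1.const_mul _) ?_ fun z => ?_
    · have e1 := hb.integrable_mul hJ x
      have e2 : Integrable fun z => fracKernel N α δ z * quadBump z₀ r (x - z) := by
        have := e1.comp_neg
        simpa [fracKernel, sub_eq_add_neg] using this
      have e3 := hJ.mul_const (2 * quadBump z₀ r x)
      refine ((e1.add e2).sub e3).congr (Eventually.of_forall fun z => ?_)
      simp only [Pi.add_apply, Pi.sub_apply]; ring
    · have := mul_le_mul_of_nonneg_left (quadBump_second_difference z₀ r x z)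
        (fracKernel_nonneg (N := N) hα1 hα2 δ z)
      simp only
      linarith
  rw [integral_const_mul] at h3
  linarith

theorem boundary_improvement (hN : 0 < N) (hα1 : 0 < α) (hα2 : α < 2) (hD : MeasurableSet D)
    {δ : ℝ} (hδ : 0 < δ) {w : EuclideanSpace ℝ (Fin N) → ℝ} (hw : BddMeas w) {S₀ : ℝ}
    (hS₀ : ∀ x, w x ≤ S₀) {z₀ : EuclideanSpace ℝ (Fin N)} {M R S r ε η θ : ℝ} (hr : 0 < r)
    (hrR : 2 * r ≤ R) (hδr : δ ≤ 2 * r) (hS₀0 : 0 ≤ S₀)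
    (hin : ∀ x ∈ D ∩ Metric.ball z₀ R, -M ≤ jumpOp (fracKernel N α δ) w x)
    (hoff : ∀ x ∈ Dᶜ ∩ Metric.ball z₀ R, w x ≤ 0) (hwS : ∀ x ∈ Metric.ball z₀ R, w x ≤ S)
    (hε : 0 < ε) (hεS : ε ≤ S) (hη0 : 0 ≤ η) (hη : η ≤ 1 / 4)
    (hθ : θ * r ^ N ≤ volume.real (Dᶜ ∩ Metric.ball z₀ r))
    (hηθ : 2 * η * fracMass N α ≤ fracLapCoeff N α * 2 ^ (-((N : ℝ) + α)) * θ / 4)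
    (hlarge : M + S₀ * ((R / 2) ^ (-α) * fracMass N α) <
      ε * (fracLapCoeff N α * 2 ^ (-((N : ℝ) + α)) * θ / 4) * r ^ (-α)) :
    ∀ x ∈ Metric.ball z₀ (r / 2), w x ≤ S - η * ε := by
  intro y hy
  by_contra! hcon
  have hJ := integrable_fracKernel (N := N) hα1 hα2 hδ
  have hK0 := fracKernel_nonneg (N := N) hα1 hα2 δ
  have hR : 0 < R / 2 := by linarith
  set b := quadBump z₀ r with hb
  have hbB := bddMeas_quadBump z₀ r
  have hb0 := quadBump_nonneg z₀ r
  have hb1 := quadBump_le_one z₀ r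
  set v := fun x => w x + 2 * η * ε * b x with hv
  have hηε : 0 ≤ 2 * η * ε := by positivity
  have hvB : BddMeas v := hw.add (hbB.const_mul _)
  have hvle : ∀ x, v x ≤ w x + ε / 2 := by
    intro x
    have : 2 * η * ε * b x ≤ 2 * η * ε * 1 := mul_le_mul_of_nonneg_left (hb1 x) hηε
    simp only [hv]
    nlinarith
  have hbout : ∀ x, r ≤ ‖x - z₀‖ → v x = w x := by
    intro x hx
    have : b x = 0 := by
      refine max_eq_right ?_
      rw [sub_nonpos, one_le_div (by positivity)]
      gcongr
    simp [hv, this]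
  have hyb : 1 / 2 ≤ b y := by
    refine le_max_of_le_left ?_
    have h1 : ‖y - z₀‖ < r / 2 := by simpa [dist_eq_norm] using hy
    have h2 : ‖y - z₀‖ ^ 2 / r ^ 2 ≤ (r / 2) ^ 2 / r ^ 2 := by gcongr
    have h3 : (r / 2) ^ 2 / r ^ 2 = 1 / 4 := by field_simp; norm_num
    linarith
  have hvy : S < v y := by
    have : 2 * η * ε * (1 / 2) ≤ 2 * η * ε * b y := mul_le_mul_of_nonneg_left hyb hηε
    simp only [hv]; linarith
  have hyr : y ∈ Metric.ball z₀ r := Metric.ball_subset_ball (by linarith) hy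
  have hrR' : Metric.ball z₀ r ⊆ Metric.ball z₀ R := Metric.ball_subset_ball (by linarith)
  set c := ∫ z, fracKernel N α δ z with hc
  set Q := fracMass N α with hQ
  set A := Dᶜ ∩ Metric.ball z₀ r with hA
  have hAm : MeasurableSet A := hD.compl.inter measurableSet_ball
  have hAi : ∀ x, Integrable fun z => A.indicator (fun _ => (1 : ℝ)) (x + z) := by
    intro x
    have : Integrable (A.indicator fun _ => (1 : ℝ)) :=
      (integrable_indicator_iff hAm).2 (integrableOn_const
        ((measure_mono Set.inter_subset_right).trans_lt measure_ball_lt_top).ne)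
    exact this.comp_add_left x
  have key : ∀ e, 0 < e → ε / 2 * (fracLapCoeff N α * 2 ^ (-((N : ℝ) + α)) * θ * r ^ (-α)) ≤
      M + 2 * η * ε * (r ^ (-α) * Q) + S₀ * ((R / 2) ^ (-α) * Q) + c * e := by
    intro e he
    obtain ⟨x₁, hx₁⟩ : ∃ x₁, x₁ ∈ Metric.ball z₀ r ∧ S < v x₁ ∧
        ∀ x ∈ Metric.ball z₀ r, v x ≤ v x₁ + e := by
      have : Nonempty (Metric.ball z₀ r) := ⟨⟨y, hyr⟩⟩
      obtain ⟨⟨x, hx⟩, hxm⟩ := exists_forall_le_add (X := Metric.ball z₀ r) (w := fun x => v x)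
        (C := S₀ + ε / 2) (fun x => (hvle _).trans (by linarith [hS₀ x])) he
      by_cases hxS : S < v x
      · exact ⟨x, hx, hxS, fun x' hx' => hxm ⟨x', hx'⟩⟩
      · exact ⟨y, hyr, hvy, fun x' hx' => by
          have := hxm ⟨x', hx'⟩
          simp only at this
          linarith⟩
    obtain ⟨hx₁r, hx₁S, hx₁m⟩ := hx₁
    have hx₁D : x₁ ∈ D := by
      by_contra hx
      have h1 := hoff x₁ ⟨hx, hrR' hx₁r⟩
      linarith [hvle x₁]
    have hx₁n : ‖x₁ - z₀‖ < r := by simpa [dist_eq_norm] using hx₁r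
    have hx₁R : ∀ x ∈ Metric.ball z₀ R, v x ≤ v x₁ + e := by
      intro x hx
      by_cases hxr : x ∈ Metric.ball z₀ r
      · exact hx₁m x hxr
      · rw [hbout x (by simpa [dist_eq_norm] using hxr)]
        linarith [hwS x hx]
    have h1 : jumpOp (fracKernel N α δ) v x₁ ≤ ∫ z, (fracKernel N α δ z * e -
        ε / 2 * (fracLapCoeff N α * (2 * r) ^ (-((N : ℝ) + α)) *
          A.indicator (fun _ => (1 : ℝ)) (x₁ + z)) +
        S₀ * (min (‖z‖ ^ 2 / (R / 2) ^ 2) 1 * fracKernel N α δ z)) := by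
      refine integral_mono (hvB.integrable_jump hJ x₁) (((hJ.mul_const e).sub
        (((hAi x₁).const_mul _).const_mul _)).add
          ((integral_min_div_mul_fracKernel_le hN hα1 hα2 δ hR).1.const_mul S₀)) fun z => ?_
      have hKz := hK0 z
      have htail : 0 ≤ S₀ * (min (‖z‖ ^ 2 / (R / 2) ^ 2) 1 * fracKernel N α δ z) := by positivity
      simp only
      by_cases hzA : x₁ + z ∈ A
      · have h2 := hoff _ ⟨hzA.1, hrR' hzA.2⟩
        have h3 : v (x₁ + z) - v x₁ ≤ -(ε / 2) := by linarith [hvle (x₁ + z)]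
        have h4 : ‖z‖ ≤ 2 * r := by
          have h5 : ‖x₁ + z - z₀‖ < r := by simpa [dist_eq_norm] using hzA.2
          have h6 : ‖z‖ ≤ ‖x₁ + z - z₀‖ + ‖x₁ - z₀‖ := by
            have := norm_sub_le (x₁ + z - z₀) (x₁ - z₀)
            simpa using this
          linarith
        have h5 := le_fracKernel hα1 hα2 hδ hδr h4
        rw [Set.indicator_of_mem hzA]
        have h6 : fracKernel N α δ z * (v (x₁ + z) - v x₁) ≤ fracKernel N α δ z * -(ε / 2) :=
          mul_le_mul_of_nonneg_left h3 hKz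
        have h7 := mul_le_mul_of_nonneg_left h5 (show 0 ≤ ε / 2 by linarith)
        have h8 := mul_nonneg hKz he.le
        linarith
      · rw [Set.indicator_of_notMem hzA]
        by_cases hzR : x₁ + z ∈ Metric.ball z₀ R
        · have h2 := mul_le_mul_of_nonneg_left
            (show v (x₁ + z) - v x₁ ≤ e by linarith [hx₁R _ hzR]) hKz
          linarith
        · have h5 : R ≤ ‖x₁ + z - z₀‖ := by simpa [dist_eq_norm] using hzR
          have h6 : ‖x₁ + z - z₀‖ ≤ ‖x₁ - z₀‖ + ‖z‖ := by
            rw [show x₁ + z - z₀ = x₁ - z₀ + z by abel]; exact norm_add_le _ _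
          have h7 : R / 2 ≤ ‖z‖ := by linarith
          have h8 : min (‖z‖ ^ 2 / (R / 2) ^ 2) 1 = 1 := by
            refine min_eq_right ?_
            rw [one_le_div (by positivity)]
            gcongr
          rw [h8]
          have h9 : v (x₁ + z) = w (x₁ + z) := hbout _ (by linarith)
          have h2 := mul_le_mul_of_nonneg_left
            (show v (x₁ + z) - v x₁ ≤ S₀ by rw [h9]; linarith [hS₀ (x₁ + z)]) hKz
          have h8 := mul_nonneg hKz he.le
          linarith
    have h2 : -M - 2 * η * ε * (r ^ (-α) * Q) ≤ jumpOp (fracKernel N α δ) v x₁ := by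
      simp only [hv]
      rw [jumpOp_add hw (hbB.const_mul _) hJ, jumpOp_const_mul]
      have h3 := hin x₁ ⟨hx₁D, hrR' hx₁r⟩
      have h4 := mul_le_mul_of_nonneg_left (jumpOp_quadBump_ge hN hα1 hα2 hδ hr z₀ x₁) hηε
      linarith
    have i1 : Integrable fun z => fracKernel N α δ z * e := hJ.mul_const e
    have i2 : Integrable fun z => ε / 2 * (fracLapCoeff N α * (2 * r) ^ (-((N : ℝ) + α)) *
          A.indicator (fun _ => (1 : ℝ)) (x₁ + z)) := ((hAi x₁).const_mul _).const_mul _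
    have i12 : Integrable fun z => fracKernel N α δ z * e -
        ε / 2 * (fracLapCoeff N α * (2 * r) ^ (-((N : ℝ) + α)) *
          A.indicator (fun _ => (1 : ℝ)) (x₁ + z)) := i1.sub i2
    rw [integral_add i12 ((integral_min_div_mul_fracKernel_le hN hα1 hα2 δ hR).1.const_mul S₀),
      integral_sub i1 i2, integral_mul_const, integral_const_mul, integral_const_mul,
      integral_const_mul, integral_add_left_eq_self (fun z => A.indicator (fun _ => (1 : ℝ)) z),
      integral_indicator hAm, setIntegral_const, smul_eq_mul, mul_one, ← hc] at h1
    have h3 := mul_le_mul_of_nonneg_left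
      (integral_min_div_mul_fracKernel_le (N := N) hN hα1 hα2 δ hR).2 hS₀0
    have h4 : fracLapCoeff N α * 2 ^ (-((N : ℝ) + α)) * θ * r ^ (-α) ≤
        fracLapCoeff N α * (2 * r) ^ (-((N : ℝ) + α)) * volume.real A := by
      have h5 : (2 * r) ^ (-((N : ℝ) + α)) * r ^ N = 2 ^ (-((N : ℝ) + α)) * r ^ (-α) := by
        rw [Real.mul_rpow zero_le_two hr.le, mul_assoc, ← Real.rpow_natCast r N,
          ← Real.rpow_add hr]
        congr 2; ring
      have h6 : 0 ≤ fracLapCoeff N α * (2 * r) ^ (-((N : ℝ) + α)) :=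
        mul_nonneg (fracLapCoeff_pos hα1 hα2).le (by positivity)
      calc fracLapCoeff N α * 2 ^ (-((N : ℝ) + α)) * θ * r ^ (-α)
          = fracLapCoeff N α * (2 ^ (-((N : ℝ) + α)) * r ^ (-α)) * θ := by ring
        _ = fracLapCoeff N α * (2 * r) ^ (-((N : ℝ) + α)) * (θ * r ^ N) := by rw [← h5]; ring
        _ ≤ _ := mul_le_mul_of_nonneg_left hθ h6
    have h5 := mul_le_mul_of_nonneg_left h4 (show 0 ≤ ε / 2 by linarith)
    linarith
  have hc0 : 0 ≤ c := integral_nonneg hK0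
  have key' : ε / 2 * (fracLapCoeff N α * 2 ^ (-((N : ℝ) + α)) * θ * r ^ (-α)) ≤
      M + 2 * η * ε * (r ^ (-α) * Q) + S₀ * ((R / 2) ^ (-α) * Q) := by
    refine le_of_forall_pos_le_add fun e he => ?_
    refine (key (e / (c + 1)) (by positivity)).trans ?_
    have : c * (e / (c + 1)) ≤ e := by
      rw [mul_div_assoc', div_le_iff₀ (by positivity)]; nlinarith
    linarith
  have hrα : 0 ≤ ε * r ^ (-α) := by positivity
  have h1 := mul_le_mul_of_nonneg_left hηθ hrα
  linarith

end Boundary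

section BoundaryRegularity

variable {N : ℕ} {α : ℝ} {D : Set (EuclideanSpace ℝ (Fin N))}

theorem exists_density_of_cone {z₀ : EuclideanSpace ℝ (Fin N)}
    (hcone : ∃ C : Set (EuclideanSpace ℝ (Fin N)),
      C.Nonempty ∧ IsOpen C ∧ (∀ y ∈ C, ∀ t : ℝ, 0 < t → z₀ + t • (y - z₀) ∈ C) ∧
      ∃ r : ℝ, 0 < r ∧ C ∩ Metric.ball z₀ r ⊆ Dᶜ) :
    ∃ θ > 0, ∃ r₁ > 0, ∀ r, 0 < r → r ≤ r₁ →
      θ * r ^ N ≤ volume.real (Dᶜ ∩ Metric.ball z₀ r) := by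
  obtain ⟨C, ⟨y, hy⟩, hCo, hCs, r₁, hr₁, hCD⟩ := hcone
  refine ⟨volume.real (C ∩ Metric.ball z₀ 1), ?_, r₁, hr₁, fun r hr hrr => ?_⟩
  · refine ENNReal.toReal_pos ?_
      ((measure_mono Set.inter_subset_right).trans_lt measure_ball_lt_top).ne
    refine ((hCo.inter Metric.isOpen_ball).measure_pos _ ⟨z₀ + (1 / (‖y - z₀‖ + 1)) • (y - z₀),
      hCs y hy _ (by positivity), ?_⟩).ne'
    rw [Metric.mem_ball, dist_eq_norm, add_sub_cancel_left, norm_smul, Real.norm_of_nonneg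
      (by positivity), one_div_mul_eq_div, div_lt_one (by positivity)]
    linarith
  · have h1 : AffineMap.homothety z₀ r '' (C ∩ Metric.ball z₀ 1) ⊆ Dᶜ ∩ Metric.ball z₀ r := by
      rintro _ ⟨x, ⟨hxC, hx1⟩, rfl⟩
      have h2 : AffineMap.homothety z₀ r x = z₀ + r • (x - z₀) := by
        simp [AffineMap.homothety_apply, add_comm]
      have h3 : AffineMap.homothety z₀ r x ∈ Metric.ball z₀ r := by
        rw [Metric.mem_ball, dist_eq_norm] at hx1
        rw [h2, Metric.mem_ball, dist_eq_norm, add_sub_cancel_left, norm_smul,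
          Real.norm_of_nonneg hr.le]
        exact mul_lt_of_lt_one_right hr hx1
      refine ⟨hCD ⟨h2 ▸ hCs x hxC r hr, Metric.ball_subset_ball hrr h3⟩, h3⟩
    have h2 := measureReal_mono h1
      ((measure_mono Set.inter_subset_right).trans_lt measure_ball_lt_top).ne (μ := volume)
    rw [measureReal_def, Measure.addHaar_image_homothety, ENNReal.toReal_mul, finrank_euclideanSpace,
      Fintype.card_fin, ENNReal.toReal_ofReal (abs_nonneg _), abs_of_nonneg (by positivity),
      ← measureReal_def, mul_comm] at h2
    exact h2

theorem exists_uniform_boundary_bound (hN : 0 < N) (hα1 : 0 < α) (hα2 : α < 2)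
    (hD : MeasurableSet D) {z₀ : EuclideanSpace ℝ (Fin N)} {θ r₁ : ℝ} (hθ : 0 < θ) (hr₁ : 0 < r₁)
    (hdens : ∀ r, 0 < r → r ≤ r₁ → θ * r ^ N ≤ volume.real (Dᶜ ∩ Metric.ball z₀ r))
    {S₀ M R₀ ε : ℝ} (hS₀ : 0 ≤ S₀) (hR₀ : 0 < R₀) (hε : 0 < ε) :
    ∃ r > 0, ∃ δ₀ > 0, ∀ δ, 0 < δ → δ < δ₀ → ∀ w : EuclideanSpace ℝ (Fin N) → ℝ, BddMeas w →
      (∀ x, w x ≤ S₀) →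
      (∀ x ∈ D ∩ Metric.ball z₀ R₀, -M ≤ jumpOp (fracKernel N α δ) w x) →
      (∀ x ∈ Dᶜ ∩ Metric.ball z₀ R₀, w x ≤ 0) → ∀ x ∈ Metric.ball z₀ r, w x ≤ ε := by
  set a := fracLapCoeff N α * 2 ^ (-((N : ℝ) + α)) * θ / 4 with ha
  have ha0 : 0 < a := by
    have := fracLapCoeff_pos (N := N) hα1 hα2
    positivity
  have hQ0 := fracMass_nonneg (N := N) hα1 hα2
  obtain ⟨η, hη0, hη, hηa⟩ : ∃ η > 0, η ≤ 1 / 4 ∧ 2 * η * fracMass N α ≤ a := by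
    refine ⟨min (1 / 4) (a / (2 * (fracMass N α + 1))), by positivity, min_le_left _ _, ?_⟩
    have h1 : min (1 / 4) (a / (2 * (fracMass N α + 1))) ≤ a / (2 * (fracMass N α + 1)) :=
      min_le_right _ _
    rw [le_div_iff₀ (by positivity)] at h1
    have h2 : 0 < min (1 / 4) (a / (2 * (fracMass N α + 1))) := by positivity
    linarith
  have key : ∀ k : ℕ, ∃ r > 0, r ≤ R₀ ∧ ∃ δ₀ > 0, ∀ δ, 0 < δ → δ < δ₀ →
      ∀ w : EuclideanSpace ℝ (Fin N) → ℝ, BddMeas w → (∀ x, w x ≤ S₀) →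
      (∀ x ∈ D ∩ Metric.ball z₀ R₀, -M ≤ jumpOp (fracKernel N α δ) w x) →
      (∀ x ∈ Dᶜ ∩ Metric.ball z₀ R₀, w x ≤ 0) →
      ∀ x ∈ Metric.ball z₀ r, w x ≤ max ε (S₀ - k * (η * ε)) := by
    intro k
    induction k with
    | zero =>
      refine ⟨R₀, hR₀, le_rfl, 1, one_pos, fun δ _ _ w _ hwS _ _ x _ => ?_⟩
      simpa using Or.inr (hwS x)
    | succ k ih =>
      obtain ⟨R, hR, hRR, δ₀, hδ₀, hP⟩ := ih
      have hlim := (tendsto_rpow_neg_nhdsGT_zero (neg_neg_of_pos hα1)).const_mul_atTop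
        (show 0 < ε * a by positivity)
      have hev := (hlim.eventually_gt_atTop (M + S₀ * ((R / 2) ^ (-α) * fracMass N α))).and
        (Ioo_mem_nhdsGT (show 0 < min (R / 2) r₁ by positivity))
      obtain ⟨r, hrl, hr0, hrm⟩ := hev.exists
      have hrR : 2 * r ≤ R := by linarith [hrm.le.trans (min_le_left _ _)]
      have hrr₁ : r ≤ r₁ := hrm.le.trans (min_le_right _ _)
      refine ⟨r / 2, by positivity, by linarith, min δ₀ (2 * r), by positivity,
        fun δ hδ hδm w hw hwS hin hoff x hx => ?_⟩
      have hsub := Metric.ball_subset_ball (x := z₀) hRR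
      have h1 := boundary_improvement hN hα1 hα2 hD hδ hw hwS hr0 hrR
        (hδm.le.trans (min_le_right _ _)) hS₀
        (fun x hx => hin x ⟨hx.1, hsub hx.2⟩) (fun x hx => hoff x ⟨hx.1, hsub hx.2⟩)
        (hP δ hδ (hδm.trans_le (min_le_left _ _)) w hw hwS hin hoff) hε (le_max_left _ _)
        hη0.le hη (hdens r hr0 hrr₁) hηa hrl x hx
      refine h1.trans ?_
      have h2 : 0 < η * ε := by positivity
      rcases max_cases ε (S₀ - k * (η * ε)) with ⟨h, _⟩ | ⟨h, _⟩
      · rw [h]; exact le_max_of_le_left (by linarith)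
      · rw [h]; refine le_max_of_le_right ?_
        push_cast; linarith
  obtain ⟨k, hk⟩ := exists_nat_ge (S₀ / (η * ε))
  obtain ⟨r, hr, -, δ₀, hδ₀, hP⟩ := key k
  refine ⟨r, hr, δ₀, hδ₀, fun δ hδ hδδ w hw hwS hin hoff x hx => ?_⟩
  have h1 := hP δ hδ hδδ w hw hwS hin hoff x hx
  rw [div_le_iff₀ (by positivity)] at hk
  exact h1.trans (max_le le_rfl (by linarith))

end BoundaryRegularity

section Translation

variable {N : ℕ}

theorem exists_translation_integral_le {ρ : EuclideanSpace ℝ (Fin N) → ℝ} (hρ : Integrable ρ)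
    {ε : ℝ} (hε : 0 < ε) :
    ∃ t > 0, ∀ τ : EuclideanSpace ℝ (Fin N), ‖τ‖ < t → ∫ x, |ρ (x + τ) - ρ x| ≤ ε := by
  set sh : C(EuclideanSpace ℝ (Fin N), C(EuclideanSpace ℝ (Fin N), EuclideanSpace ℝ (Fin N))) :=
    ContinuousMap.curry ⟨fun p => p.2 + p.1, by fun_prop⟩
  have hmp : ∀ τ, MeasurePreserving (sh τ) volume volume :=
    fun τ => measurePreserving_add_right volume τ
  have hρ1 : MemLp ρ 1 := memLp_one_iff_integrable.2 hρ
  have hc : Continuous fun τ => Lp.compMeasurePreserving (sh τ) (hmp τ) (hρ1.toLp ρ) :=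
    Continuous.compMeasurePreservingLp continuous_const sh.continuous hmp
      ENNReal.one_ne_top
  have h0 := Metric.continuous_iff.1 hc 0 ε hε
  obtain ⟨t, ht, h1⟩ := h0
  refine ⟨t, ht, fun τ hτ => ?_⟩
  have h2 := (h1 τ (by simpa using hτ)).le
  rw [dist_eq_norm, Lp.toLp_compMeasurePreserving, Lp.toLp_compMeasurePreserving,
    ← MemLp.toLp_sub, Lp.norm_toLp, eLpNorm_one_eq_lintegral_enorm,
    ← integral_norm_eq_lintegral_enorm] at h2
  · refine le_of_eq_of_le (integral_congr_ae (Eventually.of_forall fun x => ?_)) h2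
    change |ρ (x + τ) - ρ x| = ‖ρ (x + τ) - ρ (x + 0)‖
    rw [add_zero, Real.norm_eq_abs]
  · exact ((hρ1.comp_measurePreserving (hmp τ)).sub
      (hρ1.comp_measurePreserving (hmp 0))).aestronglyMeasurable

end Translation

section ApproxSolutions

variable {N : ℕ} {α : ℝ} {D : Set (EuclideanSpace ℝ (Fin N))}

/-- Bounded data of the Dirichlet problem `Δ^{α/2} u = -ρ ψ(u)` in `D`, `u = f` off `D`, with
bounded nonlinearity `ψ` and with every boundary point of positive exterior density. -/
structure DirichletData (N : ℕ) (α : ℝ) (D : Set (EuclideanSpace ℝ (Fin N))) (β : ℝ)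
    (ρ : EuclideanSpace ℝ (Fin N) → ℝ) (M₁ : ℝ) (ψ : ℝ → ℝ) (M₂ : ℝ)
    (f : EuclideanSpace ℝ (Fin N) → ℝ) (F : ℝ) : Prop where
  dim_pos : 0 < N
  index_pos : 0 < α
  index_lt : α < 2
  isOpen : IsOpen D
  bounded : Bornology.IsBounded D
  exit : ∀ δ, 0 < δ → δ ≤ 1 → ExitKernel (fracKernel N α δ) D β
  density : ∀ z₀ ∈ frontier D, ∃ θ > 0, ∃ r₁ > 0, ∀ r, 0 < r → r ≤ r₁ →
    θ * r ^ N ≤ volume.real (Dᶜ ∩ Metric.ball z₀ r)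
  meas_weight : Measurable ρ
  weight_nonneg : ∀ x, 0 ≤ ρ x
  weight_le : ∀ x, ρ x ≤ M₁
  weight_off : ∀ x ∉ D, ρ x = 0
  cont_nonlin : Continuous ψ
  anti_nonlin : Antitone ψ
  nonlin_nonneg : ∀ t, 0 ≤ ψ t
  nonlin_le : ∀ t, ψ t ≤ M₂
  meas_datum : Measurable f
  datum_le : ∀ x, |f x| ≤ F
  cont_datum : ContinuousOn f Dᶜ

/-- Solutions of the Dirichlet problem with the fractional Laplacian replaced by the generator of
the truncated kernel. -/
def IsApproxSol (N : ℕ) (α : ℝ) (D : Set (EuclideanSpace ℝ (Fin N)))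
    (ρ : EuclideanSpace ℝ (Fin N) → ℝ) (ψ : ℝ → ℝ) (f : EuclideanSpace ℝ (Fin N) → ℝ)
    (δ : ℝ) (u : EuclideanSpace ℝ (Fin N) → ℝ) : Prop :=
  BddMeas u ∧ (∀ x ∉ D, u x = f x) ∧
    ∀ x ∈ D, jumpOp (fracKernel N α δ) u x = -(ρ x * ψ (u x))

namespace DirichletData

variable {β M₁ M₂ F : ℝ} {ρ f : EuclideanSpace ℝ (Fin N) → ℝ} {ψ : ℝ → ℝ}
  (h : DirichletData N α D β ρ M₁ ψ M₂ f F)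

include h

theorem rate_pos : 0 < β := (h.exit 1 one_pos le_rfl).rate_pos

theorem weight_bound_nonneg : 0 ≤ M₁ := (h.weight_nonneg 0).trans (h.weight_le 0)

theorem nonlin_bound_nonneg : 0 ≤ M₂ := (h.nonlin_nonneg 0).trans (h.nonlin_le 0)

theorem datum_bound_nonneg : 0 ≤ F := (abs_nonneg _).trans (h.datum_le 0)

theorem volume_ne_top : volume D ≠ ⊤ := h.bounded.measure_lt_top.ne

theorem integrable_weight : Integrable ρ :=
  BddMeas.integrable_of_eq_zero ⟨h.meas_weight, M₁, fun x => by
    rw [abs_of_nonneg (h.weight_nonneg x)]; exact h.weight_le x⟩ h.isOpen.measurableSet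
    h.volume_ne_top h.weight_off

theorem exists_approxSol {δ : ℝ} (hδ : 0 < δ) (hδ1 : δ ≤ 1) :
    ∃ u, IsApproxSol N α D ρ ψ f δ u :=
  (h.exit δ hδ hδ1).exists_solution (integral_fracKernel_pos h.index_pos h.index_lt hδ)
    h.meas_weight h.weight_nonneg h.weight_le h.cont_nonlin h.anti_nonlin h.nonlin_nonneg
    h.nonlin_le ⟨h.meas_datum, F, h.datum_le⟩

theorem weight_mul_nonlin_le (x : EuclideanSpace ℝ (Fin N)) (t : ℝ) : ρ x * ψ t ≤ M₁ * M₂ :=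
  mul_le_mul (h.weight_le x) (h.nonlin_le t) (h.nonlin_nonneg t) h.weight_bound_nonneg

theorem weight_mul_nonlin_nonneg (x : EuclideanSpace ℝ (Fin N)) (t : ℝ) : 0 ≤ ρ x * ψ t :=
  mul_nonneg (h.weight_nonneg x) (h.nonlin_nonneg t)

theorem le_approxSol {δ : ℝ} (hδ : 0 < δ) (hδ1 : δ ≤ 1) {u : EuclideanSpace ℝ (Fin N) → ℝ}
    (hu : IsApproxSol N α D ρ ψ f δ u) {a : ℝ} (ha : ∀ x ∉ D, a ≤ f x)
    (x : EuclideanSpace ℝ (Fin N)) : a ≤ u x := by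
  have := (h.exit δ hδ hδ1).comparison (w := fun x => a - u x) le_rfl
    ((bddMeas_const a).sub hu.1)
    (fun x hx => by rw [hu.2.1 x hx]; linarith [ha x hx])
    (fun x hx _ => by
      rw [jumpOp_const_sub, hu.2.2 x hx]; linarith [h.weight_mul_nonlin_nonneg x (u x)]) x
  simp only [zero_div] at this
  linarith

theorem abs_approxSol_le {δ : ℝ} (hδ : 0 < δ) (hδ1 : δ ≤ 1) {u : EuclideanSpace ℝ (Fin N) → ℝ}
    (hu : IsApproxSol N α D ρ ψ f δ u) (x : EuclideanSpace ℝ (Fin N)) :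
    |u x| ≤ F + M₁ * M₂ / β := by
  have hM : 0 ≤ M₁ * M₂ := mul_nonneg h.weight_bound_nonneg h.nonlin_bound_nonneg
  have hβ := h.rate_pos
  have h1 := h.le_approxSol hδ hδ1 hu (a := -F)
    (fun x _ => (abs_le.1 (h.datum_le x)).1) x
  have h2 := (h.exit δ hδ hδ1).comparison (w := fun x => u x - F) hM
    (hu.1.sub (bddMeas_const F))
    (fun x hx => by rw [hu.2.1 x hx]; linarith [(abs_le.1 (h.datum_le x)).2])
    (fun x hx _ => by
      rw [jumpOp_sub_const, hu.2.2 x hx]; linarith [h.weight_mul_nonlin_le x (u x)]) x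
  have h3 : 0 ≤ M₁ * M₂ / β := by positivity
  exact abs_le.2 ⟨by linarith, by linarith⟩

theorem near_frontier {z₀ : EuclideanSpace ℝ (Fin N)} (hz₀ : z₀ ∈ frontier D) {ε : ℝ}
    (hε : 0 < ε) :
    ∃ t > 0, ∀ δ, 0 < δ → δ < t → ∀ u, IsApproxSol N α D ρ ψ f δ u →
      ∀ x ∈ Metric.ball z₀ t, |u x - f z₀| ≤ ε := by
  have hz₀D : z₀ ∈ Dᶜ := fun hz => by
    rw [h.isOpen.frontier_eq] at hz₀; exact hz₀.2 hz
  obtain ⟨R₀, hR₀, hf⟩ := Metric.continuousOn_iff.1 h.cont_datum z₀ hz₀D (ε / 2) (by positivity)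
  obtain ⟨θ, hθ, r₁, hr₁, hdens⟩ := h.density z₀ hz₀
  have hM : 0 ≤ M₁ * M₂ := mul_nonneg h.weight_bound_nonneg h.nonlin_bound_nonneg
  have hβ := h.rate_pos
  have hF := h.datum_bound_nonneg
  set U := F + M₁ * M₂ / β with hU
  have hU0 : 0 ≤ U := by positivity
  obtain ⟨r, hr, δ₀, hδ₀, hP⟩ := exists_uniform_boundary_bound h.dim_pos h.index_pos h.index_lt
    h.isOpen.measurableSet hθ hr₁ hdens (S₀ := U + F) (M := M₁ * M₂) (by positivity) hR₀
    (show 0 < ε / 2 by positivity)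
  refine ⟨min (min r δ₀) 1, by positivity, fun δ hδ hδt u hu x hx => ?_⟩
  have hδ1 : δ ≤ 1 := hδt.le.trans (min_le_right _ _)
  have hδδ : δ < δ₀ := hδt.trans_le ((min_le_left _ _).trans (min_le_right _ _))
  have hxr : x ∈ Metric.ball z₀ r :=
    Metric.ball_subset_ball ((min_le_left _ _).trans (min_le_left _ _)) hx
  have hub := fun y => abs_le.1 (h.abs_approxSol_le hδ hδ1 hu y)
  have hfz := abs_le.1 (h.datum_le z₀)
  have hfb : ∀ y ∈ Dᶜ ∩ Metric.ball z₀ R₀, |f y - f z₀| < ε / 2 := fun y hy => by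
    rw [← Real.dist_eq]; exact hf y hy.1 hy.2
  have h1 := hP δ hδ hδδ (fun y => u y - (f z₀ + ε / 2)) (hu.1.sub (bddMeas_const _))
    (fun y => by linarith [(hub y).2])
    (fun y hy => by
      rw [jumpOp_sub_const, hu.2.2 y hy.1]; linarith [h.weight_mul_nonlin_le y (u y)])
    (fun y hy => by rw [hu.2.1 y hy.1]; linarith [(abs_lt.1 (hfb y hy)).2]) x hxr
  have h2 := hP δ hδ hδδ (fun y => (f z₀ - ε / 2) - u y) ((bddMeas_const _).sub hu.1)
    (fun y => by linarith [(hub y).1])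
    (fun y hy => by
      rw [jumpOp_const_sub, hu.2.2 y hy.1]; linarith [h.weight_mul_nonlin_nonneg y (u y)])
    (fun y hy => by rw [hu.2.1 y hy.1]; linarith [(abs_lt.1 (hfb y hy)).1]) x hxr
  exact abs_le.2 ⟨by linarith, by linarith⟩

theorem near_compl {z₀ : EuclideanSpace ℝ (Fin N)} (hz₀ : z₀ ∉ D) {ε : ℝ} (hε : 0 < ε) :
    ∃ t > 0, ∀ δ, 0 < δ → δ < t → ∀ u, IsApproxSol N α D ρ ψ f δ u →
      ∀ x ∈ Metric.ball z₀ t, |u x - f z₀| ≤ ε := by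
  by_cases hz : z₀ ∈ frontier D
  · exact h.near_frontier hz hε
  · have hint : z₀ ∈ interior Dᶜ := by
      rw [interior_compl]
      intro hcl
      rw [h.isOpen.frontier_eq] at hz
      exact hz ⟨hcl, hz₀⟩
    obtain ⟨r, hr, hrD⟩ := Metric.mem_nhds_iff.1 (mem_interior_iff_mem_nhds.1 hint)
    obtain ⟨R₀, hR₀, hf⟩ := Metric.continuousOn_iff.1 h.cont_datum z₀ hz₀ ε hε
    refine ⟨min r R₀, by positivity, fun δ _ _ u hu x hx => ?_⟩
    have hxD : x ∈ Dᶜ := hrD (Metric.ball_subset_ball (min_le_left _ _) hx)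
    rw [hu.2.1 x hxD, ← Real.dist_eq]
    exact (hf x hxD (Metric.ball_subset_ball (min_le_right _ _) hx)).le

theorem oscillation_compl (R : ℝ) {ε : ℝ} (hε : 0 < ε) :
    ∃ t > 0, ∀ δ, 0 < δ → δ < t → ∀ u, IsApproxSol N α D ρ ψ f δ u →
      ∀ x τ : EuclideanSpace ℝ (Fin N), ‖x‖ ≤ R → ‖τ‖ < t → (x ∉ D ∨ x + τ ∉ D) →
        |u (x + τ) - u x| ≤ ε := by
  have hK : IsCompact (Metric.closedBall (0 : EuclideanSpace ℝ (Fin N)) (R + 1) \ D) :=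
    (isCompact_closedBall _ _).diff h.isOpen
  have hev := hK.eventually_forall_of_forall_eventually (x₀ := (0 : ℝ))
    (P := fun t x => ∀ δ, 0 < δ → δ < t → ∀ u, IsApproxSol N α D ρ ψ f δ u →
      ∀ τ : EuclideanSpace ℝ (Fin N), ‖τ‖ < t → |u (x + τ) - u x| ≤ ε) (by
    intro z₀ hz₀
    obtain ⟨t, ht, hP⟩ := h.near_compl hz₀.2 (show 0 < ε / 2 by positivity)
    filter_upwards [prod_mem_nhds (Iio_mem_nhds (show (0 : ℝ) < t / 2 by positivity))
      (Metric.ball_mem_nhds z₀ (show 0 < t / 2 by positivity))] with p hp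
    obtain ⟨hp1, hp2⟩ := hp
    simp only [Set.mem_Iio, Metric.mem_ball, dist_eq_norm] at hp1 hp2
    intro δ hδ hδp u hu τ hτ
    have h1 := hP δ hδ (by linarith) u hu p.2 (by
      rw [Metric.mem_ball, dist_eq_norm]; linarith)
    have h2 := hP δ hδ (by linarith) u hu (p.2 + τ) (by
      rw [Metric.mem_ball, dist_eq_norm, show p.2 + τ - z₀ = (p.2 - z₀) + τ by abel]
      linarith [norm_add_le (p.2 - z₀) τ])
    rw [abs_le] at h1 h2 ⊢
    constructor <;> linarith [h1.1, h1.2, h2.1, h2.2])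
  obtain ⟨t, ht, hP⟩ := Metric.eventually_nhds_iff.1 hev
  have hP' := hP (y := min (t / 2) 1) (by
    rw [dist_zero_right, Real.norm_of_nonneg (by positivity)]
    exact (min_le_left _ _).trans_lt (by linarith))
  refine ⟨min (t / 2) 1, by positivity, fun δ hδ hδt u hu x τ hx hτ hD => ?_⟩
  have hτ1 : ‖τ‖ ≤ 1 := hτ.le.trans (min_le_right _ _)
  rcases hD with hD | hD
  · exact hP' x ⟨by rw [mem_closedBall_zero_iff]; linarith, hD⟩ δ hδ hδt u hu τ hτ
  · have := hP' (x + τ) ⟨by rw [mem_closedBall_zero_iff]; linarith [norm_add_le x τ], hD⟩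
      δ hδ hδt u hu (-τ) (by rwa [norm_neg])
    rw [add_neg_cancel_right, abs_sub_comm] at this
    exact this

end DirichletData

end ApproxSolutions

section Equicontinuity

variable {N : ℕ} {α : ℝ} {D : Set (EuclideanSpace ℝ (Fin N))}

namespace DirichletData

variable {β M₁ M₂ F : ℝ} {ρ f : EuclideanSpace ℝ (Fin N) → ℝ} {ψ : ℝ → ℝ}
  (h : DirichletData N α D β ρ M₁ ψ M₂ f F)

include h

theorem exists_small_barrier {M ε : ℝ} (hM : 0 ≤ M) (hε : 0 < ε) :
    ∃ A > 0, ∃ t > 0, ∀ δ, 0 < δ → δ < t → ∀ g : EuclideanSpace ℝ (Fin N) → ℝ, Measurable g →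
      (∀ x, 0 ≤ g x) → (∀ x, g x ≤ M) →
      ∃ v, BddMeas v ∧ (∀ x ∉ D, v x = 0) ∧ (∀ x, 0 ≤ v x) ∧
        (∀ x ∈ D, jumpOp (fracKernel N α δ) v x = -g x) ∧
        ∀ x, v x ≤ A * (∫ x in D, g x) + ε := by
  have hα1 := h.index_pos
  have hα2 := h.index_lt
  have hβ := h.rate_pos
  have hc := fracLapCoeff_pos (N := N) hα1 hα2
  have hV : ∀ r : ℝ, 0 < r →
      0 < volume.real (Metric.closedBall (0 : EuclideanSpace ℝ (Fin N)) r) := fun r hr => by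
    rw [measureReal_def]
    exact ENNReal.toReal_pos (Metric.measure_closedBall_pos _ _ hr).ne'
      (isCompact_closedBall _ _).measure_ne_top
  have hV1 := hV 1 one_pos
  set V := volume.real (Metric.closedBall (0 : EuclideanSpace ℝ (Fin N)) 1) with hVdef
  have hy : 0 < ε * fracLapCoeff N α * V / (M + 1) := by positivity
  set y := ε * fracLapCoeff N α * V / (M + 1) with hydef
  set r := y ^ α⁻¹ with hr
  have hr0 : 0 < r := Real.rpow_pos_of_pos hy _
  have hrα : r ^ α = y := Real.rpow_inv_rpow hy.le hα1.ne'
  have hVr : volume.real (Metric.closedBall (0 : EuclideanSpace ℝ (Fin N)) r) = r ^ N * V := by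
    have := Measure.addHaar_real_closedBall' (volume : Measure (EuclideanSpace ℝ (Fin N))) 0
      hr0.le
    simpa using this
  have hκ : 0 < fracLapCoeff N α * r ^ (-((N : ℝ) + α)) := by positivity
  refine ⟨1 / (β * (r ^ N * V)), by positivity, min r 1, by positivity,
    fun δ hδ hδt g hgm hg0 hgM => ?_⟩
  obtain ⟨v, hv, hvD, hv0, hvJ, hvle⟩ :=
    (h.exit δ hδ (hδt.le.trans (min_le_right _ _))).exists_barrier h.volume_ne_top
      (integral_fracKernel_pos hα1 hα2 hδ) hκ hr0
      (fun z hz => le_fracKernel hα1 hα2 hδ (hδt.le.trans (min_le_left _ _)) hz) hgm hg0 hgM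
  refine ⟨v, hv, hvD, hv0, hvJ, fun x => (hvle x).trans ?_⟩
  rw [hVr, add_div]
  have e1 : (∫ x in D, g x) / β / (r ^ N * V) = 1 / (β * (r ^ N * V)) * ∫ x in D, g x := by
    field_simp
  have e2 : M / (fracLapCoeff N α * r ^ (-((N : ℝ) + α))) / (r ^ N * V) =
      M * r ^ α / (fracLapCoeff N α * V) := by
    have e3 : r ^ (-((N : ℝ) + α)) = (r ^ N * r ^ α)⁻¹ := by
      rw [Real.rpow_neg hr0.le, Real.rpow_add hr0, Real.rpow_natCast]
    rw [e3]
    have : 0 < r ^ α := Real.rpow_pos_of_pos hr0 _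
    field_simp
  rw [e1, e2]
  have e4 : M * r ^ α / (fracLapCoeff N α * V) ≤ ε := by
    rw [hrα, hydef, div_le_iff₀ (by positivity), mul_div_assoc', div_le_iff₀ (by positivity)]
    have : 0 < ε * fracLapCoeff N α * V := by positivity
    nlinarith
  linarith

theorem equicontinuity (R : ℝ) {ε : ℝ} (hε : 0 < ε) :
    ∃ t > 0, ∀ δ, 0 < δ → δ < t → ∀ u, IsApproxSol N α D ρ ψ f δ u →
      ∀ x τ : EuclideanSpace ℝ (Fin N), ‖x‖ ≤ R → ‖τ‖ < t → |u (x + τ) - u x| ≤ ε := by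
  have hα1 := h.index_pos
  have hα2 := h.index_lt
  have hβ := h.rate_pos
  have hM1 := h.weight_bound_nonneg
  have hM2 := h.nonlin_bound_nonneg
  have hF := h.datum_bound_nonneg
  have hQ := fracMass_nonneg (N := N) hα1 hα2
  obtain ⟨RD, hRD⟩ := h.bounded.exists_norm_le
  set U := F + M₁ * M₂ / β with hU
  have hU0 : 0 ≤ U := by positivity
  set H := 2 * U + ε with hH
  have hH0 : 0 < H := by positivity
  obtain ⟨L, hL0, hL⟩ : ∃ L : ℝ, 0 < L ∧ H * (L ^ (-α) * fracMass N α) / β ≤ ε / 4 := by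
    have hlim : Tendsto (fun L : ℝ => H * (L ^ (-α) * fracMass N α) / β) atTop
        (𝓝 (H * (0 * fracMass N α) / β)) :=
      (((tendsto_rpow_neg_atTop hα1).mul_const _).const_mul H).div_const β
    rw [zero_mul, mul_zero, zero_div] at hlim
    obtain ⟨L, h1, h2⟩ := ((eventually_gt_atTop (0 : ℝ)).and
      (hlim.eventually_le_const (show 0 < ε / 4 by positivity))).exists
    exact ⟨L, h1, h2⟩
  set R' := RD + L with hR'
  obtain ⟨A, hA, t₀, ht₀, hbar⟩ := h.exists_small_barrier (M := M₁ * M₂) (by positivity)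
    (show 0 < ε / 8 by positivity)
  obtain ⟨t₁, ht₁, hosc⟩ := h.oscillation_compl (max R R') (show 0 < ε / 4 by positivity)
  obtain ⟨t₂, ht₂, htr⟩ := exists_translation_integral_le h.integrable_weight
    (show 0 < ε / (8 * A * (M₂ + 1)) by positivity)
  have key : ∀ δ, 0 < δ → δ < min (min t₀ t₁) (min t₂ 1) → ∀ u, IsApproxSol N α D ρ ψ f δ u →
      ∀ τ : EuclideanSpace ℝ (Fin N), ‖τ‖ < min (min t₀ t₁) (min t₂ 1) → ∀ x ∈ D,
        u (x + τ) - u x ≤ ε := by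
    intro δ hδ hδt u hu τ hτ x₀ hx₀
    simp only [lt_min_iff] at hδt hτ
    obtain ⟨⟨hδ0, hδ1⟩, -, hδ3⟩ := hδt
    obtain ⟨⟨-, hτ1⟩, hτ2, -⟩ := hτ
    have hK := h.exit δ hδ hδ3.le
    have hub := fun y => abs_le.1 (h.abs_approxSol_le hδ hδ3.le hu y)
    have hdiff : ∀ x, |ρ (x + τ) - ρ x| ≤ M₁ := fun x => abs_le.2
      ⟨by linarith [h.weight_nonneg (x + τ), h.weight_le x],
        by linarith [h.weight_le (x + τ), h.weight_nonneg x]⟩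
    obtain ⟨v, hv, hvD, hv0, hvJ, hvle⟩ := hbar δ hδ hδ0 (fun x => |ρ (x + τ) - ρ x| * M₂)
      (((h.meas_weight.comp (measurable_add_const τ)).sub h.meas_weight).abs.mul_const _)
      (fun x => by positivity) (fun x => mul_le_mul_of_nonneg_right (hdiff x) hM2)
    have hvsmall : ∀ x, v x ≤ ε / 4 := by
      intro x
      refine (hvle x).trans ?_
      have h1 : ∫ x in D, |ρ (x + τ) - ρ x| * M₂ ≤ ε / (8 * A * (M₂ + 1)) * M₂ := by
        rw [integral_mul_const]
        refine mul_le_mul_of_nonneg_right ((setIntegral_le_integral ?_ ?_).trans (htr τ hτ2)) hM2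
        · exact ((h.integrable_weight.comp_add_right τ).sub h.integrable_weight).abs
        · exact Eventually.of_forall fun x => abs_nonneg _
      have h2 : A * (ε / (8 * A * (M₂ + 1)) * M₂) ≤ ε / 8 := by
        have : A * (ε / (8 * A * (M₂ + 1)) * M₂) = ε / 8 * (M₂ / (M₂ + 1)) := by field_simp
        rw [this]
        exact mul_le_of_le_one_right (by positivity) ((div_le_one (by positivity)).2 (by linarith))
      have h3 := mul_le_mul_of_nonneg_left h1 hA.le
      linarith
    set hf := fun x => u (x + τ) - (u x + ε / 4) with hhf
    have hhB : BddMeas hf := (hu.1.comp_add τ).sub (hu.1.add (bddMeas_const _))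
    set B := Metric.closedBall (0 : EuclideanSpace ℝ (Fin N)) R' with hB
    have hBm : MeasurableSet B := measurableSet_closedBall
    have hDB : ∀ x ∈ D, x ∈ B := fun x hx => by
      rw [hB, mem_closedBall_zero_iff]; linarith [hRD x hx]
    have hosc' : ∀ x ∈ B, (x ∉ D ∨ x + τ ∉ D) → hf x ≤ 0 := fun x hx hxD => by
      have := (abs_le.1 (hosc δ hδ hδ1 u hu x τ
        ((mem_closedBall_zero_iff.1 hx).trans (le_max_right _ _)) hτ1 hxD)).2
      simp only [hhf]; linarith
    set e := H * (L ^ (-α) * fracMass N α) with he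
    have he0 : 0 ≤ e := by positivity
    have hw : BddMeas fun x => B.indicator hf x - v x := (hhB.indicator hBm).sub hv
    have hcomp := hK.comparison he0 hw
      (fun x hx => by
        rw [hvD x hx, sub_zero]
        by_cases hxB : x ∈ B
        · rw [Set.indicator_of_mem hxB]; exact hosc' x hxB (Or.inl hx)
        · rw [Set.indicator_of_notMem hxB])
      (fun x hx hpos => by
        have hxB := hDB x hx
        rw [Set.indicator_of_mem hxB] at hpos
        have hxτ : x + τ ∈ D := by
          by_contra hxτ
          linarith [hosc' x hxB (Or.inr hxτ), hv0 x]
        rw [jumpOp_sub (hhB.indicator hBm) hv hK.integrable, hvJ x hx]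
        have h1 : jumpOp (fracKernel N α δ) hf x =
            -(ρ (x + τ) * ψ (u (x + τ))) + ρ x * ψ (u x) := by
          have : jumpOp (fracKernel N α δ) hf x = jumpOp (fracKernel N α δ)
              (fun y => u (y + τ)) x - jumpOp (fracKernel N α δ) (fun y => u y - (-(ε / 4))) x := by
            rw [← jumpOp_sub (hu.1.comp_add τ) (hu.1.sub (bddMeas_const _)) hK.integrable]
            simp only [hhf, sub_neg_eq_add]
          rw [this, jumpOp_comp_add, jumpOp_sub_const, hu.2.2 x hx, hu.2.2 _ hxτ]
          ring
        have h2 : -(|ρ (x + τ) - ρ x| * M₂) ≤ jumpOp (fracKernel N α δ) hf x := by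
          rw [h1]
          have hle : u x ≤ u (x + τ) := by
            have := hv0 x
            simp only [hhf] at hpos
            linarith
          have h3 := mul_le_mul_of_nonneg_left (h.anti_nonlin hle) (h.weight_nonneg (x + τ))
          have h4 : (ρ (x + τ) - ρ x) * ψ (u x) ≤ |ρ (x + τ) - ρ x| * M₂ :=
            (mul_le_mul_of_nonneg_right (le_abs_self _) (h.nonlin_nonneg _)).trans
              (mul_le_mul_of_nonneg_left (h.nonlin_le _) (abs_nonneg _))
          linarith
        have h3 : jumpOp (fracKernel N α δ) hf x - e ≤
            jumpOp (fracKernel N α δ) (B.indicator hf) x := by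
          obtain ⟨i1, i2⟩ := integral_min_div_mul_fracKernel_le (N := N) h.dim_pos hα1 hα2 δ hL0
          have i3 : jumpOp (fracKernel N α δ) hf x - jumpOp (fracKernel N α δ) (B.indicator hf) x ≤
              ∫ z, H * (min (‖z‖ ^ 2 / L ^ 2) 1 * fracKernel N α δ z) := by
            unfold jumpOp
            rw [← integral_sub (hhB.integrable_jump hK.integrable x)
              ((hhB.indicator hBm).integrable_jump hK.integrable x)]
            refine integral_mono ((hhB.integrable_jump hK.integrable x).sub
              ((hhB.indicator hBm).integrable_jump hK.integrable x)) (i1.const_mul H) fun z => ?_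
            have hKz := hK.nonneg z
            simp only [Set.indicator_of_mem hxB]
            by_cases hz : x + z ∈ B
            · rw [Set.indicator_of_mem hz, sub_self]
              positivity
            · rw [Set.indicator_of_notMem hz]
              have h5 : R' < ‖x + z‖ := by simpa [hB] using hz
              have h6 : L ≤ ‖z‖ := by linarith [norm_add_le x z, hRD x hx]
              have h7 : min (‖z‖ ^ 2 / L ^ 2) 1 = 1 := by
                refine min_eq_right ?_
                rw [one_le_div (by positivity)]
                gcongr
              rw [h7]
              have h8 : hf (x + z) ≤ H := by
                simp only [hhf]
                linarith [(hub (x + z + τ)).2, (hub (x + z)).1]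
              have h9 := mul_le_mul_of_nonneg_left h8 hKz
              linarith
          rw [integral_const_mul] at i3
          have := mul_le_mul_of_nonneg_left i2 hH0.le
          linarith
        linarith) x₀
    rw [Set.indicator_of_mem (hDB x₀ hx₀)] at hcomp
    simp only [hhf] at hcomp
    linarith [hvsmall x₀]
  refine ⟨min (min t₀ t₁) (min t₂ 1), by positivity, fun δ hδ hδt u hu x τ hx hτ => ?_⟩
  by_cases hD : x ∈ D ∧ x + τ ∈ D
  · have k1 := key δ hδ hδt u hu τ hτ x hD.1
    have k2 := key δ hδ hδt u hu (-τ) (by rwa [norm_neg]) (x + τ) hD.2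
    rw [add_neg_cancel_right] at k2
    exact abs_le.2 ⟨by linarith, k1⟩
  · have h1 : δ < t₁ := hδt.trans_le ((min_le_left _ _).trans (min_le_right _ _))
    have h2 : ‖τ‖ < t₁ := hτ.trans_le ((min_le_left _ _).trans (min_le_right _ _))
    exact (hosc δ hδ h1 u hu x τ (hx.trans (le_max_left _ _)) h2 (not_and_or.1 hD)).trans
      (by linarith)

end DirichletData

end Equicontinuity

/-- The symmetric second difference of `θ` at `x` with step `z`. -/
def secDiff {N : ℕ} (θ : EuclideanSpace ℝ (Fin N) → ℝ) (x z : EuclideanSpace ℝ (Fin N)) : ℝ :=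
  θ (x + z) + θ (x - z) - 2 * θ x

section WeakForm

variable {N : ℕ} {α : ℝ} {θ : EuclideanSpace ℝ (Fin N) → ℝ}

theorem fracLap_eq_half_integral (θ : EuclideanSpace ℝ (Fin N) → ℝ)
    (x : EuclideanSpace ℝ (Fin N)) :
    fracLap N α θ x = (1 / 2) * ∫ z, fracKernel N α 0 z * secDiff θ x z := by
  have : ∀ z : EuclideanSpace ℝ (Fin N), fracKernel N α 0 z * secDiff θ x z =
      fracLapCoeff N α * ((θ (x + z) + θ (x - z) - 2 * θ x) / ‖z‖ ^ ((N : ℝ) + α)) := fun z => by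
    rw [fracKernel, max_eq_left (norm_nonneg z), Real.rpow_neg (norm_nonneg z), secDiff]
    ring
  simp only [this, integral_const_mul, fracLap]
  ring

theorem continuous_secDiff (hθ : Continuous θ) :
    Continuous (fun p : EuclideanSpace ℝ (Fin N) × EuclideanSpace ℝ (Fin N) =>
      secDiff θ p.2 p.1) := by
  unfold secDiff
  fun_prop

theorem exists_abs_secDiff_le (hθ : ContDiff ℝ 2 θ) (hθc : HasCompactSupport θ) :
    ∃ C, 0 ≤ C ∧ ∀ x z, |secDiff θ x z| ≤ C * ‖z‖ ^ 2 := by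
  obtain ⟨L, hL⟩ := ContDiff.lipschitzWith_of_hasCompactSupport (n := 1)
    (hθc.fderiv (𝕜 := ℝ)) (hθ.fderiv_right (m := 1) (by norm_num)) one_ne_zero
  refine ⟨2 * L, by positivity, fun x z => ?_⟩
  have key : ∀ w : EuclideanSpace ℝ (Fin N), ‖w‖ = ‖z‖ →
      ‖θ (x + w) - θ x - fderiv ℝ θ x w‖ ≤ L * ‖z‖ * ‖z‖ := fun w hw => by
    have := Convex.norm_image_sub_le_of_norm_fderiv_le' (𝕜 := ℝ) (f := θ) (φ := fderiv ℝ θ x)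
      (C := L * ‖z‖) (s := Metric.closedBall x ‖z‖) (x := x) (y := x + w)
      (fun y _ => (hθ.differentiable (by norm_num)).differentiableAt)
      (fun y hy => (hL.norm_sub_le y x).trans
        (mul_le_mul_of_nonneg_left (by simpa [dist_eq_norm] using hy) L.2))
      (convex_closedBall _ _) (by simp) (by simp [hw])
    simpa [hw] using this
  have h1 := key z rfl
  have h2 := key (-z) (norm_neg z)
  rw [Real.norm_eq_abs, abs_le] at h1 h2
  rw [map_neg, ← sub_eq_add_neg] at h2
  rw [secDiff, abs_le]
  constructor <;> nlinarith [h1.1, h1.2, h2.1, h2.2]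

theorem exists_integral_secDiff_le (hθ : ContDiff ℝ 2 θ) (hθc : HasCompactSupport θ) :
    ∃ C, 0 ≤ C ∧ ∀ z, Integrable (fun x => secDiff θ x z) ∧
      ∫ x, |secDiff θ x z| ≤ C * min (‖z‖ ^ 2) 1 := by
  obtain ⟨C, hC0, hC⟩ := exists_abs_secDiff_le hθ hθc
  have hθi : Integrable θ := hθ.continuous.integrable_of_hasCompactSupport hθc
  obtain ⟨R, hR⟩ := hθc.isCompact.isBounded.subset_closedBall (0 : EuclideanSpace ℝ (Fin N))
  have hoff : ∀ x : EuclideanSpace ℝ (Fin N), R < ‖x‖ → θ x = 0 := fun x hx =>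
    image_eq_zero_of_notMem_tsupport fun h => by
      have := hR h
      rw [mem_closedBall_zero_iff] at this
      exact absurd this (not_le.2 hx)
  set B := Metric.closedBall (0 : EuclideanSpace ℝ (Fin N)) (R + 1) with hB
  have hint : ∀ z, Integrable (fun x => secDiff θ x z) := fun z =>
    ((hθi.comp_add_right z).add (hθi.comp_sub_right z)).sub (hθi.const_mul 2)
  refine ⟨max (C * volume.real B) (4 * ∫ x, |θ x|), by positivity, fun z => ⟨hint z, ?_⟩⟩
  rcases le_total ‖z‖ 1 with hz | hz
  · have hz2 : ‖z‖ ^ 2 ≤ 1 := pow_le_one₀ (norm_nonneg z) hz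
    rw [min_eq_left hz2]
    have hle : ∀ x, |secDiff θ x z| ≤ B.indicator (fun _ => C * ‖z‖ ^ 2) x := fun x => by
      by_cases hx : x ∈ B
      · rw [Set.indicator_of_mem hx]
        exact hC x z
      · rw [Set.indicator_of_notMem hx]
        rw [hB, mem_closedBall_zero_iff, not_le] at hx
        have h1 : ‖x‖ ≤ ‖x + z‖ + ‖z‖ := by simpa using norm_sub_le (x + z) z
        have h2 : ‖x‖ ≤ ‖x - z‖ + ‖z‖ := by simpa using norm_add_le (x - z) z
        rw [secDiff, hoff _ (by linarith), hoff _ (by linarith), hoff _ (by linarith)]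
        simp
    have hBi : Integrable (B.indicator fun _ : EuclideanSpace ℝ (Fin N) => C * ‖z‖ ^ 2) :=
      (integrable_indicator_iff measurableSet_closedBall).2
        (integrableOn_const (isCompact_closedBall _ _).measure_lt_top.ne)
    calc ∫ x, |secDiff θ x z| ≤ ∫ x, B.indicator (fun _ => C * ‖z‖ ^ 2) x :=
          integral_mono (hint z).abs hBi hle
      _ = C * volume.real B * ‖z‖ ^ 2 := by
          rw [integral_indicator measurableSet_closedBall, setIntegral_const, smul_eq_mul]
          ring
      _ ≤ _ := by gcongr; exact le_max_left _ _
  · have hz2 : 1 ≤ ‖z‖ ^ 2 := one_le_pow₀ hz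
    rw [min_eq_right hz2, mul_one]
    have hp := hθi.abs.comp_add_right z
    have hm := hθi.abs.comp_sub_right z
    calc ∫ x, |secDiff θ x z| ≤ ∫ x, (|θ (x + z)| + |θ (x - z)| + 2 * |θ x|) := by
          refine integral_mono (hint z).abs ((hp.add hm).add (hθi.abs.const_mul 2)) fun x => ?_
          simp only [secDiff]
          refine (abs_sub _ _).trans ?_
          rw [abs_mul, abs_two]
          gcongr
          exact abs_add_le _ _
      _ = 4 * ∫ x, |θ x| := by
          have hpm : Integrable (fun x => |θ (x + z)| + |θ (x - z)|) := hp.add hm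
          rw [integral_add hpm (hθi.abs.const_mul 2), integral_add hp hm,
            integral_add_right_eq_self (fun x => |θ x|) z,
            integral_sub_right_eq_self (fun x => |θ x|) z, integral_const_mul]
          ring
      _ ≤ _ := le_max_right _ _

theorem exists_abs_integral_mul_secDiff_le (hθ : ContDiff ℝ 2 θ) (hθc : HasCompactSupport θ)
    (U : ℝ) :
    ∃ C, 0 ≤ C ∧ ∀ u : EuclideanSpace ℝ (Fin N) → ℝ, Measurable u → (∀ x, |u x| ≤ U) → ∀ z,
      Integrable (fun x => u x * secDiff θ x z) ∧
      ∫ x, |u x * secDiff θ x z| ≤ C * min (‖z‖ ^ 2) 1 := by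
  obtain ⟨C, hC0, hC⟩ := exists_integral_secDiff_le hθ hθc
  refine ⟨|U| * C, by positivity, fun u hu huU z => ?_⟩
  have hi : Integrable (fun x => u x * secDiff θ x z) :=
    (hC z).1.bdd_mul (c := U) hu.aestronglyMeasurable (ae_of_all _ huU)
  refine ⟨hi, ?_⟩
  calc ∫ x, |u x * secDiff θ x z| ≤ ∫ x, |U| * |secDiff θ x z| := by
        refine integral_mono hi.abs ((hC z).1.abs.const_mul _) fun x => ?_
        rw [abs_mul]
        exact mul_le_mul_of_nonneg_right ((huU x).trans (le_abs_self U)) (abs_nonneg _)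
    _ ≤ |U| * C * min (‖z‖ ^ 2) 1 := by
        rw [integral_const_mul, mul_assoc]
        exact mul_le_mul_of_nonneg_left (hC z).2 (abs_nonneg _)

theorem integrable_prod_mul_secDiff (hN : 0 < N) (hα1 : 0 < α) (hα2 : α < 2)
    (hθ : ContDiff ℝ 2 θ) (hθc : HasCompactSupport θ) (δ : ℝ)
    {u : EuclideanSpace ℝ (Fin N) → ℝ} (hu : BddMeas u) :
    Integrable (fun p : EuclideanSpace ℝ (Fin N) × EuclideanSpace ℝ (Fin N) =>
      fracKernel N α δ p.1 * (u p.2 * secDiff θ p.2 p.1)) (volume.prod volume) := by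
  obtain ⟨hum, U, hU⟩ := hu
  obtain ⟨C, hC0, hC⟩ := exists_abs_integral_mul_secDiff_le hθ hθc U
  have hm : Measurable (fun p : EuclideanSpace ℝ (Fin N) × EuclideanSpace ℝ (Fin N) =>
      fracKernel N α δ p.1 * (u p.2 * secDiff θ p.2 p.1)) :=
    ((measurable_fracKernel δ).comp measurable_fst).mul
      ((hum.comp measurable_snd).mul (continuous_secDiff hθ.continuous).measurable)
  rw [integrable_prod_iff hm.aestronglyMeasurable]
  refine ⟨ae_of_all _ fun z => (hC u hum hU z).1.const_mul (fracKernel N α δ z), ?_⟩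
  refine ((integrable_min_mul_fracKernel hN hα1 hα2 δ).const_mul C).mono'
    hm.norm.aestronglyMeasurable.integral_prod_right' (ae_of_all _ fun z => ?_)
  have hK := fracKernel_nonneg hα1 hα2 δ z
  simp only [norm_mul, Real.norm_eq_abs, abs_of_nonneg hK, integral_const_mul]
  rw [abs_of_nonneg (integral_nonneg fun x => by positivity)]
  simp only [← abs_mul]
  calc _ ≤ fracKernel N α δ z * (C * min (‖z‖ ^ 2) 1) :=
        mul_le_mul_of_nonneg_left (hC u hum hU z).2 hK
    _ = _ := by ring

theorem integrable_fracKernel_mul_integral_secDiff (hN : 0 < N) (hα1 : 0 < α) (hα2 : α < 2)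
    (hθ : ContDiff ℝ 2 θ) (hθc : HasCompactSupport θ) (δ : ℝ)
    {u : EuclideanSpace ℝ (Fin N) → ℝ} (hu : BddMeas u) :
    Integrable (fun z => fracKernel N α δ z * ∫ x, u x * secDiff θ x z) := by
  simpa only [integral_const_mul] using
    (integrable_prod_mul_secDiff hN hα1 hα2 hθ hθc δ hu).integral_prod_left

theorem integral_mul_half_secDiff (hN : 0 < N) (hα1 : 0 < α) (hα2 : α < 2)
    (hθ : ContDiff ℝ 2 θ) (hθc : HasCompactSupport θ) (δ : ℝ)
    {u : EuclideanSpace ℝ (Fin N) → ℝ} (hu : BddMeas u) :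
    ∫ x, u x * ((1 / 2) * ∫ z, fracKernel N α δ z * secDiff θ x z) =
      (1 / 2) * ∫ z, fracKernel N α δ z * ∫ x, u x * secDiff θ x z := by
  have := integral_integral_swap
    (f := fun z x => fracKernel N α δ z * (u x * secDiff θ x z))
    (integrable_prod_mul_secDiff hN hα1 hα2 hθ hθc δ hu)
  simp only [integral_const_mul] at this
  rw [this, ← integral_const_mul]
  refine integral_congr_ae (ae_of_all _ fun x => ?_)
  simp only [mul_left_comm _ (u x), integral_const_mul]

theorem integral_mul_fracLap (hN : 0 < N) (hα1 : 0 < α) (hα2 : α < 2)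
    (hθ : ContDiff ℝ 2 θ) (hθc : HasCompactSupport θ)
    {u : EuclideanSpace ℝ (Fin N) → ℝ} (hu : BddMeas u) :
    ∫ x, u x * fracLap N α θ x =
      (1 / 2) * ∫ z, fracKernel N α 0 z * ∫ x, u x * secDiff θ x z := by
  simp only [fracLap_eq_half_integral]
  exact integral_mul_half_secDiff hN hα1 hα2 hθ hθc 0 hu

theorem integrable_mul_fracLap (hN : 0 < N) (hα1 : 0 < α) (hα2 : α < 2)
    (hθ : ContDiff ℝ 2 θ) (hθc : HasCompactSupport θ)
    {u : EuclideanSpace ℝ (Fin N) → ℝ} (hu : BddMeas u) :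
    Integrable (fun x => u x * fracLap N α θ x) := by
  refine ((integrable_prod_mul_secDiff hN hα1 hα2 hθ hθc 0 hu).integral_prod_right.const_mul
    (1 / 2)).congr (ae_of_all _ fun x => ?_)
  simp only [fracLap_eq_half_integral, mul_left_comm _ (u x), integral_const_mul]

theorem integral_fracLap (hN : 0 < N) (hα1 : 0 < α) (hα2 : α < 2)
    (hθ : ContDiff ℝ 2 θ) (hθc : HasCompactSupport θ) :
    ∫ x, fracLap N α θ x = 0 := by
  have hθi : Integrable θ := hθ.continuous.integrable_of_hasCompactSupport hθc
  have h := integral_mul_fracLap hN hα1 hα2 hθ hθc (bddMeas_const 1)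
  simp only [one_mul] at h
  have h0 : ∀ z, ∫ x, secDiff θ x z = 0 := fun z => by
    have hp := hθi.comp_add_right z
    have hm := hθi.comp_sub_right z
    have hpm : Integrable (fun x => θ (x + z) + θ (x - z)) := hp.add hm
    simp only [secDiff]
    rw [integral_sub hpm (hθi.const_mul 2), integral_add hp hm,
      integral_add_right_eq_self θ z, integral_sub_right_eq_self θ z, integral_const_mul]
    ring
  simpa [h0] using h

/-- Weak continuity of the truncated fractional Laplacians along bounded pointwise limits. -/
theorem tendsto_integral_mul_secDiff (hN : 0 < N) (hα1 : 0 < α) (hα2 : α < 2)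
    (hθ : ContDiff ℝ 2 θ) (hθc : HasCompactSupport θ) {δ : ℕ → ℝ}
    (hδ : Tendsto δ atTop (𝓝 0)) {u : ℕ → EuclideanSpace ℝ (Fin N) → ℝ}
    {v : EuclideanSpace ℝ (Fin N) → ℝ} {U : ℝ} (hu : ∀ n, Measurable (u n))
    (hU : ∀ n x, |u n x| ≤ U) (huv : ∀ x, Tendsto (fun n => u n x) atTop (𝓝 (v x))) :
    Tendsto (fun n => ∫ x, u n x * ((1 / 2) * ∫ z, fracKernel N α (δ n) z * secDiff θ x z))
      atTop (𝓝 (∫ x, v x * fracLap N α θ x)) := by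
  have hv : BddMeas v := ⟨measurable_of_tendsto_metrizable hu (tendsto_pi_nhds.2 huv), U,
    fun x => le_of_tendsto (huv x).abs (Eventually.of_forall fun n => hU n x)⟩
  rw [integral_mul_fracLap hN hα1 hα2 hθ hθc hv]
  simp only [fun n => integral_mul_half_secDiff hN hα1 hα2 hθ hθc (δ n) ⟨hu n, U, hU n⟩]
  refine Tendsto.const_mul _ ?_
  obtain ⟨C, hC0, hC⟩ := exists_abs_integral_mul_secDiff_le hθ hθc U
  refine tendsto_integral_of_dominated_convergence
    (fun z => C * (min (‖z‖ ^ 2) 1 * fracKernel N α 0 z)) (fun n => ?_)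
    ((integrable_min_mul_fracKernel_zero hN hα1 hα2).const_mul C) (fun n => ?_) ?_
  · refine (measurable_fracKernel (δ n)).aestronglyMeasurable.mul ?_
    exact (((hu n).comp measurable_snd).mul
      (continuous_secDiff hθ.continuous).measurable).aestronglyMeasurable.integral_prod_right'
  · refine ae_of_all _ fun z => ?_
    have hK := fracKernel_nonneg hα1 hα2 (δ n) z
    rw [norm_mul, Real.norm_eq_abs, Real.norm_eq_abs, abs_of_nonneg hK]
    calc _ ≤ fracKernel N α (δ n) z * (C * min (‖z‖ ^ 2) 1) :=
          mul_le_mul_of_nonneg_left ((abs_integral_le_integral_abs).trans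
            (hC (u n) (hu n) (hU n) z).2) hK
      _ = C * (min (‖z‖ ^ 2) 1 * fracKernel N α (δ n) z) := by ring
      _ ≤ _ := mul_le_mul_of_nonneg_left (min_mul_fracKernel_le hα1 hα2 (δ n) z) hC0
  · have : NeZero N := ⟨hN.ne'⟩
    have hne : ∀ᵐ z : EuclideanSpace ℝ (Fin N), z ≠ 0 := by
      simp [ae_iff]
    filter_upwards [hne] with z hz
    refine (tendsto_fracKernel hδ hz).mul ?_
    obtain ⟨C', hC0', hC'⟩ := exists_integral_secDiff_le hθ hθc
    refine tendsto_integral_of_dominated_convergence (fun x => U * |secDiff θ x z|)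
      (fun n => (hC (u n) (hu n) (hU n) z).1.aestronglyMeasurable)
      ((hC' z).1.abs.const_mul U) (fun n => ae_of_all _ fun x => ?_)
      (ae_of_all _ fun x => (huv x).mul_const _)
    rw [norm_mul, Real.norm_eq_abs, Real.norm_eq_abs]
    exact mul_le_mul_of_nonneg_right (hU n x) (abs_nonneg _)

end WeakForm

section Compactness

/-- A bounded, asymptotically equicontinuous sequence of real functions on a separable space has
a subsequence that converges pointwise to a continuous function. -/
theorem exists_subseq_tendsto_continuous {E : Type*} [PseudoMetricSpace E]
    [TopologicalSpace.SeparableSpace E] [Nonempty E] {u : ℕ → E → ℝ} {U : ℝ}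
    (hU : ∀ n x, |u n x| ≤ U)
    (hequi : ∀ x, ∀ ε > 0, ∃ t > 0, ∀ᶠ n in atTop, ∀ y, dist y x < t → |u n y - u n x| ≤ ε) :
    ∃ (k : ℕ → ℕ) (v : E → ℝ), StrictMono k ∧ Continuous v ∧
      ∀ x, Tendsto (fun n => u (k n) x) atTop (𝓝 (v x)) := by
  obtain ⟨a, -, k, hk, ha⟩ := (isCompact_univ_pi fun _ : ℕ =>
      isCompact_Icc (a := -U) (b := U)).tendsto_subseq
    (x := fun n i => u n (TopologicalSpace.denseSeq E i)) fun n i _ => abs_le.1 (hU n _)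
  have hlim : ∀ x, ∃ b, Tendsto (fun n => u (k n) x) atTop (𝓝 b) := fun x => by
    refine cauchySeq_tendsto_of_complete (Metric.cauchySeq_iff'.2 fun ε hε => ?_)
    obtain ⟨t, ht, hn⟩ := hequi x (ε / 8) (by positivity)
    obtain ⟨i, hi⟩ := (TopologicalSpace.denseRange_denseSeq E).exists_dist_lt x ht
    rw [dist_comm] at hi
    have h1 := (tendsto_pi_nhds.1 ha i).cauchySeq
    obtain ⟨n₁, hn₁⟩ := Metric.cauchySeq_iff.1 h1 (ε / 2) (by positivity)
    obtain ⟨n₂, hn₂⟩ := eventually_atTop.1 (hk.tendsto_atTop.eventually hn)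
    refine ⟨max n₁ n₂, fun n hn => ?_⟩
    have e1 := hn₂ n ((le_max_right _ _).trans hn) _ hi
    have e2 := hn₂ (max n₁ n₂) (le_max_right _ _) _ hi
    have e3 := hn₁ n ((le_max_left _ _).trans hn) (max n₁ n₂) (le_max_left _ _)
    simp only [Real.dist_eq, Function.comp_apply] at e3 ⊢
    rw [abs_le] at e1 e2
    rw [abs_lt] at e3 ⊢
    constructor <;> linarith [e1.1, e1.2, e2.1, e2.2, e3.1, e3.2]
  choose v hv using hlim
  refine ⟨k, v, hk, continuous_iff_continuousAt.2 fun x => ?_, hv⟩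
  refine Metric.continuousAt_iff.2 fun ε hε => ?_
  obtain ⟨t, ht, hn⟩ := hequi x (ε / 2) (by positivity)
  refine ⟨t, ht, fun {y} hy => ?_⟩
  rw [Real.dist_eq]
  refine (le_of_tendsto ((hv y).sub (hv x)).abs
    ((hk.tendsto_atTop.eventually hn).mono fun n h => h y hy)).trans_lt (by linarith)

end Compactness

section WeakSolutions

variable {N : ℕ} {α : ℝ} {D : Set (EuclideanSpace ℝ (Fin N))}

namespace DirichletData

variable {β M₁ M₂ F : ℝ} {ρ f : EuclideanSpace ℝ (Fin N) → ℝ} {ψ : ℝ → ℝ}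
  (h : DirichletData N α D β ρ M₁ ψ M₂ f F)

include h

theorem integral_mul_jumpOp_approxSol {δ : ℝ} (hδ : 0 < δ) {u : EuclideanSpace ℝ (Fin N) → ℝ}
    (hu : IsApproxSol N α D ρ ψ f δ u) {θ : EuclideanSpace ℝ (Fin N) → ℝ} (hθ : BddMeas θ)
    (hθi : Integrable θ) (hθD : ∀ x ∉ D, θ x = 0) :
    ∫ x, u x * ((1 / 2) * ∫ z, fracKernel N α δ z * secDiff θ x z) =
      -∫ x, ρ x * ψ (u x) * θ x := by
  have hJ := integrable_fracKernel (N := N) h.index_pos h.index_lt hδ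
  have h1 : ∀ x, (1 / 2) * ∫ z, fracKernel N α δ z * secDiff θ x z =
      jumpOp (fracKernel N α δ) θ x := fun x => (jumpOp_eq_half hJ (fracKernel_neg δ) hθ x).symm
  simp only [h1]
  rw [← integral_mul_jumpOp_comm (measurable_fracKernel δ) hJ (fracKernel_neg δ) hθ hθi hu.1,
    ← integral_neg]
  refine integral_congr_ae (ae_of_all _ fun x => ?_)
  by_cases hx : x ∈ D
  · simp only [hu.2.2 x hx]
    ring
  · simp [hθD x hx]

/-- Existence of weak solutions when the nonlinearity is bounded and continuous. -/
theorem exists_weakSol :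
    ∃ u : EuclideanSpace ℝ (Fin N) → ℝ, Continuous u ∧ (∃ U, ∀ x, |u x| ≤ U) ∧
      (∀ x ∉ D, u x = f x) ∧ (∀ a, (∀ x ∉ D, a ≤ f x) → ∀ x, a ≤ u x) ∧
      ∀ θ : EuclideanSpace ℝ (Fin N) → ℝ, ContDiff ℝ 2 θ → HasCompactSupport θ →
        tsupport θ ⊆ D → ∫ x, u x * fracLap N α θ x = -∫ x, ρ x * ψ (u x) * θ x := by
  have hδ : ∀ n : ℕ, (0 : ℝ) < 1 / (n + 1) := fun n => by positivity
  have hδ1 : ∀ n : ℕ, (1 : ℝ) / (n + 1) ≤ 1 := fun n => by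
    rw [div_le_one (by positivity)]
    simp
  have hδ0 : Tendsto (fun n : ℕ => (1 : ℝ) / (n + 1)) atTop (𝓝 0) :=
    tendsto_one_div_add_atTop_nhds_zero_nat
  choose u hu using fun n => h.exists_approxSol (hδ n) (hδ1 n)
  have hU := fun n => h.abs_approxSol_le (hδ n) (hδ1 n) (hu n)
  obtain ⟨k, v, hk, hvc, hv⟩ := exists_subseq_tendsto_continuous hU fun x ε hε => by
    obtain ⟨t, ht, ht'⟩ := h.equicontinuity ‖x‖ hε
    refine ⟨t, ht, (hδ0.eventually_lt_const ht).mono fun n hn y hy => ?_⟩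
    have := ht' _ (hδ n) hn (u n) (hu n) x (y - x) le_rfl (by rwa [← dist_eq_norm])
    rwa [add_sub_cancel] at this
  refine ⟨v, hvc, ⟨_, fun x => le_of_tendsto (hv x).abs (Eventually.of_forall fun n => hU _ x)⟩,
    fun x hx => ?_, fun a ha x => ?_, fun θ hθ hθc hθD => ?_⟩
  · refine tendsto_nhds_unique (hv x) ?_
    simp only [(hu _).2.1 x hx, tendsto_const_nhds]
  · exact ge_of_tendsto (hv x)
      (Eventually.of_forall fun n => h.le_approxSol (hδ _) (hδ1 _) (hu _) ha x)
  · have hθi : Integrable θ := hθ.continuous.integrable_of_hasCompactSupport hθc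
    have hθb : BddMeas θ := ⟨hθ.continuous.measurable,
      (hθ.continuous.bounded_above_of_compact_support hθc)⟩
    have h1 := tendsto_integral_mul_secDiff h.dim_pos h.index_pos h.index_lt hθ hθc
      (hδ0.comp hk.tendsto_atTop) (fun n => (hu (k n)).1.1) (fun n => hU (k n)) hv
    refine tendsto_nhds_unique h1 ?_
    have h2 : ∀ n, _ := fun n => h.integral_mul_jumpOp_approxSol (hδ (k n)) (hu (k n)) hθb hθi
      fun x hx => image_eq_zero_of_notMem_tsupport fun hx' => hx (hθD hx')
    simp only [Function.comp_apply, h2]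
    refine Tendsto.neg (tendsto_integral_of_dominated_convergence (fun x => M₁ * M₂ * |θ x|)
      (fun n => ?_) (hθi.abs.const_mul _) (fun n => ae_of_all _ fun x => ?_)
      (ae_of_all _ fun x => ?_))
    · exact ((h.meas_weight.mul (h.cont_nonlin.measurable.comp (hu (k n)).1.1)).mul
        hθ.continuous.measurable).aestronglyMeasurable
    · rw [norm_mul, Real.norm_eq_abs, Real.norm_eq_abs,
        abs_of_nonneg (h.weight_mul_nonlin_nonneg x _)]
      exact mul_le_mul_of_nonneg_right (h.weight_mul_nonlin_le x _) (abs_nonneg _)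
    · exact (((h.cont_nonlin.tendsto _).comp (hv x)).const_mul _).mul_const _

end DirichletData

end WeakSolutions

section Comparison

variable {N : ℕ} {α : ℝ} {D : Set (EuclideanSpace ℝ (Fin N))}

/-- Weak maximum principle: a continuous function that is nonpositive off a bounded set and weakly
subharmonic for the fractional Laplacian where it is positive is nonpositive. -/
theorem nonpos_of_integral_mul_fracLap_nonneg (hN : 0 < N) (hα1 : 0 < α) (hα2 : α < 2)
    (hDb : Bornology.IsBounded D) {w : EuclideanSpace ℝ (Fin N) → ℝ} (hwc : Continuous w)
    (hwb : ∃ C, ∀ x, |w x| ≤ C) (hoff : ∀ x ∉ D, w x ≤ 0)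
    (hin : ∀ θ : EuclideanSpace ℝ (Fin N) → ℝ, ContDiff ℝ (⊤ : ℕ∞) θ → HasCompactSupport θ →
      (∀ x, 0 ≤ θ x) → tsupport θ ⊆ {x | 0 < w x} → 0 ≤ ∫ x, w x * fracLap N α θ x)
    (x₀ : EuclideanSpace ℝ (Fin N)) : w x₀ ≤ 0 := by
  by_contra! hx₀
  have hx₀D : x₀ ∈ D := by_contra fun hx => (hoff x₀ hx).not_gt hx₀
  obtain ⟨C, hC⟩ := hwb
  have hK : IsCompact (closure D) := hDb.isCompact_closure
  obtain ⟨p, hpK, hp⟩ := hK.exists_isMaxOn ⟨x₀, subset_closure hx₀D⟩ hwc.continuousOn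
  set m := w p with hm
  have hm0 : 0 < m := hx₀.trans_le (hp (subset_closure hx₀D))
  obtain ⟨d, hd, hdK⟩ := Metric.mem_uniformity_dist.1
    (hK.uniformContinuousAt_of_continuousAt w (fun a _ => hwc.continuousAt)
      (Metric.dist_mem_uniformity (show 0 < m / 4 by positivity)))
  have hunif : ∀ a ∈ closure D, ∀ b, dist a b < d → |w a - w b| < m / 4 := fun a ha b hab => by
    simpa [Real.dist_eq] using hdK hab ha
  set ε := min d 1 / 3 with hεdef
  have hε : 0 < ε := by positivity
  have hεd : 2 * ε < d := by
    have := min_le_left d 1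
    linarith
  have hε1 : ε ≤ 1 := by
    have := min_le_right d 1
    linarith
  let b : ContDiffBump (0 : EuclideanSpace ℝ (Fin N)) := ⟨ε / 2, ε, by positivity, by linarith⟩
  set η := b.normed volume with hη
  have hηs : ContDiff ℝ (⊤ : ℕ∞) η := b.contDiff_normed
  have hηc : Continuous η := hηs.continuous
  have hη0 : ∀ x, 0 ≤ η x := b.nonneg_normed
  have hηi : Integrable η := b.integrable_normed
  have hη1 : ∫ x, η x = 1 := b.integral_normed
  have hηz : ∀ x, ε ≤ ‖x‖ → η x = 0 := fun x hx => by
    have : x ∉ Function.support η := by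
      rw [hη, b.support_normed_eq]
      simpa using hx
    simpa using this
  let W : EuclideanSpace ℝ (Fin N) → ℝ := fun x => ∫ y, w y * η (y - x)
  have hWi : ∀ x, Integrable (fun y => w y * η (y - x)) := fun x =>
    (hηi.comp_sub_right x).bdd_mul (c := C) hwc.aestronglyMeasurable (ae_of_all _ hC)
  have hconst : ∀ (c : ℝ) (x : EuclideanSpace ℝ (Fin N)),
      Integrable (fun y => c * η (y - x)) ∧ ∫ y, c * η (y - x) = c := fun c x => by
    refine ⟨(hηi.comp_sub_right x).const_mul c, ?_⟩
    rw [integral_const_mul, integral_sub_right_eq_self η x, hη1, mul_one]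
  have hW_le : ∀ (c : ℝ) (x : EuclideanSpace ℝ (Fin N)), (∀ y, dist y x < ε → w y ≤ c) →
      W x ≤ c := fun c x hc => by
    rw [← (hconst c x).2]
    refine integral_mono (hWi x) (hconst c x).1 fun y => ?_
    rcases lt_or_ge (dist y x) ε with hy | hy
    · exact mul_le_mul_of_nonneg_right (hc y hy) (hη0 _)
    · simp [hηz (y - x) (by rwa [← dist_eq_norm])]
  have hW_ge : ∀ (c : ℝ) (x : EuclideanSpace ℝ (Fin N)), (∀ y, dist y x < ε → c ≤ w y) →
      c ≤ W x := fun c x hc => by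
    rw [← (hconst c x).2]
    refine integral_mono (hconst c x).1 (hWi x) fun y => ?_
    rcases lt_or_ge (dist y x) ε with hy | hy
    · exact mul_le_mul_of_nonneg_right (hc y hy) (hη0 _)
    · simp [hηz (y - x) (by rwa [← dist_eq_norm])]
  have hWc : Continuous W := by
    have : W = fun x => ∫ y, w (y + x) * η y := by
      funext x
      have := integral_add_right_eq_self (μ := volume) (fun y => w y * η (y - x)) x
      simp only [add_sub_cancel_right] at this
      exact this.symm
    rw [this]
    refine continuous_of_dominated (bound := fun y => C * η y) (fun x => ?_) (fun x => ?_)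
      (hηi.const_mul C) (ae_of_all _ fun y => by fun_prop)
    · exact (by fun_prop : Continuous fun y => w (y + x) * η y).aestronglyMeasurable
    · refine ae_of_all _ fun y => ?_
      rw [norm_mul, Real.norm_eq_abs, Real.norm_eq_abs, abs_of_nonneg (hη0 y)]
      exact mul_le_mul_of_nonneg_right (hC _) (hη0 y)
  have hWp : 3 * m / 4 ≤ W p := hW_ge _ _ fun y hy => by
    have := hunif p hpK y (by rw [dist_comm]; linarith)
    rw [abs_lt] at this
    linarith [this.2]
  obtain ⟨R, hR⟩ := hDb.subset_closedBall (0 : EuclideanSpace ℝ (Fin N))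
  have hWfar : ∀ x, R + 1 < ‖x‖ → W x ≤ 0 := fun x hx => hW_le 0 x fun y hy => by
    refine hoff y fun hyD => ?_
    have h1 := hR hyD
    rw [mem_closedBall_zero_iff] at h1
    rw [dist_comm, dist_eq_norm] at hy
    have := norm_sub_norm_le x y
    linarith
  obtain ⟨x₁, -, hx₁⟩ := (isCompact_closedBall (0 : EuclideanSpace ℝ (Fin N))
    (R + 1)).exists_isMaxOn (f := W) ⟨p, by
      by_contra h
      rw [mem_closedBall_zero_iff, not_le] at h
      linarith [hWfar p h]⟩ hWc.continuousOn
  have hpx : W p ≤ W x₁ := hx₁ (by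
      by_contra h
      rw [mem_closedBall_zero_iff, not_le] at h
      linarith [hWfar p h])
  have hmax : ∀ x, W x ≤ W x₁ := fun x => by
    by_cases h : x ∈ Metric.closedBall (0 : EuclideanSpace ℝ (Fin N)) (R + 1)
    · exact hx₁ h
    · rw [mem_closedBall_zero_iff, not_le] at h
      linarith [hWfar x h]
  have hW1 : 0 < W x₁ := by linarith
  obtain ⟨y₁, hy₁, hwy₁⟩ : ∃ y, dist y x₁ < ε ∧ m / 2 < w y := by
    by_contra! h
    linarith [hW_le (m / 2) x₁ h]
  have hy₁D : y₁ ∈ closure D := subset_closure (by_contra fun h => by linarith [hoff y₁ h])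
  set θ : EuclideanSpace ℝ (Fin N) → ℝ := fun y => η (y - x₁) with hθ
  have hθs : ContDiff ℝ (⊤ : ℕ∞) θ := hηs.comp (contDiff_id.sub contDiff_const)
  have hθt : tsupport θ ⊆ Metric.closedBall x₁ ε :=
    closure_minimal (fun y hy => by
      by_contra h
      rw [Metric.mem_closedBall, not_le, dist_eq_norm] at h
      exact hy (hηz _ h.le)) Metric.isClosed_closedBall
  have hθc : HasCompactSupport θ :=
    (isCompact_closedBall x₁ ε).of_isClosed_subset (isClosed_tsupport θ) hθt
  have hpos := hin θ hθs hθc (fun x => hη0 _) fun x hx => by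
    have h1 := hθt hx
    rw [Metric.mem_closedBall] at h1
    have h2 := hunif y₁ hy₁D x (by
      have := dist_triangle_right y₁ x x₁
      linarith)
    rw [abs_lt] at h2
    simp only [Set.mem_ofPred_eq]
    linarith [h2.2]
  have hθ2 : ContDiff ℝ 2 θ := by exact_mod_cast contDiff_infty.1 hθs 2
  have hwB : BddMeas w := ⟨hwc.measurable, C, hC⟩
  rw [integral_mul_fracLap hN hα1 hα2 hθ2 hθc hwB] at hpos
  have hSD : ∀ z, ∫ x, w x * secDiff θ x z = W (x₁ - z) + W (x₁ + z) - 2 * W x₁ := fun z => by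
    have e : ∀ x, w x * secDiff θ x z =
        w x * η (x - (x₁ - z)) + w x * η (x - (x₁ + z)) - 2 * (w x * η (x - x₁)) := fun x => by
      simp only [secDiff, hθ]
      rw [show x + z - x₁ = x - (x₁ - z) by abel, show x - z - x₁ = x - (x₁ + z) by abel]
      ring
    simp only [e]
    have hpm : Integrable fun x => w x * η (x - (x₁ - z)) + w x * η (x - (x₁ + z)) :=
      (hWi _).add (hWi _)
    rw [integral_sub hpm ((hWi _).const_mul 2), integral_add (hWi _) (hWi _),
      integral_const_mul]
  have hint := integrable_fracKernel_mul_integral_secDiff hN hα1 hα2 hθ2 hθc 0 hwB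
  simp only [hSD] at hpos hint
  have hle : ∀ z, fracKernel N α 0 z * (W (x₁ - z) + W (x₁ + z) - 2 * W x₁) ≤ 0 := fun z =>
    mul_nonpos_of_nonneg_of_nonpos (fracKernel_nonneg hα1 hα2 0 z)
      (by linarith [hmax (x₁ - z), hmax (x₁ + z)])
  have hzero := (integral_eq_zero_iff_of_nonneg (fun z => neg_nonneg.2 (hle z)) hint.neg).1 (by
    refine le_antisymm ?_ (integral_nonneg fun z => neg_nonneg.2 (hle z))
    simp only [integral_neg]
    linarith)
  set S : Set (EuclideanSpace ℝ (Fin N)) := {z | ‖x₁‖ + |R| + 1 < ‖z‖} with hS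
  have hSo : IsOpen S := isOpen_lt continuous_const continuous_norm
  have hSne : S.Nonempty := by
    refine ⟨EuclideanSpace.single ⟨0, hN⟩ (‖x₁‖ + |R| + 2), ?_⟩
    simp only [hS, Set.mem_ofPred_eq, PiLp.norm_single, Real.norm_eq_abs]
    refine lt_of_lt_of_le ?_ (le_abs_self _)
    linarith
  refine (hSo.measure_pos volume hSne).ne' (measure_mono_null (fun z hz => ?_) hzero)
  simp only [hS, Set.mem_ofPred_eq] at hz
  have hz1 : R + 1 < ‖x₁ - z‖ := by
    have h1 := norm_sub_norm_le z x₁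
    rw [norm_sub_rev] at h1
    linarith [le_abs_self R]
  have hz2 : R + 1 < ‖x₁ + z‖ := by
    have h1 := norm_sub_le (x₁ + z) x₁
    rw [add_sub_cancel_left] at h1
    linarith [le_abs_self R]
  have hz0 : 0 < ‖z‖ := by linarith [norm_nonneg x₁, abs_nonneg R]
  have hKpos : 0 < fracKernel N α 0 z :=
    mul_pos (fracLapCoeff_pos hα1 hα2) (Real.rpow_pos_of_pos (lt_max_of_lt_left hz0) _)
  have := mul_neg_of_pos_of_neg hKpos
    (by linarith [hWfar _ hz1, hWfar _ hz2] : W (x₁ - z) + W (x₁ + z) - 2 * W x₁ < 0)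
  simp only [Set.mem_compl_iff, Set.mem_ofPred_eq, Pi.zero_apply, neg_eq_zero]
  exact this.ne

end Comparison

/-- Bounded nonnegative continuous weak solutions of `Δ^{α/2}u = -ρ Φ(u)` in `D`. -/
def IsWeakSol (N : ℕ) (α : ℝ) (D : Set (EuclideanSpace ℝ (Fin N)))
    (ρ : EuclideanSpace ℝ (Fin N) → ℝ) (Φ : ℝ → ℝ≥0∞) (u : EuclideanSpace ℝ (Fin N) → ℝ) : Prop :=
  Continuous u ∧ (∃ M, ∀ x, |u x| ≤ M) ∧ (∀ x, 0 ≤ u x) ∧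
  (∀ K : Set (EuclideanSpace ℝ (Fin N)), IsCompact K → K ⊆ D →
    (∫⁻ x in K, ENNReal.ofReal (ρ x) * Φ (u x)) ≠ ⊤) ∧
  ∀ θ : EuclideanSpace ℝ (Fin N) → ℝ, ContDiff ℝ (⊤ : ℕ∞) θ → HasCompactSupport θ →
    tsupport θ ⊆ D → ∫ x, u x * fracLap N α θ x =
      -∫ x, (ENNReal.ofReal (ρ x) * Φ (u x)).toReal * θ x

section SingularProblem

variable {N : ℕ} {α : ℝ} {D : Set (EuclideanSpace ℝ (Fin N))}
  {ρ : EuclideanSpace ℝ (Fin N) → ℝ} {Φ : ℝ → ℝ≥0∞}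

theorem integrable_toReal_mul_of_tsupport_subset {g : EuclideanSpace ℝ (Fin N) → ℝ≥0∞}
    (hg : Measurable g)
    (hK : ∀ K : Set (EuclideanSpace ℝ (Fin N)), IsCompact K → K ⊆ D → (∫⁻ x in K, g x) ≠ ⊤)
    {θ : EuclideanSpace ℝ (Fin N) → ℝ} (hθ : Continuous θ) (hθc : HasCompactSupport θ)
    (hθD : tsupport θ ⊆ D) : Integrable (fun x => (g x).toReal * θ x) := by
  have h1 : IntegrableOn (fun x => (g x).toReal) (tsupport θ) :=
    integrable_toReal_of_lintegral_ne_top hg.aemeasurable (hK _ hθc hθD)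
  refine (integrableOn_iff_integrable_of_support_subset fun x hx => ?_).1
    (h1.mul_continuousOn hθ.continuousOn hθc)
  exact subset_tsupport θ (right_ne_zero_of_mul hx)

theorem ae_ne_top_of_mem_tsupport {g : EuclideanSpace ℝ (Fin N) → ℝ≥0∞}
    (hg : Measurable g)
    (hK : ∀ K : Set (EuclideanSpace ℝ (Fin N)), IsCompact K → K ⊆ D → (∫⁻ x in K, g x) ≠ ⊤)
    {θ : EuclideanSpace ℝ (Fin N) → ℝ} (hθc : HasCompactSupport θ) (hθD : tsupport θ ⊆ D) :
    ∀ᵐ x, θ x ≠ 0 → g x ≠ ⊤ := by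
  have h1 := ae_lt_top hg (hK _ hθc hθD)
  rw [ae_restrict_iff' (isClosed_tsupport θ).measurableSet] at h1
  filter_upwards [h1] with x hx hθx
  exact (hx (subset_tsupport θ hθx)).ne

theorem measurable_weight_mul (hρm : Measurable ρ) (hΦc : Continuous Φ)
    {u : EuclideanSpace ℝ (Fin N) → ℝ} (hu : Continuous u) :
    Measurable fun x => ENNReal.ofReal (ρ x) * Φ (u x) :=
  hρm.ennreal_ofReal.mul (hΦc.comp hu).measurable

theorem IsWeakSol.le_add (hN : 0 < N) (hα1 : 0 < α) (hα2 : α < 2)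
    (hDb : Bornology.IsBounded D) (hρm : Measurable ρ) (hΦc : Continuous Φ) (hΦa : Antitone Φ)
    {u v : EuclideanSpace ℝ (Fin N) → ℝ} (hu : IsWeakSol N α D ρ Φ u)
    (hv : IsWeakSol N α D ρ Φ v) {c : ℝ} (hc : 0 ≤ c) (hoff : ∀ x ∉ D, u x ≤ v x + c)
    (x : EuclideanSpace ℝ (Fin N)) : u x ≤ v x + c := by
  obtain ⟨huc, ⟨U, hU⟩, -, huK, hue⟩ := hu
  obtain ⟨hvc, ⟨V, hV⟩, -, hvK, hve⟩ := hv
  have hub : BddMeas u := ⟨huc.measurable, U, hU⟩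
  have hvb : BddMeas v := ⟨hvc.measurable, V, hV⟩
  have hwb : BddMeas fun x => u x - v x - c := (hub.sub hvb).sub (bddMeas_const c)
  have := nonpos_of_integral_mul_fracLap_nonneg hN hα1 hα2 hDb (w := fun x => u x - v x - c)
    ((huc.sub hvc).sub continuous_const) hwb.2 (fun x hx => by linarith [hoff x hx])
    (fun θ hθ hθc hθ0 hθs => ?_) x
  · linarith
  have hθD : tsupport θ ⊆ D := fun x hx => by_contra fun hxD => by
    have h1 : 0 < u x - v x - c := hθs hx
    linarith [hoff x hxD]
  have hθ2 : ContDiff ℝ 2 θ := by exact_mod_cast contDiff_infty.1 hθ 2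
  have e : ∀ x, (u x - v x - c) * fracLap N α θ x =
      u x * fracLap N α θ x - v x * fracLap N α θ x - c * fracLap N α θ x := fun x => by ring
  have iu := integrable_mul_fracLap hN hα1 hα2 hθ2 hθc hub
  have iv := integrable_mul_fracLap hN hα1 hα2 hθ2 hθc hvb
  have ic := integrable_mul_fracLap hN hα1 hα2 hθ2 hθc (bddMeas_const c)
  have iuv : Integrable fun x => u x * fracLap N α θ x - v x * fracLap N α θ x := iu.sub iv
  simp only [e]
  rw [integral_sub iuv ic, integral_sub iu iv, integral_const_mul,
    integral_fracLap hN hα1 hα2 hθ2 hθc, hue θ hθ hθc hθD, hve θ hθ hθc hθD]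
  have hle : ∫ x, (ENNReal.ofReal (ρ x) * Φ (u x)).toReal * θ x ≤
      ∫ x, (ENNReal.ofReal (ρ x) * Φ (v x)).toReal * θ x := by
    have mu := measurable_weight_mul hρm hΦc huc
    have mv := measurable_weight_mul hρm hΦc hvc
    refine integral_mono_ae
      (integrable_toReal_mul_of_tsupport_subset mu huK hθ.continuous hθc hθD)
      (integrable_toReal_mul_of_tsupport_subset mv hvK hθ.continuous hθc hθD) ?_
    filter_upwards [ae_ne_top_of_mem_tsupport mv hvK hθc hθD] with x hx
    by_cases h0 : θ x = 0
    · simp [h0]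
    · have h1 : 0 < u x - v x - c := hθs (subset_tsupport θ h0)
      refine mul_le_mul_of_nonneg_right (ENNReal.toReal_mono (hx h0) ?_) (hθ0 x)
      gcongr
      exact hΦa (by linarith)
  linarith

theorem IsWeakSol.unique (hN : 0 < N) (hα1 : 0 < α) (hα2 : α < 2)
    (hDb : Bornology.IsBounded D) (hρm : Measurable ρ) (hΦc : Continuous Φ) (hΦa : Antitone Φ)
    {u v : EuclideanSpace ℝ (Fin N) → ℝ} (hu : IsWeakSol N α D ρ Φ u)
    (hv : IsWeakSol N α D ρ Φ v) (hoff : ∀ x ∉ D, u x = v x) : u = v := by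
  funext x
  refine le_antisymm ?_ ?_
  · simpa using hu.le_add hN hα1 hα2 hDb hρm hΦc hΦa hv le_rfl (fun x hx => by simp [hoff x hx]) x
  · simpa using hv.le_add hN hα1 hα2 hDb hρm hΦc hΦa hu le_rfl (fun x hx => by simp [hoff x hx]) x

theorem exists_bounded_data_sol (hN : 0 < N) (hα1 : 0 < α) (hα2 : α < 2) (hρm : Measurable ρ)
    (hρnn : ∀ x, 0 ≤ ρ x) (hρlb : ∀ R : ℝ, ∃ M : ℝ, ∀ x, ‖x‖ ≤ R → ρ x ≤ M)
    (hΦc : Continuous Φ) (hΦa : Antitone Φ) (hΦt : ∀ t, 0 < t → Φ t < ⊤)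
    (hDo : IsOpen D) (hDb : Bornology.IsBounded D)
    (hdens : ∀ z₀ ∈ frontier D, ∃ θ > 0, ∃ r₁ > 0, ∀ r, 0 < r → r ≤ r₁ →
      θ * r ^ N ≤ volume.real (Dᶜ ∩ Metric.ball z₀ r))
    {f : EuclideanSpace ℝ (Fin N) → ℝ} (hfc : ContinuousOn f Dᶜ) {M : ℝ}
    (hfM : ∀ x ∈ Dᶜ, |f x| ≤ M) (hf0 : ∀ x ∈ Dᶜ, 0 ≤ f x) {ε : ℝ} (hε : 0 < ε) :
    ∃ u, IsWeakSol N α D ρ Φ u ∧ ∀ x ∉ D, u x = f x + ε := by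
  classical
  obtain ⟨β, hβ⟩ := exists_exitKernel_fracKernel hN hα1 hα2 hDo.measurableSet hDb
  obtain ⟨R, hR⟩ := hDb.subset_closedBall (0 : EuclideanSpace ℝ (Fin N))
  obtain ⟨M₁, hM₁⟩ := hρlb R
  have hρD : ∀ x ∈ D, ρ x ≤ M₁ := fun x hx => hM₁ x (mem_closedBall_zero_iff.1 (hR hx))
  have hm0 : ∀ t, max t ε ≠ 0 ∧ 0 < max t ε := fun t =>
    ⟨(lt_max_of_lt_right hε).ne', lt_max_of_lt_right hε⟩
  have h : DirichletData N α D β (D.indicator ρ) (max M₁ 0) (fun t => (Φ (max t ε)).toReal)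
      (Φ ε).toReal (fun x => Dᶜ.piecewise f 0 x + ε) (|M| + ε) :=
    { dim_pos := hN
      index_pos := hα1
      index_lt := hα2
      isOpen := hDo
      bounded := hDb
      exit := hβ
      density := hdens
      meas_weight := hρm.indicator hDo.measurableSet
      weight_nonneg := fun x => Set.indicator_nonneg (fun x _ => hρnn x) x
      weight_le := fun x => Set.indicator_le' (fun x hx => (hρD x hx).trans (le_max_left _ _))
        (fun _ _ => le_max_right _ _) x
      weight_off := fun x hx => Set.indicator_of_notMem hx ρ
      cont_nonlin := continuous_iff_continuousAt.2 fun t =>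
        (ENNReal.tendsto_toReal (hΦt _ (hm0 t).2).ne).comp
          (hΦc.comp (continuous_id.max continuous_const)).continuousAt
      anti_nonlin := fun s t hst => ENNReal.toReal_mono (hΦt _ (hm0 s).2).ne
        (hΦa (max_le_max_right ε hst))
      nonlin_nonneg := fun _ => ENNReal.toReal_nonneg
      nonlin_le := fun t => ENNReal.toReal_mono (hΦt ε hε).ne (hΦa (le_max_right t ε))
      meas_datum := (hfc.measurable_piecewise continuousOn_const
        hDo.measurableSet.compl).add_const ε
      datum_le := fun x => by
        refine (abs_add_le _ _).trans (add_le_add ?_ (abs_of_pos hε).le)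
        by_cases hx : x ∈ Dᶜ
        · rw [Set.piecewise_eq_of_mem _ _ _ hx]
          exact (hfM x hx).trans (le_abs_self M)
        · rw [Set.piecewise_eq_of_notMem _ _ _ hx]
          simp
      cont_datum := (hfc.congr (Set.piecewise_eqOn Dᶜ f 0)).add continuousOn_const }
  obtain ⟨u, huc, hub, huf, hua, hue⟩ := h.exists_weakSol
  have huf' : ∀ x ∉ D, u x = f x + ε := fun x hx => by
    rw [huf x hx, Set.piecewise_eq_of_mem _ _ _ hx]
  have huε : ∀ x, ε ≤ u x := hua ε fun x hx => by
    rw [Set.piecewise_eq_of_mem _ _ _ hx]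
    linarith [hf0 x hx]
  refine ⟨u, ⟨huc, hub, fun x => hε.le.trans (huε x), fun K hK hKD => ?_,
    fun θ hθ hθc hθD => ?_⟩, huf'⟩
  · have hle : ∫⁻ x in K, ENNReal.ofReal (ρ x) * Φ (u x) ≤
        ∫⁻ _ in K, ENNReal.ofReal M₁ * Φ ε :=
      setLIntegral_mono measurable_const fun x hx =>
        mul_le_mul' (ENNReal.ofReal_le_ofReal (hρD x (hKD hx))) (hΦa (huε x))
    refine (hle.trans_lt ?_).ne
    rw [setLIntegral_const]
    exact ENNReal.mul_lt_top (ENNReal.mul_lt_top ENNReal.ofReal_lt_top (hΦt ε hε))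
      hK.measure_lt_top
  · rw [hue θ (by exact_mod_cast contDiff_infty.1 hθ 2) hθc hθD]
    congr 1
    refine integral_congr_ae (ae_of_all _ fun x => ?_)
    by_cases hx : x ∈ D
    · simp only [Set.indicator_of_mem hx, max_eq_left (huε x), ENNReal.toReal_mul,
        ENNReal.toReal_ofReal (hρnn x)]
    · simp [image_eq_zero_of_notMem_tsupport fun hx' => hx (hθD hx')]

end SingularProblem

section SingularExistence

variable {N : ℕ} {α : ℝ} {D : Set (EuclideanSpace ℝ (Fin N))}
  {ρ : EuclideanSpace ℝ (Fin N) → ℝ} {Φ : ℝ → ℝ≥0∞}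

/-- Local integrability of the nonlinear term passes to increasing limits of weak solutions. -/
theorem lintegral_weight_mul_ne_top (hN : 0 < N) (hα1 : 0 < α) (hα2 : α < 2) (hDo : IsOpen D)
    (hρm : Measurable ρ) (hΦc : Continuous Φ) {U : ℝ}
    {u : ℕ → EuclideanSpace ℝ (Fin N) → ℝ} {v : EuclideanSpace ℝ (Fin N) → ℝ}
    (hu : ∀ n, IsWeakSol N α D ρ Φ (u n)) (hU : ∀ n x, |u n x| ≤ U)
    (huv : ∀ x, Tendsto (fun n => u n x) atTop (𝓝 (v x)))
    (hmono : ∀ x, Monotone fun n => ENNReal.ofReal (ρ x) * Φ (u n x))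
    {K : Set (EuclideanSpace ℝ (Fin N))} (hK : IsCompact K) (hKD : K ⊆ D) :
    (∫⁻ x in K, ENNReal.ofReal (ρ x) * Φ (v x)) ≠ ⊤ := by
  refine hK.induction_on (p := fun s => (∫⁻ x in s, ENNReal.ofReal (ρ x) * Φ (v x)) ≠ ⊤)
    (by simp) (fun s t hst ht => ne_top_of_le_ne_top ht (lintegral_mono_set hst))
    (fun s t hs ht => ne_top_of_le_ne_top (ENNReal.add_ne_top.2 ⟨hs, ht⟩)
      (lintegral_union_le _ s t)) fun x hx => ?_
  obtain ⟨r, hr, hrD⟩ := Metric.nhds_basis_closedBall.mem_iff.1 (hDo.mem_nhds (hKD hx))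
  let b : ContDiffBump x := ⟨r / 2, r, by positivity, by linarith⟩
  refine ⟨Metric.closedBall x (r / 2),
    mem_nhdsWithin_of_mem_nhds (Metric.closedBall_mem_nhds x (by positivity)), ?_⟩
  have hbs : ContDiff ℝ (⊤ : ℕ∞) b := b.contDiff
  have hbc : HasCompactSupport b := b.hasCompactSupport
  have hbD : tsupport b ⊆ D := by
    rw [b.tsupport_eq]
    exact hrD
  have hb2 : ContDiff ℝ 2 b := by exact_mod_cast contDiff_infty.1 hbs 2
  have hL := integrable_mul_fracLap hN hα1 hα2 hb2 hbc (bddMeas_const 1)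
  simp only [one_mul] at hL
  have hbound : ∀ n, ∫⁻ y in Metric.closedBall x (r / 2), ENNReal.ofReal (ρ y) * Φ (u n y) ≤
      ENNReal.ofReal (∫ y, U * |fracLap N α b y|) := fun n => by
    obtain ⟨huc, -, -, huK, hue⟩ := hu n
    have mu := measurable_weight_mul hρm hΦc huc
    have hi := integrable_toReal_mul_of_tsupport_subset mu huK b.continuous hbc hbD
    have h1 : ∫ y, (ENNReal.ofReal (ρ y) * Φ (u n y)).toReal * b y ≤
        ∫ y, U * |fracLap N α b y| := by
      have := hue b hbs hbc hbD
      calc _ = ∫ y, -(u n y * fracLap N α b y) := by rw [integral_neg, this, neg_neg]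
        _ ≤ _ := by
          refine integral_mono
            (integrable_mul_fracLap hN hα1 hα2 hb2 hbc ⟨huc.measurable, U, hU n⟩).neg
            (hL.abs.const_mul U) fun y => (neg_le_abs _).trans ?_
          rw [abs_mul]
          exact mul_le_mul_of_nonneg_right (hU n y) (abs_nonneg _)
    refine le_trans ?_ (ENNReal.ofReal_le_ofReal h1)
    rw [ofReal_integral_eq_lintegral_ofReal hi
      (ae_of_all _ fun y => mul_nonneg ENNReal.toReal_nonneg b.nonneg)]
    refine le_trans ?_ (setLIntegral_le_lintegral (Metric.closedBall x (r / 2)) _)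
    refine lintegral_mono_ae ?_
    have hfin := ae_lt_top mu (huK _ (isCompact_closedBall x (r / 2))
      ((Metric.closedBall_subset_closedBall (by linarith)).trans hrD))
    filter_upwards [hfin, ae_restrict_mem measurableSet_closedBall] with y hy hyb
    rw [b.one_of_mem_closedBall hyb, mul_one, ENNReal.ofReal_toReal hy.ne]
  refine ne_top_of_le_ne_top ENNReal.ofReal_ne_top (le_of_tendsto
    (lintegral_tendsto_of_tendsto_of_monotone
      (fun n => (measurable_weight_mul hρm hΦc (hu n).1).aemeasurable)
      (ae_of_all _ hmono) (ae_of_all _ fun y => ?_)) (Eventually.of_forall hbound))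
  exact ENNReal.Tendsto.const_mul ((hΦc.tendsto _).comp (huv y)) (Or.inr ENNReal.ofReal_ne_top)

theorem isWeakSol_of_tendsto (hN : 0 < N) (hα1 : 0 < α) (hα2 : α < 2) (hDo : IsOpen D)
    (hρm : Measurable ρ) (hΦc : Continuous Φ) {U : ℝ}
    {u : ℕ → EuclideanSpace ℝ (Fin N) → ℝ} {v : EuclideanSpace ℝ (Fin N) → ℝ}
    (hu : ∀ n, IsWeakSol N α D ρ Φ (u n)) (hU : ∀ n x, |u n x| ≤ U)
    (huv : ∀ x, Tendsto (fun n => u n x) atTop (𝓝 (v x))) (hvc : Continuous v)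
    (hmono : ∀ x, Monotone fun n => ENNReal.ofReal (ρ x) * Φ (u n x)) :
    IsWeakSol N α D ρ Φ v := by
  have hK := fun K (hK : IsCompact K) (hKD : K ⊆ D) =>
    lintegral_weight_mul_ne_top hN hα1 hα2 hDo hρm hΦc hu hU huv hmono hK hKD
  refine ⟨hvc, ⟨U, fun x => le_of_tendsto (huv x).abs (Eventually.of_forall fun n => hU n x)⟩,
    fun x => ge_of_tendsto (huv x) (Eventually.of_forall fun n => (hu n).2.2.1 x), hK,
    fun θ hθ hθc hθD => ?_⟩
  have hθ2 : ContDiff ℝ 2 θ := by exact_mod_cast contDiff_infty.1 hθ 2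
  have hL := integrable_mul_fracLap hN hα1 hα2 hθ2 hθc (bddMeas_const 1)
  simp only [one_mul] at hL
  have mv := measurable_weight_mul hρm hΦc hvc
  have hi := integrable_toReal_mul_of_tsupport_subset mv hK hθ.continuous hθc hθD
  have hfin := ae_ne_top_of_mem_tsupport mv hK hθc hθD
  have hlim : ∀ x, Tendsto (fun n => ENNReal.ofReal (ρ x) * Φ (u n x)) atTop
      (𝓝 (ENNReal.ofReal (ρ x) * Φ (v x))) := fun x =>
    ENNReal.Tendsto.const_mul ((hΦc.tendsto _).comp (huv x)) (Or.inr ENNReal.ofReal_ne_top)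
  have t1 : Tendsto (fun n => ∫ x, u n x * fracLap N α θ x) atTop
      (𝓝 (∫ x, v x * fracLap N α θ x)) := by
    refine tendsto_integral_of_dominated_convergence (fun x => U * |fracLap N α θ x|)
      (fun n => (hu n).1.aestronglyMeasurable.mul hL.aestronglyMeasurable) (hL.abs.const_mul U)
      (fun n => ae_of_all _ fun x => ?_) (ae_of_all _ fun x => (huv x).mul_const _)
    rw [norm_mul, Real.norm_eq_abs, Real.norm_eq_abs]
    exact mul_le_mul_of_nonneg_right (hU n x) (abs_nonneg _)
  have t2 : Tendsto (fun n => ∫ x, (ENNReal.ofReal (ρ x) * Φ (u n x)).toReal * θ x) atTop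
      (𝓝 (∫ x, (ENNReal.ofReal (ρ x) * Φ (v x)).toReal * θ x)) := by
    refine tendsto_integral_of_dominated_convergence
      (fun x => |(ENNReal.ofReal (ρ x) * Φ (v x)).toReal * θ x|) (fun n => ?_) hi.abs
      (fun n => ?_) ?_
    · exact ((measurable_weight_mul hρm hΦc (hu n).1).ennreal_toReal.mul
        hθ.continuous.measurable).aestronglyMeasurable
    · filter_upwards [hfin] with x hx
      by_cases h0 : θ x = 0
      · simp [h0]
      · rw [norm_mul, abs_mul, Real.norm_eq_abs, Real.norm_eq_abs,
          abs_of_nonneg ENNReal.toReal_nonneg, abs_of_nonneg ENNReal.toReal_nonneg]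
        exact mul_le_mul_of_nonneg_right (ENNReal.toReal_mono (hx h0)
          ((hmono x).ge_of_tendsto (hlim x) n)) (abs_nonneg _)
    · filter_upwards [hfin] with x hx
      by_cases h0 : θ x = 0
      · simp [h0]
      · exact ((ENNReal.tendsto_toReal (hx h0)).comp (hlim x)).mul_const _
  refine tendsto_nhds_unique t1 ?_
  simp only [fun n => (hu n).2.2.2.2 θ hθ hθc hθD]
  exact t2.neg

theorem exists_isWeakSol (hN : 0 < N) (hα1 : 0 < α) (hα2 : α < 2) (hρm : Measurable ρ)
    (hρnn : ∀ x, 0 ≤ ρ x) (hρlb : ∀ R : ℝ, ∃ M : ℝ, ∀ x, ‖x‖ ≤ R → ρ x ≤ M)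
    (hΦc : Continuous Φ) (hΦa : Antitone Φ) (hΦt : ∀ t, 0 < t → Φ t < ⊤)
    (hDo : IsOpen D) (hDb : Bornology.IsBounded D)
    (hdens : ∀ z₀ ∈ frontier D, ∃ θ > 0, ∃ r₁ > 0, ∀ r, 0 < r → r ≤ r₁ →
      θ * r ^ N ≤ volume.real (Dᶜ ∩ Metric.ball z₀ r))
    {f : EuclideanSpace ℝ (Fin N) → ℝ} (hfc : ContinuousOn f Dᶜ) {M : ℝ}
    (hfM : ∀ x ∈ Dᶜ, |f x| ≤ M) (hf0 : ∀ x ∈ Dᶜ, 0 ≤ f x) :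
    ∃ u, IsWeakSol N α D ρ Φ u ∧ ∀ x ∉ D, u x = f x := by
  have hε : ∀ n : ℕ, (0 : ℝ) < 1 / (n + 1) := fun n => by positivity
  have hεa : ∀ {m n : ℕ}, m ≤ n → (1 : ℝ) / (n + 1) ≤ 1 / (m + 1) := fun h =>
    Nat.one_div_le_one_div h
  have hε0 : Tendsto (fun n : ℕ => (1 : ℝ) / (n + 1)) atTop (𝓝 0) :=
    tendsto_one_div_add_atTop_nhds_zero_nat
  choose u hu huf using fun n : ℕ => exists_bounded_data_sol hN hα1 hα2 hρm hρnn hρlb hΦc hΦa hΦt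
    hDo hDb hdens hfc hfM hf0 (hε n)
  have hanti : ∀ x, Antitone fun n => u n x := fun x m n hmn => by
    simpa using (hu n).le_add hN hα1 hα2 hDb hρm hΦc hΦa (hu m) le_rfl (fun y hy => by
      rw [huf n y hy, huf m y hy]
      linarith [hεa hmn]) x
  have hgap : ∀ {m n : ℕ}, m ≤ n → ∀ x, u m x ≤ u n x + 1 / (m + 1) := fun {m n} _ x =>
    (hu m).le_add hN hα1 hα2 hDb hρm hΦc hΦa (hu n) (hε m).le (fun y hy => by
      rw [huf n y hy, huf m y hy]
      linarith [hε n]) x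
  have hbdd : ∀ x, BddBelow (Set.range fun n => u n x) := fun x =>
    ⟨0, by rintro _ ⟨n, rfl⟩; exact (hu n).2.2.1 x⟩
  have hlim : ∀ x, Tendsto (fun n => u n x) atTop (𝓝 (⨅ n, u n x)) := fun x =>
    tendsto_atTop_ciInf (hanti x) (hbdd x)
  have hunif : TendstoUniformly u (fun x => ⨅ n, u n x) atTop := by
    refine Metric.tendstoUniformly_iff.2 fun η hη => ?_
    filter_upwards [hε0.eventually_lt_const hη] with n hn x
    have h1 : (⨅ n, u n x) ≤ u n x := ciInf_le (hbdd x) n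
    have h2 : u n x ≤ (⨅ n, u n x) + 1 / (n + 1) :=
      ge_of_tendsto ((hlim x).add_const _) ((eventually_ge_atTop n).mono fun m hm => hgap hm x)
    rw [Real.dist_eq, abs_lt]
    constructor <;> linarith
  obtain ⟨U, hU⟩ := (hu 0).2.1
  refine ⟨fun x => ⨅ n, u n x, isWeakSol_of_tendsto hN hα1 hα2 hDo hρm hΦc (U := U) hu
    (fun n x => ?_) hlim (hunif.continuous (Eventually.of_forall fun n => (hu n).1).frequently)
    (fun x m n hmn => ?_), fun x hx => ?_⟩
  · rw [abs_of_nonneg ((hu n).2.2.1 x)]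
    exact (hanti x (Nat.zero_le n)).trans ((le_abs_self _).trans (hU x))
  · dsimp only
    gcongr
    exact hΦa (hanti x hmn)
  · refine tendsto_nhds_unique (hlim x) ?_
    simp only [huf _ x hx]
    simpa using hε0.const_add (f x)

end SingularExistence

theorem continuous_comp_max_zero {φ : ℝ → ℝ≥0∞} (hφc : ContinuousOn φ (Set.Ioi 0))
    (hφ0 : Tendsto φ (𝓝[>] 0) (𝓝 (φ 0))) : Continuous fun t => φ (max t 0) := by
  have hc : ContinuousOn φ (Set.Ici 0) := fun t ht => by
    rcases (Set.mem_Ici.1 ht).eq_or_lt with rfl | ht'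
    · exact continuousWithinAt_Ioi_iff_Ici.1 hφ0
    · exact (hφc.continuousAt (Ioi_mem_nhds ht')).continuousWithinAt
  exact hc.comp_continuous (continuous_id.max continuous_const) fun t =>
    Set.mem_Ici.2 (le_max_right _ _)

theorem antitone_comp_max_zero {φ : ℝ → ℝ≥0∞} (hφanti : AntitoneOn φ (Set.Ioi 0))
    (hφ0 : Tendsto φ (𝓝[>] 0) (𝓝 (φ 0))) : Antitone fun t => φ (max t 0) := by
  have ha : AntitoneOn φ (Set.Ici 0) := fun s hs t ht hst => by
    rcases (Set.mem_Ici.1 hs).eq_or_lt with rfl | hs'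
    · rcases hst.eq_or_lt with rfl | ht'
      · exact le_rfl
      · refine ge_of_tendsto hφ0 ?_
        filter_upwards [Ioo_mem_nhdsGT ht'] with r hr
        exact hφanti hr.1 ht' hr.2.le
    · exact hφanti hs' (hs'.trans_le hst) hst
  exact fun s t hst => ha (Set.mem_Ici.2 (le_max_right s 0)) (Set.mem_Ici.2 (le_max_right t 0))
    (max_le_max_right 0 hst)

/-- existence and uniqueness of the solution to the nonlinear Dirichlet
problem `Δ^{α/2}u = -ρ·φ(u)` in a bounded open set `D` satisfying the exterior cone
condition, with boundary datum `f` on `Dᶜ`. -/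
theorem stmt15 (N : ℕ) (hN : 3 ≤ N) (α : ℝ) (hα1 : 0 < α) (hα2 : α < 2)
    (ρ : EuclideanSpace ℝ (Fin N) → ℝ) (hρm : Measurable ρ) (hρnn : ∀ x, 0 ≤ ρ x)
    (hρlb : ∀ R : ℝ, ∃ M : ℝ, ∀ x : EuclideanSpace ℝ (Fin N), ‖x‖ ≤ R → ρ x ≤ M)
    (hρnt : 0 < volume {x : EuclideanSpace ℝ (Fin N) | 0 < ρ x})
    (φ : ℝ → ℝ≥0∞)
    (hφc : ContinuousOn φ (Set.Ioi 0)) (hφanti : AntitoneOn φ (Set.Ioi 0))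
    (hφpos : ∀ t : ℝ, 0 < t → 0 < φ t ∧ φ t < ⊤)
    (hφ0 : Tendsto φ (nhdsWithin 0 (Set.Ioi 0)) (nhds (φ 0))) (hφ0pos : 0 < φ 0)
    (D : Set (EuclideanSpace ℝ (Fin N))) (hDo : IsOpen D)
    (hDb : Bornology.IsBounded D)
    (hcone : ∀ z ∈ frontier D, ∃ C : Set (EuclideanSpace ℝ (Fin N)),
      C.Nonempty ∧ IsOpen C ∧ (∀ y ∈ C, ∀ t : ℝ, 0 < t → z + t • (y - z) ∈ C) ∧
      ∃ r : ℝ, 0 < r ∧ C ∩ Metric.ball z r ⊆ Dᶜ) :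
    ∀ f : EuclideanSpace ℝ (Fin N) → ℝ, ContinuousOn f Dᶜ →
      (∃ M, ∀ x ∈ Dᶜ, |f x| ≤ M) → (∀ x ∈ Dᶜ, 0 ≤ f x) →
      ∃! u : EuclideanSpace ℝ (Fin N) → ℝ,
        Continuous u ∧ (∃ M, ∀ x, |u x| ≤ M) ∧ (∀ x, 0 ≤ u x) ∧
        (∀ x ∈ Dᶜ, u x = f x) ∧
        (∀ K : Set (EuclideanSpace ℝ (Fin N)), IsCompact K → K ⊆ D →
          (∫⁻ x in K, ENNReal.ofReal (ρ x) * φ (u x)) ≠ ⊤) ∧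
        ∀ θ : EuclideanSpace ℝ (Fin N) → ℝ, ContDiff ℝ (⊤ : ℕ∞) θ →
          HasCompactSupport θ → tsupport θ ⊆ D →
          (∫ x, u x * fracLap N α θ x) =
            -∫ x in D, (ENNReal.ofReal (ρ x) * φ (u x)).toReal * θ x := by
  intro f hfc hfM hf0
  have hN0 : 0 < N := by omega
  obtain ⟨M, hM⟩ := hfM
  set Φ : ℝ → ℝ≥0∞ := fun t => φ (max t 0) with hΦ
  have hΦc : Continuous Φ := continuous_comp_max_zero hφc hφ0
  have hΦa : Antitone Φ := antitone_comp_max_zero hφanti hφ0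
  have hΦφ : ∀ t, 0 ≤ t → Φ t = φ t := fun t ht => by rw [hΦ]; simp [ht]
  have hiff : ∀ u : EuclideanSpace ℝ (Fin N) → ℝ,
      (Continuous u ∧ (∃ M, ∀ x, |u x| ≤ M) ∧ (∀ x, 0 ≤ u x) ∧
        (∀ x ∈ Dᶜ, u x = f x) ∧
        (∀ K : Set (EuclideanSpace ℝ (Fin N)), IsCompact K → K ⊆ D →
          (∫⁻ x in K, ENNReal.ofReal (ρ x) * φ (u x)) ≠ ⊤) ∧
        ∀ θ : EuclideanSpace ℝ (Fin N) → ℝ, ContDiff ℝ (⊤ : ℕ∞) θ →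
          HasCompactSupport θ → tsupport θ ⊆ D →
          (∫ x, u x * fracLap N α θ x) =
            -∫ x in D, (ENNReal.ofReal (ρ x) * φ (u x)).toReal * θ x) ↔
      IsWeakSol N α D ρ Φ u ∧ ∀ x ∉ D, u x = f x := fun u => by
    have hset : ∀ θ : EuclideanSpace ℝ (Fin N) → ℝ, tsupport θ ⊆ D →
        ∫ x in D, (ENNReal.ofReal (ρ x) * φ (u x)).toReal * θ x =
          ∫ x, (ENNReal.ofReal (ρ x) * φ (u x)).toReal * θ x := fun θ hθD =>
      setIntegral_eq_integral_of_forall_compl_eq_zero fun x hx => by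
        rw [image_eq_zero_of_notMem_tsupport fun hx' => hx (hθD hx'), mul_zero]
    constructor
    · rintro ⟨h1, h2, h3, h4, h5, h6⟩
      refine ⟨⟨h1, h2, h3, ?_, ?_⟩, h4⟩ <;> simp only [fun x => hΦφ (u x) (h3 x)]
      · exact h5
      · exact fun θ hθ hθc hθD => (h6 θ hθ hθc hθD).trans (by rw [hset θ hθD])
    · rintro ⟨⟨h1, h2, h3, h5, h6⟩, h4⟩
      simp only [fun x => hΦφ (u x) (h3 x)] at h5 h6
      exact ⟨h1, h2, h3, h4, h5,
        fun θ hθ hθc hθD => (h6 θ hθ hθc hθD).trans (by rw [hset θ hθD])⟩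
  obtain ⟨u, hu, huf⟩ := exists_isWeakSol hN0 hα1 hα2 hρm hρnn hρlb hΦc hΦa
    (fun t ht => by rw [hΦφ t ht.le]; exact (hφpos t ht).2) hDo hDb
    (fun z hz => exists_density_of_cone (hcone z hz)) hfc hM hf0
  refine ⟨u, (hiff u).2 ⟨hu, huf⟩, fun v hv => ?_⟩
  obtain ⟨hv1, hv2⟩ := (hiff v).1 hv
  exact hv1.unique hN0 hα1 hα2 hDb hρm hΦc hΦa hu fun x hx => by rw [hv2 x hx, huf x hx]
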